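/- Let Γ be a nonelementary hyperbolic group, μ a finitely supported nondegenerate probability measure on Γ, and ν the associated harmonic measure on the Gromov boundary ∂Γ. Then r(Γ,∂Γ,ν)∖{0} equals the closed multiplicative subgroup of (0,+∞) generated by {r(g) : g ∈ Γ}. In particular, r(Γ,∂Γ,ν)∖{0} ≠ {1}, i.e. the orbit equivalence relation of Γ acting on (∂Γ,ν) is never of type III₀. -/

import Mathlib

open Filter Topology MeasureTheory
open scoped ENNReal

namespace HarmonicBoundary

variable {Γ : Type} [Group Γ]

/-- Word length of `g` with respect to a generating set `S`. -/
noncomputable def wl (S : Set Γ) (g : Γ) : ℕ :=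
  sInf {n : ℕ | ∃ w : List Γ, w.length = n ∧ (∀ x ∈ w, x ∈ S) ∧ w.prod = g}

/-- Word metric `d(x,y) = |x⁻¹y|`. -/
noncomputable def wdist (S : Set Γ) (x y : Γ) : ℕ := wl S (x⁻¹ * y)

/-- Gromov product `(x|y)_z = (d(x,z)+d(y,z)-d(x,y))/2`. -/
noncomputable def gp (S : Set Γ) (z x y : Γ) : ℝ :=
  ((wdist S x z : ℝ) + (wdist S y z : ℝ) - (wdist S x y : ℝ)) / 2

/-- `S` is a finite symmetric generating set of `Γ`. -/
def IsGenSet (S : Set Γ) : Prop :=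
  S.Finite ∧ (∀ s ∈ S, s⁻¹ ∈ S) ∧ Subgroup.closure S = ⊤

/-- `Γ` is `δ`-hyperbolic with respect to the word metric of `S`:
`(x|y) ≥ min ((x|z), (y|z)) - δ` for all `x y z`. -/
def IsHyperbolic (S : Set Γ) (δ : ℝ) : Prop :=
  0 ≤ δ ∧ ∀ x y z : Γ, min (gp S 1 x z) (gp S 1 y z) - δ ≤ gp S 1 x y

/-- `Γ` is nonelementary: it has no cyclic subgroup of finite index. -/
def Nonelementary (Γ : Type) [Group Γ] : Prop :=
  ∀ g : Γ, (Subgroup.zpowers g).index = 0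

/-- A sequence converges to infinity if `(x_i|x_j) → ∞`. -/
def ConvInf (S : Set Γ) (u : ℕ → Γ) : Prop :=
  Tendsto (fun p : ℕ × ℕ => gp S 1 (u p.1) (u p.2)) atTop atTop

/-- Two sequences converging to infinity are equivalent if `(x_i|y_j) → ∞`. -/
def EquivSeq (S : Set Γ) (u v : ℕ → Γ) : Prop :=
  Tendsto (fun p : ℕ × ℕ => gp S 1 (u p.1) (v p.2)) atTop atTop

/-- An (abstract model of the) Gromov boundary of `Γ`: the points are exactly the
classes of sequences converging to infinity, modulo the equivalence `EquivSeq`,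
together with the natural left action of `Γ`. -/
structure Boundary (Γ : Type) [Group Γ] (S : Set Γ) where
  pt : Type
  cls : (ℕ → Γ) → pt
  cls_surj : ∀ ξ : pt, ∃ u : ℕ → Γ, ConvInf S u ∧ cls u = ξ
  cls_eq : ∀ u v : ℕ → Γ, ConvInf S u → ConvInf S v → (cls u = cls v ↔ EquivSeq S u v)
  smul : Γ → pt → pt
  smul_cls : ∀ (g : Γ) (u : ℕ → Γ), ConvInf S u → smul g (cls u) = cls fun n => g * u n

/-- Extension of the Gromov product to the boundary:
`(ξ|η) = sup liminf (x_i|y_j)` over sequences representing `ξ` and `η`,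
as an extended nonnegative real. -/
noncomputable def bgp {S : Set Γ} (B : Boundary Γ S) (ξ η : B.pt) : ℝ≥0∞ :=
  ⨆ (u : {u : ℕ → Γ // ConvInf S u ∧ B.cls u = ξ})
    (v : {v : ℕ → Γ // ConvInf S v ∧ B.cls v = η}),
    Filter.liminf (fun p : ℕ × ℕ => ENNReal.ofReal (gp S 1 (u.1 p.1) (v.1 p.2))) atTop

/-- Real-valued Gromov product on the boundary (finite for `ξ ≠ η`). -/
noncomputable def bgpR {S : Set Γ} (B : Boundary Γ S) (ξ η : B.pt) : ℝ := (bgp B ξ η).toReal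

/-- The canonical topology of the Gromov boundary: a set is open iff around each of
its points it contains a basic neighbourhood `V_r(p) = {q | (q|p) > r}`. -/
def btop {S : Set Γ} (B : Boundary Γ S) : TopologicalSpace B.pt where
  IsOpen O := ∀ p ∈ O, ∃ r : ℝ≥0∞, r ≠ ⊤ ∧ {q | r < bgp B q p} ⊆ O
  isOpen_univ := fun p _ => ⟨0, ENNReal.zero_ne_top, fun q _ => trivial⟩
  isOpen_inter := by
    intro A A' hA hA' p hp
    obtain ⟨r1, hr1, h1⟩ := hA p hp.1
    obtain ⟨r2, hr2, h2⟩ := hA' p hp.2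
    refine ⟨max r1 r2, (max_lt hr1.lt_top hr2.lt_top).ne, fun q hq => ?_⟩
    have hq' : max r1 r2 < bgp B q p := hq
    exact ⟨h1 (show r1 < bgp B q p from (le_max_left r1 r2).trans_lt hq'),
      h2 (show r2 < bgp B q p from (le_max_right r1 r2).trans_lt hq')⟩
  isOpen_sUnion := by
    intro s hs p hp
    obtain ⟨t, ht, hpt⟩ := hp
    obtain ⟨r, hr, hsub⟩ := hs t ht p hpt
    exact ⟨r, hr, fun q hq => ⟨t, ht, hsub hq⟩⟩

/-- The attracting fixed point `g⁺ = lim_n gⁿ` of an (infinite order) element. -/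
def plusPt {S : Set Γ} (B : Boundary Γ S) (g : Γ) : B.pt := B.cls fun n => g ^ n

/-- The repelling fixed point `g⁻ = lim_n g⁻ⁿ` of an (infinite order) element. -/
def minusPt {S : Set Γ} (B : Boundary Γ S) (g : Γ) : B.pt := B.cls fun n => g⁻¹ ^ n

/-- A geodesic ray starting at the identity. -/
def IsGeodesicRay (S : Set Γ) (x : ℕ → Γ) : Prop :=
  x 0 = 1 ∧ ∀ m n : ℕ, wdist S (x m) (x n) = Nat.dist m n

/-- A geodesic ray from `e` to the boundary point `ξ`, i.e. an element of `[e,ξ]`. -/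
def RayTo {S : Set Γ} (B : Boundary Γ S) (x : ℕ → Γ) (ξ : B.pt) : Prop :=
  IsGeodesicRay S x ∧ ConvInf S x ∧ B.cls x = ξ

/-- A geodesic segment from `x` to `y` (parametrized on `0,…,d(x,y)`),
i.e. an element of `[x,y]`. -/
def IsGeodesicSeg (S : Set Γ) (x y : Γ) (α : ℕ → Γ) : Prop :=
  α 0 = x ∧ α (wdist S x y) = y ∧
  ∀ m n : ℕ, m ≤ wdist S x y → n ≤ wdist S x y → wdist S (α m) (α n) = Nat.dist m n

/-- The boundary "cylinder" `U(ξ,R)`: all `η` such that for every pair of geodesic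
rays `x ∈ [e,ξ]`, `y ∈ [e,η]` one has `lim_n (x(n)|y(n)) > R` (the sequence
`(x(n)|y(n))` is nondecreasing, so the limit exceeds `R` iff some term does). -/
def Uset {S : Set Γ} (B : Boundary Γ S) (ξ : B.pt) (R : ℝ) : Set B.pt :=
  {η | ∀ x y : ℕ → Γ, RayTo B x ξ → RayTo B y η → ∃ n : ℕ, R < gp S 1 (x n) (y n)}

/-- `C_r(p) = {g | (g|e)_p > r}`. -/
def Cset (S : Set Γ) (p : Γ) (r : ℝ) : Set Γ := {g | r < gp S p g 1}

/-- The `R`-neighbourhood `N(α,R)` of a geodesic segment `α ∈ [x,y]`. -/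
def segN (S : Set Γ) (x y : Γ) (α : ℕ → Γ) (R : ℝ) : Set Γ :=
  {g | ∃ i ≤ wdist S x y, (wdist S g (α i) : ℝ) ≤ R}

/-- The `R`-neighbourhood `N(A,R)` of a subset `A ⊆ Γ`. -/
def setN (S : Set Γ) (A : Set Γ) (R : ℝ) : Set Γ :=
  {g | ∃ a ∈ A, (wdist S g a : ℝ) ≤ R}

/-- `μ` is a nondegenerate probability measure on `Γ` with support contained in `S`:
nonnegative, of total mass one, supported in `S`, and the semigroup generated by its
support is the whole of `Γ`. -/
structure IsRWMeasure (S : Set Γ) (μ : Γ → ℝ) : Prop where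
  nonneg : ∀ g, 0 ≤ μ g
  support_subset : ∀ g, μ g ≠ 0 → g ∈ S
  total : ∑' g : Γ, μ g = 1
  nondeg : ∀ g : Γ, ∃ l : List Γ, l ≠ [] ∧ (∀ x ∈ l, 0 < μ x) ∧ l.prod = g

open Classical in
/-- `n`-step transition probabilities `p⁽ⁿ⁾(x,y) = μ*ⁿ(x⁻¹y)` of the random walk. -/
noncomputable def ptrans (μ : Γ → ℝ) : ℕ → Γ → Γ → ℝ
  | 0 => fun x y => if x = y then 1 else 0
  | n + 1 => fun x y => ∑' z : Γ, ptrans μ n x z * μ (z⁻¹ * y)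

/-- Green function `G(x,y) = Σ_n p⁽ⁿ⁾(x,y)`. -/
noncomputable def green (μ : Γ → ℝ) (x y : Γ) : ℝ := ∑' n : ℕ, ptrans μ n x y

/-- `F(x,y) = G(x,y)/G(y,y)`, the probability that the walk from `x` ever hits `y`. -/
noncomputable def greenF (μ : Γ → ℝ) (x y : Γ) : ℝ := green μ x y / green μ y y

/-- The Martin kernel `K(x,y) = G(x,y)/G(e,y)`. -/
noncomputable def martinK (μ : Γ → ℝ) (x y : Γ) : ℝ := green μ x y / green μ 1 y

open Classical in
/-- Transition probabilities of the walk restricted to `Δ` (killed when leaving `Δ`). -/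
noncomputable def ptransR (μ : Γ → ℝ) (Δ : Set Γ) : ℕ → Γ → Γ → ℝ
  | 0 => fun x y => if x = y ∧ x ∈ Δ then 1 else 0
  | n + 1 => fun x y => if y ∈ Δ then ∑' z : Γ, ptransR μ Δ n x z * μ (z⁻¹ * y) else 0

/-- Green function `G_Δ` of the restricted walk. -/
noncomputable def greenR (μ : Γ → ℝ) (Δ : Set Γ) (x y : Γ) : ℝ := ∑' n : ℕ, ptransR μ Δ n x y

/-- `F_Δ(x,y) = G_Δ(x,y)/G_Δ(y,y)`. -/
noncomputable def greenFR (μ : Γ → ℝ) (Δ : Set Γ) (x y : Γ) : ℝ :=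
  greenR μ Δ x y / greenR μ Δ y y

/-- Generating function `G_Δ(x,y|z) = Σ_n p_Δ⁽ⁿ⁾(x,y) zⁿ`. -/
noncomputable def greenRZ (μ : Γ → ℝ) (Δ : Set Γ) (x y : Γ) (z : ℝ) : ℝ :=
  ∑' n : ℕ, ptransR μ Δ n x y * z ^ n

/-- Spectral radius `ρ(P) = lim_n p⁽ⁿ⁾(e,e)^{1/n}` of the walk. -/
noncomputable def specRad (μ : Γ → ℝ) : ℝ :=
  Filter.limsup (fun n : ℕ => (ptrans μ n 1 1) ^ ((n : ℝ)⁻¹)) atTop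

/-- `u` is harmonic on `Λ`: `Σ_h p(g,h) u(h) = u(g)` for `g ∈ Λ`, `p(g,h)=μ(g⁻¹h)`. -/
def HarmonicOn (μ : Γ → ℝ) (u : Γ → ℝ) (Λ : Set Γ) : Prop :=
  ∀ g ∈ Λ, (∑' h : Γ, μ (g⁻¹ * h) * u h) = u g

/-- `u` vanishes at infinity on `Λ`: `u(g_n) → 0` along sequences in `Λ` with `|g_n|→∞`. -/
def VanishesAtInftyOn (S : Set Γ) (u : Γ → ℝ) (Λ : Set Γ) : Prop :=
  ∀ ε : ℝ, 0 < ε → ∃ M : ℕ, ∀ g ∈ Λ, M ≤ wl S g → |u g| ≤ ε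

open Classical in
/-- `r(g) = K(g⁻¹,g⁺)` for infinite order `g`, and `r(g) = 1` for finite order `g`;
here `Kb` is the boundary extension of the Martin kernel. -/
noncomputable def rfun {S : Set Γ} (B : Boundary Γ S) (Kb : Γ → B.pt → ℝ) (g : Γ) : ℝ :=
  if IsOfFinOrder g then 1 else Kb g⁻¹ (plusPt B g)

/-- The ratio set `r(Γ,∂Γ,ν)`: all `l ≥ 0` such that for every `ε > 0` and every
Borel `A` of positive measure there is `g ∈ Γ` such that
`{ω ∈ gA ∩ A : |d(gν)/dν(ω) − l| < ε}` has positive measure; here the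
Radon–Nikodym derivative `d(gν)/dν` is the Martin kernel `Kb g`. -/
def ratioSet {S : Set Γ} (B : Boundary Γ S) [MeasurableSpace B.pt]
    (ν : Measure B.pt) (Kb : Γ → B.pt → ℝ) : Set ℝ :=
  {l : ℝ | 0 ≤ l ∧ ∀ ε : ℝ, 0 < ε → ∀ A : Set B.pt, MeasurableSet A → 0 < ν A →
    ∃ g : Γ, 0 < ν {ω | ω ∈ A ∧ B.smul g⁻¹ ω ∈ A ∧ |Kb g ω - l| < ε}}

/-- A left invariant finitely additive mean on `Γ`; `Γ` is amenable iff one exists. -/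
structure InvariantMean (Γ : Type) [Group Γ] where
  m : Set Γ → ℝ
  nonneg : ∀ A, 0 ≤ m A
  total : m Set.univ = 1
  fin_add : ∀ A B : Set Γ, Disjoint A B → m (A ∪ B) = m A + m B
  invariant : ∀ (g : Γ) (A : Set Γ), m ((g * ·) ⁻¹' A) = m A

set_option linter.unusedVariables false

section Part1


/-! ### Word metric -/

/-- Real valued word metric. -/
noncomputable def dd (S : Set Γ) (x y : Γ) : ℝ := (wdist S x y : ℝ)

lemma gp_eq (S : Set Γ) (z x y : Γ) : gp S z x y = (dd S x z + dd S y z - dd S x y) / 2 := rfl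

lemma exists_word {S : Set Γ} (hS : IsGenSet S) (g : Γ) :
    ∃ w : List Γ, (∀ x ∈ w, x ∈ S) ∧ w.prod = g := by
  have hg : g ∈ Subgroup.closure S := by rw [hS.2.2]; trivial
  induction hg using Subgroup.closure_induction with
  | mem x hx => exact ⟨[x], by simpa using hx, by simp⟩
  | one => exact ⟨[], by simp, by simp⟩
  | mul x y _ _ hx hy =>
    obtain ⟨a, ha, ha'⟩ := hx
    obtain ⟨b, hb, hb'⟩ := hy
    refine ⟨a ++ b, ?_, by simp [ha', hb']⟩
    intro z hz
    rcases List.mem_append.1 hz with h | h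
    · exact ha z h
    · exact hb z h
  | inv x _ hx =>
    obtain ⟨a, ha, ha'⟩ := hx
    refine ⟨(a.map (·⁻¹)).reverse, ?_, by rw [← List.prod_inv_reverse, ha']⟩
    intro z hz
    simp only [List.mem_reverse, List.mem_map] at hz
    obtain ⟨y, hy, rfl⟩ := hz
    exact hS.2.1 y (ha y hy)

lemma wl_word {S : Set Γ} (hS : IsGenSet S) (g : Γ) :
    ∃ w : List Γ, w.length = wl S g ∧ (∀ x ∈ w, x ∈ S) ∧ w.prod = g := by
  have hne : {n : ℕ | ∃ w : List Γ, w.length = n ∧ (∀ x ∈ w, x ∈ S) ∧ w.prod = g}.Nonempty := by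
    obtain ⟨w, hw, hw'⟩ := exists_word hS g
    exact ⟨w.length, w, rfl, hw, hw'⟩
  exact Nat.sInf_mem hne

lemma wl_le {S : Set Γ} (w : List Γ) (hw : ∀ x ∈ w, x ∈ S) : wl S w.prod ≤ w.length :=
  Nat.sInf_le ⟨w, rfl, hw, rfl⟩

lemma wl_one (S : Set Γ) : wl S (1 : Γ) = 0 := by
  have := wl_le (S := S) ([] : List Γ) (by simp)
  simpa using this

lemma wl_eq_zero {S : Set Γ} (hS : IsGenSet S) {g : Γ} (h : wl S g = 0) : g = 1 := by
  obtain ⟨w, h1, h2, h3⟩ := wl_word hS g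
  rw [h, List.length_eq_zero_iff] at h1
  rw [← h3, h1]; simp

lemma wl_mul {S : Set Γ} (hS : IsGenSet S) (g h : Γ) : wl S (g * h) ≤ wl S g + wl S h := by
  obtain ⟨w, h1, h2, h3⟩ := wl_word hS g
  obtain ⟨w', h1', h2', h3'⟩ := wl_word hS h
  have := wl_le (S := S) (w ++ w') (by
    intro z hz
    rcases List.mem_append.1 hz with h | h
    · exact h2 z h
    · exact h2' z h)
  rw [List.prod_append, h3, h3', List.length_append, h1, h1'] at this
  exact this

lemma wl_inv_le {S : Set Γ} (hS : IsGenSet S) (g : Γ) : wl S g⁻¹ ≤ wl S g := by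
  obtain ⟨w, h1, h2, h3⟩ := wl_word hS g
  have := wl_le (S := S) ((w.map (·⁻¹)).reverse) (by
    intro z hz
    simp only [List.mem_reverse, List.mem_map] at hz
    obtain ⟨y, hy, rfl⟩ := hz
    exact hS.2.1 y (h2 y hy))
  rw [← List.prod_inv_reverse, h3] at this
  simpa [h1] using this

lemma wl_inv {S : Set Γ} (hS : IsGenSet S) (g : Γ) : wl S g⁻¹ = wl S g :=
  le_antisymm (wl_inv_le hS g) (by simpa using wl_inv_le hS g⁻¹)

lemma wl_mem {S : Set Γ} {s : Γ} (hs : s ∈ S) : wl S s ≤ 1 := by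
  have := wl_le (S := S) [s] (by simpa using hs)
  simpa using this

lemma ball_finite {S : Set Γ} (hS : IsGenSet S) (n : ℕ) : {g : Γ | wl S g ≤ n}.Finite := by
  induction n with
  | zero =>
    refine (Set.finite_singleton (1 : Γ)).subset ?_
    intro g hg
    exact wl_eq_zero hS (Nat.le_zero.1 hg)
  | succ n ih =>
    refine ((ih.image2 (· * ·) hS.1).union ih).subset ?_
    intro g hg
    obtain ⟨w, h1, h2, h3⟩ := wl_word hS g
    rcases List.eq_nil_or_concat' w with rfl | ⟨l, s, rfl⟩
    · right
      simp at h1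
      simp [← h1]
    · left
      refine ⟨l.prod, ?_, s, h2 s (by simp), by simpa using h3⟩
      have h4 := wl_le (S := S) l (fun x hx => h2 x (by simp [hx]))
      simp at h1
      have : wl S g ≤ n + 1 := hg
      show wl S l.prod ≤ n
      omega

lemma geod_pt {S : Set Γ} (hS : IsGenSet S) (g : Γ) {m : ℕ} (hm : m ≤ wl S g) :
    ∃ y : Γ, wl S y = m ∧ wl S (y⁻¹ * g) = wl S g - m := by
  obtain ⟨w, h1, h2, h3⟩ := wl_word hS g
  have e : (w.take m).prod * (w.drop m).prod = g := by rw [List.prod_take_mul_prod_drop, h3]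
  have a := wl_le (S := S) (w.take m) (fun x hx => h2 x (List.mem_of_mem_take hx))
  have b := wl_le (S := S) (w.drop m) (fun x hx => h2 x (List.mem_of_mem_drop hx))
  have c := wl_mul hS (w.take m).prod (w.drop m).prod
  rw [e] at c
  rw [List.length_take] at a
  rw [List.length_drop] at b
  have e' : (w.take m).prod⁻¹ * g = (w.drop m).prod := by rw [← e]; group
  refine ⟨(w.take m).prod, ?_, ?_⟩
  · rw [h1] at a b
    have : min m (wl S g) = m := min_eq_left hm
    omega
  · rw [e']
    rw [h1] at a b
    have : min m (wl S g) = m := min_eq_left hm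
    omega

lemma dd_nonneg (S : Set Γ) (x y : Γ) : 0 ≤ dd S x y := Nat.cast_nonneg _

lemma dd_self (S : Set Γ) (x : Γ) : dd S x x = 0 := by
  simp [dd, wdist, wl_one]

lemma dd_comm {S : Set Γ} (hS : IsGenSet S) (x y : Γ) : dd S x y = dd S y x := by
  unfold dd wdist
  rw [← wl_inv hS (x⁻¹ * y)]
  simp

lemma dd_tri {S : Set Γ} (hS : IsGenSet S) (x y z : Γ) : dd S x z ≤ dd S x y + dd S y z := by
  unfold dd wdist
  have := wl_mul hS (x⁻¹ * y) (y⁻¹ * z)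
  rw [show x⁻¹ * y * (y⁻¹ * z) = x⁻¹ * z by group] at this
  exact_mod_cast this

lemma dd_left (S : Set Γ) (g x y : Γ) : dd S (g * x) (g * y) = dd S x y := by
  unfold dd wdist
  rw [show (g * x)⁻¹ * (g * y) = x⁻¹ * y by group]

lemma dd_one_left (S : Set Γ) (x : Γ) : dd S 1 x = wl S x := by
  simp [dd, wdist]

lemma dd_one_right {S : Set Γ} (hS : IsGenSet S) (x : Γ) : dd S x 1 = wl S x := by
  rw [dd_comm hS, dd_one_left]

lemma dd_eq_zero {S : Set Γ} (hS : IsGenSet S) {x y : Γ} (h : dd S x y = 0) : x = y := by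
  have h' : wl S (x⁻¹ * y) = 0 := by unfold dd wdist at h; exact_mod_cast h
  have := wl_eq_zero hS h'
  exact (inv_mul_eq_one.1 this)

lemma gp_left (S : Set Γ) (g z x y : Γ) : gp S (g * z) (g * x) (g * y) = gp S z x y := by
  simp only [gp_eq, dd_left]

lemma gp_comm {S : Set Γ} (hS : IsGenSet S) (z x y : Γ) : gp S z x y = gp S z y x := by
  simp only [gp_eq, dd_comm hS x y]; ring

lemma gp_nonneg {S : Set Γ} (hS : IsGenSet S) (z x y : Γ) : 0 ≤ gp S z x y := by
  have := dd_tri hS x z y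
  rw [dd_comm hS z y] at this
  rw [gp_eq]; linarith

lemma gp_le_left {S : Set Γ} (hS : IsGenSet S) (z x y : Γ) : gp S z x y ≤ dd S x z := by
  have := dd_tri hS y x z
  rw [dd_comm hS y x] at this
  rw [gp_eq]; linarith

lemma gp_le_right {S : Set Γ} (hS : IsGenSet S) (z x y : Γ) : gp S z x y ≤ dd S y z := by
  rw [gp_comm hS]; exact gp_le_left hS z y x

/-- hyperbolicity at any base point -/
lemma hyp_gp {S : Set Γ} {δ : ℝ} (hS : IsGenSet S) (hδ : IsHyperbolic S δ) (w x z y : Γ) :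
    min (gp S w x z) (gp S w z y) - δ ≤ gp S w x y := by
  have := hδ.2 (w⁻¹ * x) (w⁻¹ * y) (w⁻¹ * z)
  have e : ∀ a b : Γ, gp S 1 (w⁻¹ * a) (w⁻¹ * b) = gp S w a b := by
    intro a b
    rw [← gp_left S w⁻¹ w a b]; simp
  rw [e, e, e, gp_comm hS w y z] at this
  exact this

lemma fourpt {S : Set Γ} {δ : ℝ} (hS : IsGenSet S) (hδ : IsHyperbolic S δ) (x y z w : Γ) :
    dd S x y + dd S z w ≤ max (dd S x z + dd S y w) (dd S y z + dd S x w) + 2 * δ := by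
  have := hyp_gp hS hδ w x z y
  simp only [gp_eq] at this
  rcases min_choice ((dd S x w + dd S z w - dd S x z) / 2) ((dd S z w + dd S y w - dd S z y) / 2)
    with h | h
  · rw [h] at this
    have := le_max_left (dd S x z + dd S y w) (dd S y z + dd S x w)
    linarith
  · rw [h] at this
    have := le_max_right (dd S x z + dd S y w) (dd S y z + dd S x w)
    rw [dd_comm hS z y] at *
    linarith

lemma fourpt' {S : Set Γ} {δ : ℝ} (hS : IsGenSet S) (hδ : IsHyperbolic S δ) (x y z w : Γ) :
    dd S x y + dd S z w ≤ dd S x z + dd S y w + 2 * δ ∨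
    dd S x y + dd S z w ≤ dd S y z + dd S x w + 2 * δ := by
  have h := fourpt hS hδ x y z w
  rcases max_choice (dd S x z + dd S y w) (dd S y z + dd S x w) with h' | h' <;> rw [h'] at h
  · exact Or.inl h
  · exact Or.inr h

/-- Change of base point. -/
lemma gp_base {S : Set Γ} (hS : IsGenSet S) (w w' x y : Γ) :
    gp S w x y ≤ gp S w' x y + dd S w w' := by
  simp only [gp_eq]
  have := dd_tri hS x w' w
  have := dd_tri hS y w' w
  rw [dd_comm hS w' w] at *
  linarith

lemma gp_lip {S : Set Γ} (hS : IsGenSet S) (w x x' y : Γ) :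
    gp S w x y ≤ gp S w x' y + dd S x x' := by
  simp only [gp_eq]
  have := dd_tri hS x x' w
  have := dd_tri hS x' x y
  rw [dd_comm hS x' x] at *
  linarith

/-- `(x|y)_w + (x|w)_y = d(w,y)`. -/
lemma gp_add {S : Set Γ} (hS : IsGenSet S) (w x y : Γ) :
    gp S w x y + gp S y x w = dd S w y := by
  simp only [gp_eq]
  rw [dd_comm hS y w]; ring

/-- if `(x|y)_w ≤ R` and `(x|x')_w` is large, then `(x'|y)_w ≤ R + δ`. -/
lemma gp_small {S : Set Γ} {δ R : ℝ} (hS : IsGenSet S) (hδ : IsHyperbolic S δ) {w x x' y : Γ}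
    (h : gp S w x y ≤ R) (h' : R + δ < gp S w x x') : gp S w x' y ≤ R + δ := by
  have := hyp_gp hS hδ w x x' y
  rcases min_choice (gp S w x x') (gp S w x' y) with e | e <;> rw [e] at this <;> linarith

lemma gp_large {S : Set Γ} {δ R : ℝ} (hS : IsGenSet S) (hδ : IsHyperbolic S δ) {w x y z : Γ}
    (h : R ≤ gp S w x z) (h' : R ≤ gp S w z y) : R - δ ≤ gp S w x y := by
  have := hyp_gp hS hδ w x z y
  have := le_min h h'
  linarith

lemma geod_pt' {S : Set Γ} (hS : IsGenSet S) (x y : Γ) {m : ℕ} (hm : (m : ℝ) ≤ dd S x y) :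
    ∃ z : Γ, dd S x z = m ∧ dd S z y = dd S x y - m := by
  have hm' : m ≤ wl S (x⁻¹ * y) := by unfold dd wdist at hm; exact_mod_cast hm
  obtain ⟨z, h1, h2⟩ := geod_pt hS (x⁻¹ * y) hm'
  refine ⟨x * z, ?_, ?_⟩
  · unfold dd wdist; simp [h1]
  · unfold dd wdist
    rw [show (x * z)⁻¹ * y = z⁻¹ * (x⁻¹ * y) by group, h2, Nat.cast_sub hm']

lemma dd_ball_finite {S : Set Γ} (hS : IsGenSet S) (x : Γ) (R : ℝ) :
    {g : Γ | dd S x g ≤ R}.Finite := by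
  refine ((ball_finite hS ⌈R⌉₊).image (x * ·)).subset ?_
  intro g hg
  refine ⟨x⁻¹ * g, ?_, by simp⟩
  have : (wl S (x⁻¹ * g) : ℝ) ≤ R := hg
  have h := this.trans (Nat.le_ceil R)
  exact_mod_cast h

lemma Γ_countable {S : Set Γ} (hS : IsGenSet S) : Countable Γ := by
  rw [← Set.countable_univ_iff]
  have : (Set.univ : Set Γ) = ⋃ n : ℕ, {g | wl S g ≤ n} := by
    ext g; simp only [Set.mem_univ, Set.mem_iUnion, true_iff]; exact ⟨wl S g, le_refl (wl S g)⟩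
  rw [this]
  exact Set.countable_iUnion fun n => (ball_finite hS n).countable

end Part1

section Part2


/-! ### Sequences converging to infinity -/

lemma tendsto_pair_iff (f : ℕ × ℕ → ℝ) :
    Tendsto f atTop atTop ↔ ∀ R : ℝ, ∃ N : ℕ, ∀ i j, N ≤ i → N ≤ j → R ≤ f (i, j) := by
  rw [tendsto_atTop]
  constructor
  · intro h R
    obtain ⟨⟨a, b⟩, hab⟩ := (eventually_atTop.1 (h R))
    exact ⟨max a b, fun i j hi hj => hab (i, j) ⟨(le_max_left a b).trans hi, (le_max_right a b).trans hj⟩⟩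
  · intro h R
    obtain ⟨N, hN⟩ := h R
    exact eventually_atTop.2 ⟨(N, N), fun p hp => hN p.1 p.2 hp.1 hp.2⟩

lemma convInf_iff (S : Set Γ) (u : ℕ → Γ) :
    ConvInf S u ↔ ∀ R : ℝ, ∃ N : ℕ, ∀ i j, N ≤ i → N ≤ j → R ≤ gp S 1 (u i) (u j) :=
  tendsto_pair_iff _

lemma equivSeq_iff (S : Set Γ) (u v : ℕ → Γ) :
    EquivSeq S u v ↔ ∀ R : ℝ, ∃ N : ℕ, ∀ i j, N ≤ i → N ≤ j → R ≤ gp S 1 (u i) (v j) :=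
  tendsto_pair_iff _

lemma EquivSeq.symm' {S : Set Γ} (hS : IsGenSet S) {u v : ℕ → Γ} (h : EquivSeq S u v) :
    EquivSeq S v u := by
  rw [equivSeq_iff] at *
  intro R
  obtain ⟨N, hN⟩ := h R
  exact ⟨N, fun i j hi hj => by rw [gp_comm hS]; exact hN j i hj hi⟩

lemma EquivSeq.trans' {S : Set Γ} {δ : ℝ} (hS : IsGenSet S) (hδ : IsHyperbolic S δ)
    {u v w : ℕ → Γ} (h : EquivSeq S u v) (h' : EquivSeq S v w) :
    EquivSeq S u w := by
  rw [equivSeq_iff] at *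
  intro R
  obtain ⟨N, hN⟩ := h (R + δ)
  obtain ⟨N', hN'⟩ := h' (R + δ)
  refine ⟨max N N', fun i j hi hj => ?_⟩
  have h1 := hN i (max N N') ((le_max_left _ _).trans hi) (le_max_left _ _)
  have h2 := hN' (max N N') j (le_max_right _ _) ((le_max_right _ _).trans hj)
  have := gp_large hS hδ h1 h2
  linarith

lemma ConvInf.mul_left {S : Set Γ} (hS : IsGenSet S) {u : ℕ → Γ} (h : ConvInf S u) (g : Γ) :
    ConvInf S (fun n => g * u n) := by
  rw [convInf_iff] at *
  intro R
  obtain ⟨N, hN⟩ := h (R + dd S 1 g⁻¹)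
  refine ⟨N, fun i j hi hj => ?_⟩
  have h1 := hN i j hi hj
  have h2 := gp_base hS 1 g⁻¹ (u i) (u j)
  have h3 : gp S 1 (g * u i) (g * u j) = gp S g⁻¹ (u i) (u j) := by
    rw [← gp_left S g⁻¹ 1]; simp
  rw [h3]; linarith

/-- bounded perturbation -/
lemma equivSeq_of_bdd {S : Set Γ} (hS : IsGenSet S) {u v : ℕ → Γ} (h : ConvInf S u) (C : ℝ)
    (hb : ∀ n, dd S (u n) (v n) ≤ C) : EquivSeq S u v := by
  rw [equivSeq_iff]
  rw [convInf_iff] at h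
  intro R
  obtain ⟨N, hN⟩ := h (R + C)
  refine ⟨N, fun i j hi hj => ?_⟩
  have h1 := hN i j hi hj
  have h2 := gp_lip hS 1 (u j) (v j) (u i)
  rw [gp_comm hS 1 (u j), gp_comm hS 1 (v j)] at h2
  have := hb j
  linarith

lemma convInf_of_equiv {S : Set Γ} {δ : ℝ} (hS : IsGenSet S) (hδ : IsHyperbolic S δ)
    {u v : ℕ → Γ} (h : EquivSeq S u v) : ConvInf S u :=
  EquivSeq.trans' hS hδ h (h.symm' hS)

lemma ConvInf.comp' {S : Set Γ} {u : ℕ → Γ} (h : ConvInf S u) {f : ℕ → ℕ}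
    (hf : Tendsto f atTop atTop) : ConvInf S (u ∘ f) ∧ EquivSeq S u (u ∘ f) := by
  rw [convInf_iff, equivSeq_iff] at *
  have key : ∀ R : ℝ, ∃ N : ℕ, ∀ i j, N ≤ i → N ≤ j →
      R ≤ gp S 1 (u (f i)) (u (f j)) ∧ R ≤ gp S 1 (u i) (u (f j)) := by
    intro R
    obtain ⟨N, hN⟩ := h R
    obtain ⟨M, hM⟩ := eventually_atTop.1 (hf.eventually_ge_atTop N)
    refine ⟨max N M, fun i j hi hj => ?_⟩
    have hi' := hM i ((le_max_right _ _).trans hi)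
    have hj' := hM j ((le_max_right _ _).trans hj)
    exact ⟨hN _ _ hi' hj', hN _ _ ((le_max_left _ _).trans hi) hj'⟩
  exact ⟨fun R => (key R).imp fun N h i j hi hj => (h i j hi hj).1,
    fun R => (key R).imp fun N h i j hi hj => (h i j hi hj).2⟩

/-! ### Loxodromic elements -/

/-- quantitative loxodromicity -/
def Lox (S : Set Γ) (g : Γ) : Prop :=
  ∃ c C : ℝ, 0 < c ∧ ∀ m n : ℕ, c * min m n - C ≤ gp S 1 (g ^ m) (g ^ n) ∧
    gp S 1 (g⁻¹ ^ m) (g ^ n) ≤ C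

lemma lox_growth {S : Set Γ} {δ : ℝ} (hS : IsGenSet S) (hδ : IsHyperbolic S δ) {h : Γ}
    (hh : dd S 1 h + 4 * δ + 1 ≤ dd S 1 (h ^ 2)) (n : ℕ) (hn : 1 ≤ n) :
    dd S 1 (h ^ n) + 2 * δ + 1 ≤ dd S 1 (h ^ (n + 1)) := by
  have hδ0 := hδ.1
  induction n, hn using Nat.le_induction with
  | base => simp only [pow_one]; norm_num; linarith
  | succ n hn ih =>
    have e1 : dd S h (h ^ (n + 2)) = dd S 1 (h ^ (n + 1)) := by
      rw [← dd_left S h 1]; simp [pow_succ']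
    have e2 : dd S (h ^ 2) (h ^ (n + 2)) = dd S 1 (h ^ n) := by
      rw [← dd_left S (h ^ 2) 1]; simp [← pow_add, add_comm]
    have e3 : dd S (h ^ 2) h = dd S 1 h := by
      rw [dd_comm hS, ← dd_left S h 1]; simp [pow_two]
    rcases fourpt' hS hδ 1 (h ^ 2) h (h ^ (n + 2)) with h' | h'
    · rw [e1, e2] at h'; linarith
    · rw [e1, e3] at h'
      show dd S 1 (h ^ (n + 1)) + 2 * δ + 1 ≤ dd S 1 (h ^ (n + 2))
      linarith

lemma dd_pow {S : Set Γ} (h : Γ) {i j : ℕ} (hij : i ≤ j) :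
    dd S (h ^ i) (h ^ j) = dd S 1 (h ^ (j - i)) := by
  rw [← dd_left S (h ^ i) 1]; simp [← pow_add, Nat.add_sub_cancel' hij]

lemma dd_inv {S : Set Γ} (hS : IsGenSet S) (h : Γ) : dd S 1 h⁻¹ = dd S 1 h := by
  rw [dd_one_left, dd_one_left, wl_inv hS]

lemma dd_inv_pow {S : Set Γ} (h : Γ) (m n : ℕ) :
    dd S (h⁻¹ ^ m) (h ^ n) = dd S 1 (h ^ (m + n)) := by
  rw [← dd_left S (h⁻¹ ^ m) 1]; simp [pow_add]

lemma lox_of_growth {S : Set Γ} {δ : ℝ} (hS : IsGenSet S) (hδ : IsHyperbolic S δ) {h : Γ}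
    (hh : dd S 1 h + 4 * δ + 1 ≤ dd S 1 (h ^ 2)) : Lox S h := by
  have hδ0 := hδ.1
  have gr := lox_growth hS hδ hh
  have gr0 : ∀ n, dd S 1 (h ^ n) ≤ dd S 1 (h ^ (n + 1)) := by
    intro n
    rcases Nat.eq_zero_or_pos n with rfl | hn
    · simp [dd_self, dd_nonneg]
    · have := gr n hn; linarith
  have mono : Monotone fun n => dd S 1 (h ^ n) := monotone_nat_of_le_succ gr0
  have lin : ∀ n : ℕ, (n : ℝ) - 1 ≤ dd S 1 (h ^ n) := by
    intro n
    induction n with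
    | zero => simp [dd_self]
    | succ n ih =>
      rcases Nat.eq_zero_or_pos n with rfl | hn
      · simp [dd_nonneg]
      · have := gr n hn; push_cast; linarith
  have main : ∀ m n : ℕ, m ≤ n → (1/2) * (m : ℝ) - 1/2 ≤ gp S 1 (h ^ m) (h ^ n) := by
    intro m n hmn
    rw [gp_eq, dd_pow h hmn, dd_comm hS _ 1, dd_comm hS _ 1]
    have := mono (Nat.sub_le n m)
    have := lin m
    simp only at *
    linarith
  have hmin : ∀ m n : ℕ, (1/2) * ((min m n : ℕ) : ℝ) - 1/2 ≤ gp S 1 (h ^ m) (h ^ n) := by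
    intro m n
    rcases le_total m n with hmn | hmn
    · rw [min_eq_left hmn]; exact main m n hmn
    · rw [min_eq_right hmn, gp_comm hS]; exact main n m hmn
  have inv1 : ∀ m : ℕ, dd S 1 (h⁻¹ ^ m) = dd S 1 (h ^ m) := by
    intro m; rw [inv_pow, dd_inv hS]
  -- opposite side
  have opp : ∀ m n : ℕ, gp S 1 (h⁻¹ ^ m) (h ^ n) ≤ dd S 1 h + δ := by
    intro m n
    rcases Nat.eq_zero_or_pos m with rfl | hm
    · have := gp_le_left hS 1 (h⁻¹ ^ 0) (h ^ n)
      simp only [pow_zero, dd_self] at this ⊢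
      have := dd_nonneg S 1 h; linarith
    rcases Nat.eq_zero_or_pos n with rfl | hn
    · have := gp_le_right hS 1 (h⁻¹ ^ m) (h ^ 0)
      simp only [pow_zero, dd_self] at this ⊢
      have := dd_nonneg S 1 h; linarith
    have h1 : gp S 1 h⁻¹ (h ^ n) ≤ (dd S 1 h - (2 * δ + 1)) / 2 := by
      have e := dd_inv_pow (S := S) h 1 n
      rw [pow_one, add_comm 1 n] at e
      rw [gp_eq, e, dd_comm hS _ 1, dd_comm hS _ 1, dd_inv hS]
      have := gr n hn
      linarith
    have h2 : (dd S 1 h) / 2 ≤ gp S 1 h⁻¹ (h⁻¹ ^ m) := by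
      have e := dd_pow (S := S) h⁻¹ hm
      rw [pow_one, inv1] at e
      rw [gp_eq, e, dd_comm hS _ 1, dd_comm hS _ 1, dd_inv hS, inv1]
      have := mono (Nat.sub_le m 1)
      simp only at this
      linarith
    have := gp_small hS hδ h1 (x' := h⁻¹ ^ m) (by linarith)
    have := dd_nonneg S 1 h
    linarith
  refine ⟨1/2, max (1/2) (dd S 1 h + δ), by norm_num, fun m n => ⟨?_, (opp m n).trans (le_max_right _ _)⟩⟩
  have := hmin m n
  have := le_max_left (1/2) (dd S 1 h + δ)
  push_cast at *
  linarith

end Part2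

section Part3


/-- If a conjugate of a positive power is loxodromic, so is `g`. -/
lemma lox_of_conj_pow {S : Set Γ} (hS : IsGenSet S) {g x : Γ} {k : ℕ} (hk : 1 ≤ k)
    (h : Lox S (x⁻¹ * g ^ k * x)) : Lox S g := by
  obtain ⟨c, C, hc, hC⟩ := h
  set h := x⁻¹ * g ^ k * x with hh
  -- the finite correction
  set D : ℝ := ∑ r ∈ Finset.range k, (dd S 1 (x⁻¹ * g ^ r) + dd S 1 (x⁻¹ * g⁻¹ ^ r)) with hD
  have hDle : ∀ r < k, dd S 1 (x⁻¹ * g ^ r) ≤ D ∧ dd S 1 (x⁻¹ * g⁻¹ ^ r) ≤ D := by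
    intro r hr
    have : dd S 1 (x⁻¹ * g ^ r) + dd S 1 (x⁻¹ * g⁻¹ ^ r) ≤ D :=
      Finset.single_le_sum (f := fun r => dd S 1 (x⁻¹ * g ^ r) + dd S 1 (x⁻¹ * g⁻¹ ^ r))
        (fun i _ => add_nonneg (dd_nonneg S _ _) (dd_nonneg S _ _)) (Finset.mem_range.2 hr)
    constructor <;> linarith [dd_nonneg S 1 (x⁻¹ * g ^ r), dd_nonneg S 1 (x⁻¹ * g⁻¹ ^ r)]
  have hpow : ∀ q : ℕ, x * h ^ q = g ^ (k * q) * x := by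
    intro q
    have : h = x⁻¹ * g ^ k * (x⁻¹)⁻¹ := by simp [hh]
    rw [this, conj_pow, pow_mul]; simp [mul_assoc]
  have hpow' : ∀ q : ℕ, x * h⁻¹ ^ q = g⁻¹ ^ (k * q) * x := by
    intro q
    have : h⁻¹ = x⁻¹ * (g⁻¹) ^ k * (x⁻¹)⁻¹ := by simp [hh, mul_assoc]
    rw [this, conj_pow, pow_mul]; simp [mul_assoc]
  have near : ∀ n : ℕ, dd S (g ^ n) (x * h ^ (n / k)) ≤ D := by
    intro n
    have := (hDle (n % k) (Nat.mod_lt _ hk)).1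
    have e : g ^ n = x * h ^ (n / k) * (x⁻¹ * g ^ (n % k)) := by
      rw [hpow]; simp only [mul_assoc, mul_inv_cancel_left]
      rw [← pow_add, Nat.div_add_mod]
    rw [e, dd_comm hS]
    have e2 := dd_left S (x * h ^ (n / k)) 1 (x⁻¹ * g ^ (n % k))
    rw [mul_one] at e2
    rw [e2]; exact this
  have near' : ∀ n : ℕ, dd S (g⁻¹ ^ n) (x * h⁻¹ ^ (n / k)) ≤ D := by
    intro n
    have := (hDle (n % k) (Nat.mod_lt _ hk)).2
    have e : g⁻¹ ^ n = x * h⁻¹ ^ (n / k) * (x⁻¹ * g⁻¹ ^ (n % k)) := by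
      rw [hpow']; simp only [mul_assoc, mul_inv_cancel_left]
      rw [← pow_add, Nat.div_add_mod]
    rw [e, dd_comm hS]
    have e2 := dd_left S (x * h⁻¹ ^ (n / k)) 1 (x⁻¹ * g⁻¹ ^ (n % k))
    rw [mul_one] at e2
    rw [e2]; exact this
  -- comparison of Gromov products
  have comp : ∀ a a' b b' : Γ, dd S a (x * a') ≤ D → dd S b (x * b') ≤ D →
      |gp S 1 a b - gp S 1 a' b'| ≤ 2 * D + dd S 1 x⁻¹ := by
    intro a a' b b' ha hb
    have e : gp S 1 (x * a') (x * b') = gp S x⁻¹ a' b' := by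
      rw [← gp_left S x⁻¹ 1]; simp
    have h1 := gp_base hS 1 x⁻¹ a' b'
    have h2 := gp_base hS x⁻¹ 1 a' b'
    rw [dd_comm hS x⁻¹ 1] at h2
    have h3 := gp_lip hS 1 a (x * a') b
    have h3' := gp_lip hS 1 (x * a') a b
    rw [dd_comm hS _ a] at h3'
    have h4 := gp_lip hS 1 b (x * b') (x * a')
    have h4' := gp_lip hS 1 (x * b') b (x * a')
    rw [dd_comm hS _ b] at h4'
    rw [gp_comm hS 1 b, gp_comm hS 1 (x * b')] at h4 h4'
    rw [e] at h4 h4'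
    rw [abs_le]; constructor <;> linarith
  have hk0 : (0 : ℝ) < k := by exact_mod_cast hk
  refine ⟨c / k, C + c + (2 * D + dd S 1 x⁻¹), by positivity, fun m n => ⟨?_, ?_⟩⟩
  · have h1 := (hC (m / k) (n / k)).1
    have h2 := abs_le.1 (comp _ _ _ _ (near m) (near n))
    have h3 : c / k * (min (m : ℝ) n) - c ≤ c * min ((m / k : ℕ) : ℝ) ((n / k : ℕ) : ℝ) := by
      have key : ∀ a : ℕ, (a : ℝ) / k - 1 ≤ ((a / k : ℕ) : ℝ) := by
        intro a
        have : a < k * (a / k) + k := Nat.lt_mul_div_succ a hk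
        have : (a : ℝ) < k * ((a / k : ℕ) : ℝ) + k := by exact_mod_cast this
        rw [div_sub_one hk0.ne', div_le_iff₀ hk0]
        linarith
      have : min (m : ℝ) n / k - 1 ≤ min ((m / k : ℕ) : ℝ) ((n / k : ℕ) : ℝ) := by
        apply le_min
        · refine le_trans ?_ (key m)
          gcongr; exact min_le_left _ _
        · refine le_trans ?_ (key n)
          gcongr; exact min_le_right _ _
      have := mul_le_mul_of_nonneg_left this hc.le
      calc _ = c * (min (m : ℝ) n / k - 1) := by ring
        _ ≤ _ := this
    rw [Nat.cast_min] at h1 ⊢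
    linarith [h2.1]
  · have h1 := (hC (m / k) (n / k)).2
    have h2 := abs_le.1 (comp _ _ _ _ (near' m) (near n))
    linarith [h2.2]

lemma pow_inj_of_inf {g : Γ} (hg : ¬ IsOfFinOrder g) : Function.Injective fun n : ℕ => g ^ n :=
  injective_pow_iff_not_isOfFinOrder.2 hg

lemma exists_pow_far {S : Set Γ} (hS : IsGenSet S) {g : Γ} (hg : ¬ IsOfFinOrder g) (R : ℝ) :
    ∃ m : ℕ, R < dd S 1 (g ^ m) := by
  by_contra hcon
  push Not at hcon
  have : (Set.range fun n : ℕ => g ^ n).Finite :=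
    (dd_ball_finite hS 1 R).subset (by rintro _ ⟨n, rfl⟩; exact hcon n)
  exact Set.infinite_range_of_injective (pow_inj_of_inf hg) this

/-- Main estimate for infinite order elements -/
lemma axis_est {S : Set Γ} {δ : ℝ} (hS : IsGenSet S) (hδ : IsHyperbolic S δ) {P Q y h : Γ} {L : ℝ}
    (hPQ : dd S P y + dd S y Q ≤ dd S P Q)
    (h1 : dd S P (h * P) ≤ L) (h2 : dd S P (h ^ 2 * P) ≤ L)
    (h1' : dd S Q (h * Q) ≤ L) (h2' : dd S Q (h ^ 2 * Q) ≤ L)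
    (hP : 2 * L + 10 * δ + 1 ≤ dd S P y) (hQ : 2 * L + 10 * δ + 1 ≤ dd S y Q)
    (hy : dd S y (h ^ 2 * y) ≤ dd S y (h * y) + 4 * δ + 1) :
    dd S y (h * y) ≤ 18 * δ + 1 := by
  have hδ0 := hδ.1
  have hL0 : 0 ≤ L := (dd_nonneg S _ _).trans h1
  have hmid : ∀ f : Γ, dd S P (f * P) ≤ L → dd S Q (f * Q) ≤ L → gp S (f * y) P Q ≤ 2 * δ := by
    intro f hP' hQ'
    have e0 : gp S (f * y) (f * P) (f * Q) ≤ 0 := by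
      rw [gp_left, gp_eq]; rw [dd_comm hS Q y]; linarith
    have eP : dd S (f * P) (f * y) = dd S P y := dd_left S f P y
    have eQ : dd S (f * Q) (f * y) = dd S y Q := by rw [dd_left, dd_comm hS]
    have a1 : gp S (f * y) P (f * Q) ≤ 0 + δ := by
      apply gp_small hS hδ e0
      rw [gp_eq, eP, dd_comm hS (f * P) P]
      have := dd_tri hS (f * P) P (f * y)
      rw [eP, dd_comm hS (f * P) P] at this
      linarith
    have a2 : gp S (f * y) Q P ≤ 0 + δ + δ := by
      rw [gp_comm hS] at a1
      apply gp_small hS hδ a1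
      rw [gp_eq, eQ, dd_comm hS (f * Q) Q]
      have := dd_tri hS (f * Q) Q (f * y)
      rw [eQ, dd_comm hS (f * Q) Q] at this
      linarith
    rw [gp_comm hS]; linarith
  have m0 : gp S y P Q ≤ 2 * δ := by
    have := hmid 1 (by simpa [dd_self] using hL0) (by simpa [dd_self] using hL0); simpa using this
  have m1 := hmid h h1 h1'
  have m2 := hmid (h ^ 2) h2 h2'
  have cl : ∀ a b : Γ, gp S a P Q ≤ 2 * δ → gp S b P Q ≤ 2 * δ →
      dd S a b ≤ |dd S P a - dd S P b| + 6 * δ := by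
    intro a b ha hb
    rw [gp_eq] at ha hb
    rw [dd_comm hS Q a] at ha
    rw [dd_comm hS Q b] at hb
    rcases fourpt' hS hδ a b P Q with h | h
    · rw [dd_comm hS a P] at h
      linarith [le_abs_self (dd S P a - dd S P b)]
    · rw [dd_comm hS b P] at h
      linarith [neg_abs_le (dd S P a - dd S P b)]
  have c1 := cl y (h * y) m0 m1
  -- shift
  have t1 : |dd S P y - dd S P (h * y)| ≤ L := by
    have e := dd_left S h P y
    have a := dd_tri hS P (h * P) (h * y)
    have b := dd_tri hS (h * P) P (h * y)
    rw [dd_comm hS (h * P) P] at b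
    rw [abs_le]; constructor <;> linarith
  set P' := h⁻¹ * P with hP'
  have ePP' : dd S P P' ≤ L := by
    rw [← dd_left S h P P', hP']; simp only [mul_inv_cancel_left]; rw [dd_comm hS]; exact h1
  have e1 : dd S P' y = dd S P (h * y) := by
    rw [← dd_left S h P' y, hP']; simp
  have e2 : dd S P' (h * y) = dd S P (h ^ 2 * y) := by
    rw [← dd_left S h P' (h * y), hP']; simp [pow_two, mul_assoc]
  have t1' := abs_le.1 t1
  have f1 : dd S P (h ^ 2 * y) + dd S P y ≤ 2 * dd S P (h * y) + 2 * δ := by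
    rcases fourpt' hS hδ P' (h * y) y P with hh | hh
    · rw [e2, e1, dd_comm hS y P, dd_comm hS (h * y) P] at hh; linarith
    · rw [e2, dd_comm hS y P, dd_comm hS (h * y) y, dd_comm hS P' P] at hh
      have hh2 := dd_tri hS P P' (h * y)
      linarith
  have f2 : 2 * dd S P (h * y) ≤ dd S P (h ^ 2 * y) + dd S P y + 2 * δ := by
    rcases fourpt' hS hδ P' y (h * y) P with hh | hh
    · rw [e1, e2, dd_comm hS y P, dd_comm hS (h * y) P] at hh; linarith
    · rw [e1, dd_comm hS (h * y) P, dd_comm hS P' P] at hh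
      have hh2 := dd_tri hS P P' (h * y)
      linarith
  have g2 : |dd S P y - dd S P (h ^ 2 * y)| ≤ dd S y (h ^ 2 * y) := by
    have a := dd_tri hS P y (h ^ 2 * y)
    have b := dd_tri hS P (h ^ 2 * y) y
    rw [dd_comm hS (h ^ 2 * y) y] at b
    rw [abs_le]; constructor <;> linarith
  have g2' := abs_le.1 g2
  rcases abs_cases (dd S P y - dd S P (h * y)) with ⟨ha, _⟩ | ⟨ha, _⟩ <;> rw [ha] at c1 <;> linarith

theorem lox_of_inf {S : Set Γ} {δ : ℝ} (hS : IsGenSet S) (hδ : IsHyperbolic S δ) {g : Γ}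
    (hg : ¬ IsOfFinOrder g) : Lox S g := by
  have hδ0 := hδ.1
  by_contra hcon
  have hno : ∀ (x : Γ) (k : ℕ), 1 ≤ k →
      dd S x ((g ^ k) ^ 2 * x) ≤ dd S x (g ^ k * x) + 4 * δ + 1 := by
    intro x k hk
    by_contra hlt
    push Not at hlt
    apply hcon
    apply lox_of_conj_pow hS hk (x := x)
    apply lox_of_growth hS hδ
    have e1 : dd S 1 (x⁻¹ * g ^ k * x) = dd S x (g ^ k * x) := by
      rw [← dd_left S x 1]; simp [mul_assoc]
    have e2 : dd S 1 ((x⁻¹ * g ^ k * x) ^ 2) = dd S x ((g ^ k) ^ 2 * x) := by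
      rw [← dd_left S x 1]; simp [pow_two, mul_assoc]
    rw [e1, e2]; linarith
  have hfin := dd_ball_finite hS 1 (18 * δ + 1)
  set N := hfin.toFinset.card with hN
  set L : ℝ := ∑ k ∈ Finset.range (2 * (N + 1) + 1), dd S 1 (g ^ k) with hL
  have hLle : ∀ k ≤ 2 * (N + 1), dd S 1 (g ^ k) ≤ L := fun k hk =>
    Finset.single_le_sum (f := fun k => dd S 1 (g ^ k)) (fun i _ => dd_nonneg S _ _)
      (Finset.mem_range.2 (by omega))
  have hL0 : 0 ≤ L := (dd_nonneg S _ _).trans (hLle 0 (by omega))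
  obtain ⟨m, hm⟩ := exists_pow_far hS hg (4 * L + 20 * δ + 6)
  set T := wdist S 1 (g ^ m) with hT
  have hTr : dd S 1 (g ^ m) = (T : ℝ) := rfl
  have hhalf : ((T / 2 : ℕ) : ℝ) ≤ dd S 1 (g ^ m) := by
    rw [hTr]; exact_mod_cast Nat.div_le_self T 2
  obtain ⟨y, hy1, hy2⟩ := geod_pt' hS 1 (g ^ m) hhalf
  have hT2 : (T : ℝ) ≤ 2 * ((T / 2 : ℕ) : ℝ) + 1 := by
    have : T ≤ 2 * (T / 2) + 1 := by omega
    exact_mod_cast this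
  have hT3 : 2 * ((T / 2 : ℕ) : ℝ) ≤ T := by
    have : 2 * (T / 2) ≤ T := by omega
    exact_mod_cast this
  have bd : ∀ k : ℕ, 1 ≤ k → k ≤ N + 1 → dd S y (g ^ k * y) ≤ 18 * δ + 1 := by
    intro k hk hkN
    have q1 : ∀ j : ℕ, dd S (g ^ m) (g ^ j * g ^ m) = dd S 1 (g ^ j) := by
      intro j
      rw [← dd_left S (g ^ m) 1]; simp [← pow_add, add_comm]
    apply axis_est hS hδ (P := 1) (Q := g ^ m) (L := L)
    · rw [hy1, hy2]; linarith
    · rw [mul_one]; exact hLle k (by omega)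
    · rw [mul_one, ← pow_mul]; exact hLle _ (by omega)
    · rw [q1]; exact hLle k (by omega)
    · rw [← pow_mul, q1]; exact hLle _ (by omega)
    · rw [hy1]; linarith
    · rw [hy2]; linarith
    · exact hno y k hk
  have hinj : Set.InjOn (fun k : ℕ => y⁻¹ * g ^ k * y) (Finset.Icc 1 (N + 1) : Finset ℕ) := by
    intro a _ b _ hab
    simp only [mul_left_inj, mul_right_inj] at hab
    exact pow_inj_of_inf hg hab
  have hcard := Finset.card_le_card_of_injOn (fun k : ℕ => y⁻¹ * g ^ k * y)
    (s := Finset.Icc 1 (N + 1)) (t := hfin.toFinset) (by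
      intro k hk
      have hk' := Finset.mem_Icc.1 (Finset.mem_coe.1 hk)
      simp only [Set.Finite.coe_toFinset, Set.mem_ofPred_eq]
      rw [← dd_left S y 1]
      simpa [mul_assoc] using bd k hk'.1 hk'.2) hinj
  rw [Nat.card_Icc] at hcard
  omega

lemma Lox.not_fin {S : Set Γ} (hS : IsGenSet S) {g : Γ} (h : Lox S g) : ¬ IsOfFinOrder g := by
  obtain ⟨c, C, hc, hC⟩ := h
  intro hfin
  obtain ⟨n, hn, hgn⟩ := isOfFinOrder_iff_pow_eq_one.1 hfin
  obtain ⟨k, hk⟩ := exists_nat_gt (C / c)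
  have h1 := (hC (n * k) (n * k)).1
  have h2 : gp S 1 (g ^ (n * k)) (g ^ (n * k)) = 0 := by
    rw [pow_mul, hgn, one_pow, gp_eq]; simp [dd_self]
  rw [h2] at h1
  have h3 : C < c * k := by rwa [div_lt_iff₀' hc] at hk
  have h4 : (k : ℝ) ≤ min ((n * k : ℕ) : ℝ) ((n * k : ℕ) : ℝ) := by
    rw [min_self]; exact_mod_cast Nat.le_mul_of_pos_left k hn
  have := mul_le_mul_of_nonneg_left h4 hc.le
  rw [Nat.cast_min] at h1
  linarith

lemma Lox.convInf {S : Set Γ} {g : Γ} (h : Lox S g) : ConvInf S fun n => g ^ n := by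
  obtain ⟨c, C, hc, hC⟩ := h
  rw [convInf_iff]
  intro R
  obtain ⟨k, hk⟩ := exists_nat_gt ((R + C) / c)
  refine ⟨k, fun i j hi hj => ?_⟩
  have h1 := (hC i j).1
  have h3 : R + C < c * k := by rwa [div_lt_iff₀' hc] at hk
  have h4 : (k : ℝ) ≤ min (i : ℝ) j := le_min (by exact_mod_cast hi) (by exact_mod_cast hj)
  have := mul_le_mul_of_nonneg_left h4 hc.le
  rw [Nat.cast_min] at h1
  linarith

end Part3

section Part4


lemma infinite_of_ne (hne : Nonelementary Γ) : Infinite Γ := by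
  by_contra h
  rw [not_infinite_iff_finite] at h
  have := hne 1
  exact Subgroup.index_ne_zero_of_finite this

lemma exists_len {S : Set Γ} (hS : IsGenSet S) (hne : Nonelementary Γ) (n : ℕ) :
    ∃ z : Γ, wl S z = n := by
  haveI := infinite_of_ne hne
  obtain ⟨g, hg⟩ := (ball_finite hS n).infinite_compl.nonempty
  have hg' : n ≤ wl S g := by
    by_contra h; exact hg (show wl S g ≤ n by omega)
  obtain ⟨y, hy, _⟩ := geod_pt hS g hg'
  exact ⟨y, hy⟩

theorem exists_inf {S : Set Γ} {δ : ℝ} (hS : IsGenSet S) (hδ : IsHyperbolic S δ)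
    (hne : Nonelementary Γ) : ∃ p : Γ, ¬ IsOfFinOrder p := by
  have hδ0 := hδ.1
  by_contra hcon
  push Not at hcon
  have hno : ∀ h : Γ, dd S 1 (h ^ 2) < dd S 1 h + 4 * δ + 1 := by
    intro h
    by_contra hlt
    push Not at hlt
    exact (lox_of_growth hS hδ hlt).not_fin hS (hcon h)
  have gpi : ∀ h : Γ, gp S 1 h h⁻¹ = dd S 1 h - dd S 1 (h ^ 2) / 2 := by
    intro h
    have e : dd S h h⁻¹ = dd S 1 (h ^ 2) := by
      rw [dd_comm hS, ← dd_left S h]; simp [pow_two]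
    rw [gp_eq, e, dd_comm hS _ 1, dd_comm hS _ 1, dd_inv hS]; ring
  have hb : ∀ h : Γ, (dd S 1 h - 4 * δ - 1) / 2 ≤ gp S 1 h h⁻¹ := by
    intro h; rw [gpi]; linarith [hno h]
  obtain ⟨n, hn⟩ := exists_nat_gt (30 * δ + 30)
  obtain ⟨z, hz⟩ := exists_len hS hne (2 * n)
  obtain ⟨y, hy1, hy2⟩ := geod_pt hS z (m := n) (by omega)
  set a := y⁻¹ with ha
  set b := y⁻¹ * z with hb'
  have la : dd S 1 a = n := by rw [dd_one_left, ha, wl_inv hS, hy1]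
  have lb : dd S 1 b = n := by
    rw [dd_one_left, hb', hy2, hz]; congr 1; omega
  have dab : dd S a b = 2 * n := by
    have : dd S a b = dd S 1 z := by rw [← dd_left S y a b, ha, hb']; simp
    rw [this, dd_one_left, hz]; push_cast; ring
  have ab0 : gp S 1 a b ≤ 0 := by
    rw [gp_eq, dab, dd_comm hS _ 1, dd_comm hS _ 1, la, lb]; linarith
  have a1 : gp S 1 a⁻¹ b ≤ 0 + δ := by
    apply gp_small hS hδ ab0
    have := hb a; rw [la] at this; linarith
  have a2 : gp S 1 b⁻¹ a ≤ 0 + δ := by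
    rw [gp_comm hS] at ab0
    apply gp_small hS hδ ab0
    have := hb b; rw [lb] at this; linarith
  have lab : 2 * n - 2 * δ ≤ dd S 1 (a * b) := by
    have e : dd S 1 (a * b) = dd S a⁻¹ b := by rw [← dd_left S a a⁻¹ b]; simp
    rw [gp_eq, dd_comm hS _ 1, dd_comm hS _ 1, dd_inv hS, la, lb] at a1
    rw [e]; linarith
  have b1 : n - δ ≤ gp S 1 a (a * b) := by
    have e : dd S a (a * b) = dd S 1 b := by rw [← dd_left S a 1 b]; simp
    rw [gp_eq, e, dd_comm hS _ 1, dd_comm hS _ 1, la, lb]; linarith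
  have b2 : n - δ ≤ gp S 1 b⁻¹ (a * b)⁻¹ := by
    have e : dd S b⁻¹ (a * b)⁻¹ = dd S 1 a := by
      rw [← dd_inv hS a, ← dd_left S b⁻¹ 1]; simp
    rw [gp_eq, e, dd_comm hS _ 1, dd_comm hS _ 1, dd_inv hS, dd_inv hS, la, lb]; linarith
  have c1 : gp S 1 (a * b) b⁻¹ ≤ 0 + δ + δ := by
    rw [gp_comm hS] at a2
    apply gp_small hS hδ a2
    linarith
  have c2 : gp S 1 (a * b)⁻¹ (a * b) ≤ 0 + δ + δ + δ := by
    rw [gp_comm hS] at c1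
    apply gp_small hS hδ c1
    linarith
  have := hb (a * b)
  rw [gp_comm hS] at c2
  linarith

lemma Lox.inv {S : Set Γ} {δ : ℝ} (hS : IsGenSet S) (hδ : IsHyperbolic S δ) {g : Γ}
    (h : Lox S g) : Lox S g⁻¹ := by
  apply lox_of_inf hS hδ
  rw [isOfFinOrder_inv_iff]
  exact h.not_fin hS

lemma Lox.gp_zpow {S : Set Γ} (hS : IsGenSet S) {p : Γ} (h : Lox S p) :
    ∃ C0 : ℝ, 0 ≤ C0 ∧ ∀ i m j : ℤ, i ≤ m → m ≤ j → gp S (p ^ m) (p ^ i) (p ^ j) ≤ C0 := by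
  obtain ⟨c, C, hc, hC⟩ := h
  refine ⟨C, (gp_nonneg hS _ _ _).trans (hC 0 0).2, fun i m j him hmj => ?_⟩
  obtain ⟨a, ha⟩ := Int.eq_ofNat_of_zero_le (sub_nonneg.2 him)
  obtain ⟨b, hb⟩ := Int.eq_ofNat_of_zero_le (sub_nonneg.2 hmj)
  have := (hC a b).2
  rw [← gp_left S (p ^ m)] at this
  rw [mul_one, ← zpow_natCast, ← zpow_natCast, inv_zpow', ← zpow_add, ← zpow_add, ← ha, ← hb] at this
  convert this using 3 <;> ring

/-- crossing lemma -/
lemma crossing {S : Set Γ} {δ : ℝ} (hS : IsGenSet S) (hδ : IsHyperbolic S δ) {p : Γ}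
    (h : Lox S p) (C : ℝ) (hC : 0 ≤ C) : ∃ C' : ℝ, ∀ (x : Γ) (i0 : ℤ) (n : ℕ),
      gp S x (p ^ i0) (p ^ (i0 + n)) ≤ C → ∃ m : ℕ, m ≤ n ∧ dd S x (p ^ (i0 + m)) ≤ C' := by
  have hδ0 := hδ.1
  obtain ⟨C0, hC0, hp⟩ := h.gp_zpow hS
  refine ⟨2 * (C + δ + dd S 1 p) + C0, fun x i0 n hx => ?_⟩
  classical
  have hex : ∃ m : ℕ, gp S x (p ^ i0) (p ^ (i0 + m)) ≤ C + δ := ⟨n, by linarith⟩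
  set m := Nat.find hex with hm
  have hm1 := Nat.find_spec hex
  rw [← hm] at hm1
  have hmn : m ≤ n := Nat.find_min' hex (by linarith)
  have hp0 := dd_nonneg S 1 p
  have hg : gp S x (p ^ (i0 + m)) (p ^ (i0 + n)) ≤ C + δ + dd S 1 p := by
    rcases Nat.eq_zero_or_pos m with h0 | hpos
    · rw [h0]; simp only [Nat.cast_zero, add_zero]; linarith
    · have hlt := Nat.find_min hex (m := m - 1) (by omega)
      push Not at hlt
      have h1 : gp S x (p ^ (i0 + (m - 1 : ℕ))) (p ^ (i0 + n)) ≤ C + δ := by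
        have := hyp_gp hS hδ x (p ^ i0) (p ^ (i0 + (m - 1 : ℕ))) (p ^ (i0 + n))
        rcases min_choice (gp S x (p ^ i0) (p ^ (i0 + (m - 1 : ℕ))))
          (gp S x (p ^ (i0 + (m - 1 : ℕ))) (p ^ (i0 + n))) with e | e <;> rw [e] at this <;> linarith
      have h2 := gp_lip hS x (p ^ (i0 + m)) (p ^ (i0 + (m - 1 : ℕ))) (p ^ (i0 + n))
      have h3 : dd S (p ^ (i0 + m)) (p ^ (i0 + (m - 1 : ℕ))) = dd S 1 p := by
        rw [dd_comm hS, ← dd_left S (p ^ (i0 + (m - 1 : ℕ))) 1 p, mul_one, ← zpow_add_one]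
        congr 2; push_cast [hpos]; ring
      linarith
  refine ⟨m, hmn, ?_⟩
  have h5 := hp i0 (i0 + m) (i0 + n) (by omega) (by omega)
  have h6 := dd_tri hS (p ^ i0) x (p ^ (i0 + n))
  rw [gp_eq] at hm1 hg h5
  rw [dd_comm hS x (p ^ (i0 + n))] at h6
  rw [dd_comm hS (p ^ (i0 + n)) (p ^ (i0 + m)) ] at h5
  rw [dd_comm hS (p ^ (i0 + m)) x] at hm1 hg
  linarith

end Part4

section Part5


/-! ### The boundary action -/

section bdry
variable {S : Set Γ} {δ : ℝ}

lemma smul_one (B : Boundary Γ S) (ξ : B.pt) : B.smul 1 ξ = ξ := by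
  obtain ⟨u, hu, rfl⟩ := B.cls_surj ξ
  rw [B.smul_cls 1 u hu]; simp

lemma smul_mul (hS : IsGenSet S) (B : Boundary Γ S) (g h : Γ) (ξ : B.pt) :
    B.smul (g * h) ξ = B.smul g (B.smul h ξ) := by
  obtain ⟨u, hu, rfl⟩ := B.cls_surj ξ
  rw [B.smul_cls _ u hu, B.smul_cls _ u hu, B.smul_cls _ _ (hu.mul_left hS h)]
  simp [mul_assoc]

lemma smul_inv_smul (hS : IsGenSet S) (B : Boundary Γ S) (g : Γ) (ξ : B.pt) :
    B.smul g (B.smul g⁻¹ ξ) = ξ := by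
  rw [← smul_mul hS, mul_inv_cancel, smul_one]

lemma inv_smul_smul (hS : IsGenSet S) (B : Boundary Γ S) (g : Γ) (ξ : B.pt) :
    B.smul g⁻¹ (B.smul g ξ) = ξ := by
  rw [← smul_mul hS, inv_mul_cancel, smul_one]

lemma cls_comp (B : Boundary Γ S) {u : ℕ → Γ} (hu : ConvInf S u) {f : ℕ → ℕ}
    (hf : Tendsto f atTop atTop) : B.cls (fun n => u (f n)) = B.cls u :=
  ((B.cls_eq u (u ∘ f) hu (hu.comp' hf).1).2 (hu.comp' hf).2).symm

lemma cls_bdd (hS : IsGenSet S) (hδ : IsHyperbolic S δ) (B : Boundary Γ S) {u v : ℕ → Γ}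
    (hu : ConvInf S u) (C : ℝ) (hb : ∀ n, dd S (u n) (v n) ≤ C) :
    ConvInf S v ∧ B.cls v = B.cls u := by
  have h1 := equivSeq_of_bdd hS hu C hb
  have h2 : ConvInf S v := convInf_of_equiv hS hδ (h1.symm' hS)
  exact ⟨h2, ((B.cls_eq u v hu h2).2 h1).symm⟩

lemma plus_ne_minus (hS : IsGenSet S) (hδ : IsHyperbolic S δ) (B : Boundary Γ S) {p : Γ}
    (hp : Lox S p) : plusPt B p ≠ minusPt B p := by
  intro h
  have := (B.cls_eq _ _ hp.convInf (hp.inv hS hδ).convInf).1 h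
  obtain ⟨c, C, hc, hC⟩ := hp
  obtain ⟨N, hN⟩ := (equivSeq_iff _ _ _).1 this (C + 1)
  have h1 := hN N N le_rfl le_rfl
  have h2 := (hC N N).2
  rw [gp_comm hS] at h1
  linarith

lemma fix_near (hS : IsGenSet S) (hδ : IsHyperbolic S δ) (B : Boundary Γ S) {p k : Γ}
    (hp : Lox S p) (hk : B.smul k (plusPt B p) = plusPt B p) :
    ∃ C : ℝ, ∀ n : ℕ, ∃ m : ℕ, dd S (k * p ^ n) (p ^ m) ≤ C := by
  have hδ0 := hδ.1
  obtain ⟨C0, hC0, hp0⟩ := hp.gp_zpow hS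
  have hk0 := dd_nonneg S 1 k
  obtain ⟨C', hC'⟩ := crossing hS hδ hp (C0 + dd S 1 k + δ) (by linarith)
  refine ⟨C', fun n => ?_⟩
  have heq : EquivSeq S (fun i => k * p ^ i) (fun j => p ^ j) := by
    have := hp.convInf
    rw [← B.cls_eq _ _ (this.mul_left hS k) this, ← B.smul_cls _ _ this]
    exact hk
  obtain ⟨N, hN⟩ := (equivSeq_iff _ _ _).1 heq (C0 + dd S 1 k + δ + 1 + dd S 1 (k * p ^ n))
  set M := max N n with hM
  have h1 := hN M M (le_max_left _ _) (le_max_left _ _)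
  have h2 := gp_base hS 1 (k * p ^ n) (k * p ^ M) (p ^ M)
  have h3 : gp S (k * p ^ n) (k * p ^ M) 1 ≤ C0 + dd S 1 k := by
    have a := hp0 0 n M (by omega) (by exact_mod_cast le_max_right _ _)
    rw [← gp_left S k] at a
    simp only [zpow_zero, mul_one, zpow_natCast] at a
    have b := gp_lip hS (k * p ^ n) 1 k (k * p ^ M)
    rw [gp_comm hS]
    linarith
  have h4 := gp_small hS hδ h3 (x' := p ^ M) (by linarith)
  rw [gp_comm hS] at h4
  obtain ⟨m, _, hm⟩ := hC' (k * p ^ n) 0 M (by simpa using h4)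
  exact ⟨m, by simpa using hm⟩

lemma fix_minus (hS : IsGenSet S) (hδ : IsHyperbolic S δ) (B : Boundary Γ S) {p k : Γ}
    (hp : Lox S p) (hk : B.smul k (plusPt B p) = plusPt B p) :
    B.smul k (minusPt B p) = minusPt B p := by
  obtain ⟨C, hC⟩ := fix_near hS hδ B hp hk
  choose m hm using hC
  have hinj := pow_inj_of_inf (hp.not_fin hS)
  obtain ⟨n, -, n', -, hlt, heq⟩ := Set.infinite_univ.exists_lt_map_eq_of_mapsTo
    (f := fun n : ℕ => (p ^ m n)⁻¹ * (k * p ^ n)) (t := {g | dd S 1 g ≤ C}) (by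
      intro n _
      show dd S 1 _ ≤ C
      rw [← dd_left S (p ^ m n) 1, dd_comm hS]
      simpa using hm n) (dd_ball_finite hS 1 C)
  -- k p^(n'-n) = p^(m n' - m n) k
  obtain ⟨b, rfl⟩ := Nat.exists_eq_add_of_lt hlt
  set b' := b + 1 with hb'
  set a : ℤ := (m (n + b + 1) : ℤ) - m n with ha
  have key : k * p ^ b' * k⁻¹ = p ^ a := by
    have e1 : k * p ^ (n + b + 1) = p ^ m (n + b + 1) * (p ^ m n)⁻¹ * (k * p ^ n) := by
      rw [mul_assoc, heq]; simp
    have e2 : p ^ m (n + b + 1) * (p ^ m n)⁻¹ = p ^ a := by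
      rw [ha, zpow_sub]; simp
    rw [e2] at e1
    have e3 : p ^ (n + b + 1) = p ^ b' * p ^ n := by rw [← pow_add]; congr 1; omega
    rw [e3] at e1
    have e4 : k * p ^ b' * p ^ n = p ^ a * k * p ^ n := by simpa [mul_assoc] using e1
    have e5 := mul_right_cancel e4
    rw [e5]; simp
  have hkey : ∀ j : ℕ, k * (p⁻¹) ^ (b' * j) * k⁻¹ = p ^ (-(a * j)) := by
    intro j
    have h1 : k * p ^ (b' * j) * k⁻¹ = p ^ (a * j) := by
      rw [pow_mul, ← conj_pow, key, zpow_mul, zpow_natCast]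
    rw [zpow_neg, ← h1]
    simp [mul_assoc]
  have tb : Tendsto (fun j : ℕ => b' * j) atTop atTop :=
    tendsto_id.const_mul_atTop' (by omega)
  have hp' := hp.inv hS hδ
  rcases lt_trichotomy a 0 with hneg | hzero | hpos
  · exfalso
    obtain ⟨a', ha'⟩ := Int.eq_ofNat_of_zero_le (neg_nonneg.2 hneg.le)
    have ta : Tendsto (fun j : ℕ => a' * j) atTop atTop :=
      tendsto_id.const_mul_atTop' (by omega)
    -- k p⁻ = p⁺
    have h1 := cls_comp B hp'.convInf tb
    have h2 := cls_comp B hp.convInf ta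
    have h3 : ConvInf S fun n => p⁻¹ ^ (b' * n) := (hp'.convInf.comp' tb).1
    have h4 := (hp.convInf.comp' ta).1
    have h5 : B.smul k (minusPt B p) = plusPt B p := by
      rw [minusPt, ← h1, B.smul_cls k _ h3, plusPt, ← h2]
      refine (cls_bdd hS hδ B h4 (dd S 1 k) (fun j => ?_)).2
      have e : k * p⁻¹ ^ (b' * j) = p ^ (a' * j) * k := by
        have := hkey j
        rw [← neg_mul, ha'] at this
        rw [mul_inv_eq_iff_eq_mul] at this
        rw [this]
        congr 1
        exact_mod_cast zpow_natCast p (a' * j)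
      rw [e]
      have := dd_left S (p ^ (a' * j)) 1 k
      rw [mul_one] at this
      exact this.le
    have h6 := plus_ne_minus hS hδ B hp
    apply h6
    rw [← inv_smul_smul hS B k (plusPt B p), hk, ← h5, inv_smul_smul hS]
  · exfalso
    rw [hzero, zpow_zero, mul_inv_eq_one, mul_eq_left] at key
    exact hp.not_fin hS (isOfFinOrder_iff_pow_eq_one.2 ⟨b', by omega, key⟩)
  · obtain ⟨a', ha'⟩ := Int.eq_ofNat_of_zero_le hpos.le
    have ta : Tendsto (fun j : ℕ => a' * j) atTop atTop :=
      tendsto_id.const_mul_atTop' (by omega)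
    have h1 := cls_comp B hp'.convInf tb
    have h2 := cls_comp B hp'.convInf ta
    have h3 : ConvInf S fun n => p⁻¹ ^ (b' * n) := (hp'.convInf.comp' tb).1
    have h4 := (hp'.convInf.comp' ta).1
    conv_rhs => rw [minusPt, ← h2]
    rw [minusPt, ← h1, B.smul_cls k _ h3]
    refine (cls_bdd hS hδ B h4 (dd S 1 k) (fun j => ?_)).2
    have e : k * p⁻¹ ^ (b' * j) = p⁻¹ ^ (a' * j) * k := by
      have := hkey j
      rw [ha'] at this
      rw [mul_inv_eq_iff_eq_mul] at this
      rw [this]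
      congr 1
      rw [inv_pow, zpow_neg]
      congr 1
      exact_mod_cast zpow_natCast p (a' * j)
    rw [e]
    have := dd_left S (p⁻¹ ^ (a' * j)) 1 k
    rw [mul_one] at this
    exact this.le

lemma moved_pair (hS : IsGenSet S) (hδ : IsHyperbolic S δ) (B : Boundary Γ S) {k : Γ}
    {u v u' v' : ℕ → Γ} {C0 : ℝ} (hu : ConvInf S u) (hv : ConvInf S v) (hu' : ConvInf S u')
    (hv' : ConvInf S v') (h0 : ∀ n, gp S 1 (v n) (u n) ≤ C0)
    (h1 : B.smul k (B.cls u) = B.cls u') (h2 : B.smul k (B.cls v) = B.cls v') :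
    ∃ n, gp S k (v' n) (u' n) ≤ C0 + 2 * δ := by
  have hδ0 := hδ.1
  rw [B.smul_cls k u hu, B.cls_eq _ _ (hu.mul_left hS k) hu', equivSeq_iff] at h1
  rw [B.smul_cls k v hv, B.cls_eq _ _ (hv.mul_left hS k) hv', equivSeq_iff] at h2
  obtain ⟨N, hN⟩ := h1 (C0 + 2 * δ + 1 + dd S 1 k)
  obtain ⟨N', hN'⟩ := h2 (C0 + 2 * δ + 1 + dd S 1 k)
  set M := max N N'
  have a1 := hN M M (le_max_left _ _) (le_max_left _ _)
  have a2 := hN' M M (le_max_right _ _) (le_max_right _ _)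
  have b1 := gp_base hS 1 k (k * u M) (u' M)
  have b2 := gp_base hS 1 k (k * v M) (v' M)
  have c0 : gp S k (k * v M) (k * u M) ≤ C0 := by
    have := gp_left S k 1 (v M) (u M)
    rw [mul_one] at this
    rw [this]; exact h0 M
  have c1 := gp_small hS hδ c0 (x' := v' M) (by linarith)
  rw [gp_comm hS] at c1
  have c2 := gp_small hS hδ c1 (x' := u' M) (by linarith)
  refine ⟨M, ?_⟩
  rw [gp_comm hS]; linarith

theorem exists_moving (hS : IsGenSet S) (hδ : IsHyperbolic S δ) (hne : Nonelementary Γ)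
    (B : Boundary Γ S) {p : Γ} (hp : Lox S p) :
    ∃ k : Γ, B.smul k (plusPt B p) ≠ plusPt B p ∧ B.smul k (plusPt B p) ≠ minusPt B p := by
  have hδ0 := hδ.1
  by_contra hcon
  push Not at hcon
  have hp' := hp.inv hS hδ
  obtain ⟨C0, hC0, hp0⟩ := hp.gp_zpow hS
  have h0 : ∀ n : ℕ, gp S 1 (p⁻¹ ^ n) (p ^ n) ≤ C0 := by
    intro n
    have := hp0 (-n) 0 n (by omega) (by omega)
    simpa using this
  obtain ⟨C', hC'⟩ := crossing hS hδ hp (C0 + 2 * δ) (by linarith)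
  have key : ∀ k : Γ, ∃ m : ℤ, dd S k (p ^ m) ≤ C' := by
    intro k
    have : ∃ n : ℕ, gp S k (p⁻¹ ^ n) (p ^ n) ≤ C0 + 2 * δ := by
      by_cases hk : B.smul k (plusPt B p) = plusPt B p
      · exact moved_pair hS hδ B hp.convInf hp'.convInf hp.convInf hp'.convInf h0 hk
          (fix_minus hS hδ B hp hk)
      · have hk1 := hcon k hk
        have hk2 : B.smul k⁻¹ (plusPt B p) = minusPt B p := by
          apply hcon
          intro h
          apply hk
          have := congrArg (B.smul k) h
          rw [smul_inv_smul hS] at this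
          exact this.symm
        have hk3 : B.smul k (minusPt B p) = plusPt B p := by
          rw [← hk2, smul_inv_smul hS]
        obtain ⟨n, hn⟩ := moved_pair hS hδ B hp.convInf hp'.convInf hp'.convInf hp.convInf h0 hk1 hk3
        exact ⟨n, by rw [gp_comm hS]; exact hn⟩
    obtain ⟨n, hn⟩ := this
    obtain ⟨m, _, hm⟩ := hC' k (-n) (2 * n) (by
      have e : (-(n : ℤ) + (2 * n : ℕ)) = n := by push_cast; ring
      rw [e]; simpa using hn)
    exact ⟨_, hm⟩
  have hfin : Finite (Γ ⧸ Subgroup.zpowers p) := by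
    have hb := dd_ball_finite hS 1 C'
    have : Finite {g : Γ | dd S 1 g ≤ C'} := hb
    refine Finite.of_surjective (fun g : {g : Γ | dd S 1 g ≤ C'} =>
      (QuotientGroup.mk (g.1) : Γ ⧸ Subgroup.zpowers p)) ?_
    intro q
    obtain ⟨k, rfl⟩ := QuotientGroup.mk_surjective q
    obtain ⟨m, hm⟩ := key k⁻¹
    refine ⟨⟨k * p ^ m, ?_⟩, ?_⟩
    · show dd S 1 (k * p ^ m) ≤ C'
      rw [← dd_left S k⁻¹]; simpa using hm
    · rw [QuotientGroup.eq]
      simp only [mul_inv_rev, inv_mul_cancel_right]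
      exact Subgroup.inv_mem _ (Subgroup.zpow_mem_zpowers p m)
  exact Subgroup.index_ne_zero_of_finite (hne p)

end bdry

end Part5

section Part6


/-! ### The random walk, with values in `ℝ≥0∞` -/

section walk

/-- step weights -/
noncomputable def mE (μ : Γ → ℝ) (g : Γ) : ℝ≥0∞ := ENNReal.ofReal (μ g)

open Classical in
/-- `n`-step transition probabilities, first step decomposition. -/
noncomputable def pE (μ : Γ → ℝ) : ℕ → Γ → Γ → ℝ≥0∞
  | 0 => fun x y => if x = y then 1 else 0
  | n + 1 => fun x y => ∑' s : Γ, mE μ s * pE μ n (x * s) y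

variable {S : Set Γ} {μ : Γ → ℝ}

lemma IsRWMeasure.summable (hμ : IsRWMeasure S μ) : Summable μ := by
  by_contra h
  have := hμ.total
  rw [tsum_eq_zero_of_not_summable h] at this
  norm_num at this

lemma mE_total (hμ : IsRWMeasure S μ) : ∑' g : Γ, mE μ g = 1 := by
  unfold mE
  rw [← ENNReal.ofReal_tsum_of_nonneg hμ.nonneg hμ.summable, hμ.total, ENNReal.ofReal_one]

lemma mE_ne_zero (hμ : IsRWMeasure S μ) {s : Γ} (h : mE μ s ≠ 0) : s ∈ S := by
  apply hμ.support_subset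
  intro h0; apply h; simp [mE, h0]

lemma pE_inv (μ : Γ → ℝ) (n : ℕ) (g x y : Γ) : pE μ n (g * x) (g * y) = pE μ n x y := by
  induction n generalizing x with
  | zero =>
    classical
    simp only [pE]
    by_cases h : x = y <;> simp [h]
  | succ n ih => simp only [pE, mul_assoc, ih]

lemma pE_add (μ : Γ → ℝ) (n k : ℕ) (x y : Γ) :
    pE μ (n + k) x y = ∑' z, pE μ n x z * pE μ k z y := by
  classical
  induction n generalizing x with
  | zero =>
    simp only [Nat.zero_add, pE]
    rw [tsum_eq_single x]
    · simp
    · intro z hz; simp [hz.symm]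
  | succ n ih =>
    rw [show n + 1 + k = (n + k) + 1 by ring]
    simp only [pE, ih]
    simp_rw [← ENNReal.tsum_mul_left, ← ENNReal.tsum_mul_right]
    rw [ENNReal.tsum_comm]
    simp_rw [mul_assoc]

lemma pE_one (μ : Γ → ℝ) (x y : Γ) : pE μ 1 x y = mE μ (x⁻¹ * y) := by
  classical
  simp only [pE]
  rw [tsum_eq_single (x⁻¹ * y)]
  · simp
  · intro s hs
    rw [if_neg, mul_zero]
    rintro rfl; apply hs; simp

lemma pE_succ (μ : Γ → ℝ) (n : ℕ) (x y : Γ) :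
    pE μ (n + 1) x y = ∑' z, pE μ n x z * mE μ (z⁻¹ * y) := by
  rw [pE_add]; simp_rw [pE_one]

lemma pE_total (hμ : IsRWMeasure S μ) (n : ℕ) (x : Γ) : ∑' y, pE μ n x y = 1 := by
  classical
  induction n generalizing x with
  | zero => simp only [pE]; rw [tsum_eq_single x] <;> simp +contextual [eq_comm]
  | succ n ih =>
    simp only [pE]
    rw [ENNReal.tsum_comm]
    simp_rw [ENNReal.tsum_mul_left, ih, mul_one]
    exact mE_total hμ

lemma pE_le_one (hμ : IsRWMeasure S μ) (n : ℕ) (x y : Γ) : pE μ n x y ≤ 1 := by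
  rw [← pE_total hμ n x]; exact ENNReal.le_tsum y

lemma pE_ne_top (hμ : IsRWMeasure S μ) (n : ℕ) (x y : Γ) : pE μ n x y ≠ ⊤ :=
  ((pE_le_one hμ n x y).trans_lt ENNReal.one_lt_top).ne

lemma ptrans_eq (hμ : IsRWMeasure S μ) (n : ℕ) (x y : Γ) :
    ptrans μ n x y = (pE μ n x y).toReal := by
  induction n generalizing y with
  | zero => simp only [ptrans, pE]; split_ifs <;> simp
  | succ n ih =>
    rw [pE_succ, ENNReal.tsum_toReal_eq]
    · simp only [ptrans, ENNReal.toReal_mul, ih, mE, ENNReal.toReal_ofReal (hμ.nonneg _)]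
    · intro z; exact ENNReal.mul_ne_top (pE_ne_top hμ _ _ _) ENNReal.ofReal_ne_top

lemma pE_support (hS : IsGenSet S) (hμ : IsRWMeasure S μ) {n : ℕ} {x y : Γ} (h : pE μ n x y ≠ 0) :
    dd S x y ≤ n := by
  induction n generalizing x with
  | zero =>
    have : x = y := by by_contra hxy; apply h; simp [pE, hxy]
    simp [this, dd_self]
  | succ n ih =>
    simp only [pE, ne_eq, ENNReal.tsum_eq_zero, not_forall] at h
    obtain ⟨s, hs⟩ := h
    have h1 : mE μ s ≠ 0 := fun h0 => hs (by simp [h0])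
    have h2 : pE μ n (x * s) y ≠ 0 := fun h0 => hs (by simp [h0])
    have h3 := ih h2
    have h4 := dd_tri hS x (x * s) y
    have h5 : dd S x (x * s) ≤ 1 := by
      have e := dd_left S x 1 s
      rw [mul_one] at e
      rw [e, dd_one_left]
      exact_mod_cast wl_mem (mE_ne_zero hμ h1)
    push_cast; linarith

lemma pE_list (μ : Γ → ℝ) (l : List Γ) (hl : ∀ x ∈ l, 0 < μ x) (x : Γ) :
    0 < pE μ l.length x (x * l.prod) := by
  induction l generalizing x with
  | nil => simp [pE]
  | cons a l ih =>
    simp only [List.length_cons, List.prod_cons, pE]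
    refine lt_of_lt_of_le ?_ (ENNReal.le_tsum a)
    rw [← mul_assoc]
    apply ENNReal.mul_pos
    · simp [mE, hl a (by simp)]
    · exact (ih (fun y hy => hl y (by simp [hy])) _).ne'

lemma pE_pos (hμ : IsRWMeasure S μ) (x y : Γ) : ∃ n, 1 ≤ n ∧ 0 < pE μ n x y := by
  obtain ⟨l, h0, hl, hp⟩ := hμ.nondeg (x⁻¹ * y)
  have := pE_list μ l hl x
  rw [hp] at this
  exact ⟨l.length, List.length_pos_iff.2 h0, by simpa using this⟩

/-- Green function with values in `ℝ≥0∞` -/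
noncomputable def GE (μ : Γ → ℝ) (x y : Γ) : ℝ≥0∞ := ∑' n, pE μ n x y

lemma GE_inv (μ : Γ → ℝ) (g x y : Γ) : GE μ (g * x) (g * y) = GE μ x y := by
  simp only [GE, pE_inv]

lemma GE_pos (hμ : IsRWMeasure S μ) (x y : Γ) : 0 < GE μ x y := by
  obtain ⟨n, _, h⟩ := pE_pos hμ x y
  exact h.trans_le (ENNReal.le_tsum n)

open Classical in
lemma GE_step (μ : Γ → ℝ) (x y : Γ) :
    GE μ x y = (if x = y then 1 else 0) + ∑' s, mE μ s * GE μ (x * s) y := by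
  have h := tsum_eq_zero_add' (f := fun n => pE μ n x y) ENNReal.summable
  unfold GE
  rw [h]
  have h2 : ∑' n, pE μ (n + 1) x y = ∑' s, mE μ s * ∑' n, pE μ n (x * s) y := by
    simp only [pE]
    rw [ENNReal.tsum_comm]
    simp_rw [ENNReal.tsum_mul_left]
  rw [h2]
  simp only [pE]

lemma GE_super (μ : Γ → ℝ) (x y : Γ) : ∑' s, mE μ s * GE μ (x * s) y ≤ GE μ x y := by
  classical
  rw [GE_step μ x y]; exact le_add_self

lemma GE_harnack_n (μ : Γ → ℝ) (n : ℕ) (x y z : Γ) : pE μ n x y * GE μ y z ≤ GE μ x z := by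
  unfold GE
  rw [← ENNReal.tsum_mul_left]
  calc ∑' k, pE μ n x y * pE μ k y z ≤ ∑' k, pE μ (n + k) x z := by
        apply ENNReal.tsum_le_tsum
        intro k
        rw [pE_add]
        exact ENNReal.le_tsum (f := fun y => pE μ n x y * pE μ k y z) y
    _ ≤ ∑' k, pE μ k x z :=
        ENNReal.tsum_comp_le_tsum_of_injective (add_right_injective n) (fun k => pE μ k x z)

/-- Harnack inequality -/
lemma exists_harnack (hS : IsGenSet S) (hμ : IsRWMeasure S μ) :
    ∃ c : ℝ≥0∞, 0 < c ∧ c ≤ 1 ∧ ∀ g x z : Γ, c ^ (wl S g) * GE μ (x * g) z ≤ GE μ x z := by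
  classical
  choose n _ hn using fun s : Γ => pE_pos hμ 1 s
  have : ∃ c : ℝ≥0∞, 0 < c ∧ c ≤ 1 ∧ ∀ s ∈ S, c ≤ pE μ (n s) 1 s := by
    have gen : ∀ T : Set Γ, T.Finite → ∃ c : ℝ≥0∞, 0 < c ∧ c ≤ 1 ∧ ∀ s ∈ T, c ≤ pE μ (n s) 1 s := by
      intro T hT
      induction T, hT using Set.Finite.induction_on with
      | empty => exact ⟨1, by simp, le_rfl, by simp⟩
      | @insert a T ha hT ih =>
        obtain ⟨c, h0, h1, h2⟩ := ih
        refine ⟨min c (pE μ (n a) 1 a), lt_min h0 (hn a), (min_le_left _ _).trans h1, ?_⟩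
        intro s hs
        rcases hs with rfl | hs
        · exact min_le_right _ _
        · exact (min_le_left _ _).trans (h2 s hs)
    exact gen S hS.1
  obtain ⟨c, hc0, hc1, hc⟩ := this
  refine ⟨c, hc0, hc1, fun g => ?_⟩
  obtain ⟨w, h1, h2, h3⟩ := wl_word hS g
  rw [← h1, ← h3]
  clear h1 h3
  induction w with
  | nil => intro x z; simp
  | cons a l ih =>
    intro x z
    have hstep : c * GE μ (x * a) z ≤ GE μ x z := by
      refine le_trans ?_ (GE_harnack_n μ (n a) x (x * a) z)
      gcongr
      have := pE_inv μ (n a) x 1 a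
      rw [mul_one] at this
      rw [this]
      exact hc a (h2 a (by simp))
    have hl := ih (fun y hy => h2 y (by simp [hy])) (x * a) z
    simp only [List.length_cons, List.prod_cons, ← mul_assoc, pow_succ']
    calc c * c ^ l.length * GE μ (x * a * l.prod) z = c * (c ^ l.length * GE μ (x * a * l.prod) z) := by
          rw [mul_assoc]
      _ ≤ c * GE μ (x * a) z := by gcongr
      _ ≤ _ := hstep

/-- reflected measure -/
def refl (μ : Γ → ℝ) : Γ → ℝ := fun g => μ g⁻¹

lemma refl_rw (hS : IsGenSet S) (hμ : IsRWMeasure S μ) : IsRWMeasure S (refl μ) where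
  nonneg g := hμ.nonneg _
  support_subset g h := by simpa using hS.2.1 _ (hμ.support_subset _ h)
  total := by
    have := (Equiv.inv Γ).tsum_eq μ
    rw [hμ.total] at this
    exact this
  nondeg g := by
    obtain ⟨l, h0, hl, hp⟩ := hμ.nondeg g⁻¹
    refine ⟨(l.map (·⁻¹)).reverse, by simpa using h0, ?_, by rw [← List.prod_inv_reverse, hp, inv_inv]⟩
    intro x hx
    simp only [List.mem_reverse, List.mem_map] at hx
    obtain ⟨y, hy, rfl⟩ := hx
    simpa [refl] using hl y hy

lemma refl_refl (μ : Γ → ℝ) : refl (refl μ) = μ := by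
  funext g; simp [refl]

lemma pE_refl (μ : Γ → ℝ) (n : ℕ) (x y : Γ) : pE (refl μ) n x y = pE μ n y x := by
  induction n generalizing y with
  | zero =>
    classical
    simp only [pE]
    by_cases h : x = y
    · simp [h]
    · simp [h, Ne.symm h]
  | succ n ih =>
    rw [pE_succ]
    simp only [pE]
    rw [← (Equiv.mulLeft y).tsum_eq]
    apply tsum_congr
    intro s
    rw [mul_comm]
    simp only [Equiv.coe_mulLeft, ih]
    congr 1
    simp [mE, refl]

lemma GE_refl (μ : Γ → ℝ) (x y : Γ) : GE (refl μ) x y = GE μ y x := by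
  simp only [GE, pE_refl]

lemma GE_ne_top_all (hμ : IsRWMeasure S μ) {a b : Γ} (h : GE μ a b ≠ ⊤) (x y : Γ) :
    GE μ x y ≠ ⊤ := by
  obtain ⟨n, _, hn⟩ := pE_pos hμ a x
  have h1 : GE μ x b ≠ ⊤ := by
    intro ht
    have := GE_harnack_n μ n a x b
    rw [ht, ENNReal.mul_top hn.ne'] at this
    exact h (top_le_iff.1 this)
  obtain ⟨k, _, hk⟩ := pE_pos hμ y b
  intro ht
  have := GE_harnack_n (refl μ) k b y x
  rw [GE_refl, GE_refl, pE_refl, ht, ENNReal.mul_top hk.ne'] at this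
  exact h1 (top_le_iff.1 this)

/-- right Harnack -/
lemma GE_harnack_r (μ : Γ → ℝ) (n : ℕ) (x y z : Γ) : GE μ x y * pE μ n y z ≤ GE μ x z := by
  have := GE_harnack_n (refl μ) n z y x
  rw [GE_refl, GE_refl, pE_refl, mul_comm] at this
  exact this

lemma green_eq (hμ : IsRWMeasure S μ) (hG : ∀ x y, GE μ x y ≠ ⊤) (x y : Γ) :
    green μ x y = (GE μ x y).toReal := by
  unfold green GE
  rw [ENNReal.tsum_toReal_eq (fun n => pE_ne_top hμ n x y)]
  simp_rw [ptrans_eq hμ]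

lemma green_zero (hμ : IsRWMeasure S μ) {x y : Γ} (h : GE μ x y = ⊤) : green μ x y = 0 := by
  unfold green
  apply tsum_eq_zero_of_not_summable
  intro hs
  have := ENNReal.ofReal_tsum_of_nonneg (f := fun n => ptrans μ n x y)
    (fun n => by rw [ptrans_eq hμ]; exact ENNReal.toReal_nonneg) hs
  simp_rw [ptrans_eq hμ, ENNReal.ofReal_toReal (pE_ne_top hμ _ x y)] at this
  unfold GE at h
  rw [h] at this
  exact ENNReal.ofReal_ne_top this

/-- the Green function is finite as soon as some Martin kernel has a non zero limit -/
lemma GE_finite (hμ : IsRWMeasure S μ) {x y : Γ} (h : martinK μ x y ≠ 0) (a b : Γ) :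
    GE μ a b ≠ ⊤ := by
  apply GE_ne_top_all hμ (a := x) (b := y)
  intro ht
  apply h
  unfold martinK
  rw [green_zero hμ ht, zero_div]

lemma martinK_eq (hμ : IsRWMeasure S μ) (hG : ∀ x y, GE μ x y ≠ ⊤) (x y : Γ) :
    martinK μ x y = (GE μ x y).toReal / (GE μ 1 y).toReal := by
  unfold martinK
  rw [green_eq hμ hG, green_eq hμ hG]

lemma GEr_pos (hμ : IsRWMeasure S μ) (hG : ∀ x y, GE μ x y ≠ ⊤) (x y : Γ) :
    0 < (GE μ x y).toReal := ENNReal.toReal_pos (GE_pos hμ x y).ne' (hG x y)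

lemma martinK_pos (hμ : IsRWMeasure S μ) (hG : ∀ x y, GE μ x y ≠ ⊤) (x y : Γ) :
    0 < martinK μ x y := by
  rw [martinK_eq hμ hG]
  exact div_pos (GEr_pos hμ hG _ _) (GEr_pos hμ hG _ _)

lemma martinK_cocycle (hμ : IsRWMeasure S μ) (hG : ∀ x y, GE μ x y ≠ ⊤) (g h y : Γ) :
    martinK μ (g * h) y = martinK μ g y * martinK μ h (g⁻¹ * y) := by
  rw [martinK_eq hμ hG, martinK_eq hμ hG, martinK_eq hμ hG]
  have h1 := GE_inv μ g h (g⁻¹ * y)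
  have h2 := GE_inv μ g 1 (g⁻¹ * y)
  rw [mul_inv_cancel_left] at h1 h2
  rw [mul_one] at h2
  rw [← h1, ← h2]
  have := (GEr_pos hμ hG 1 y).ne'
  have := (GEr_pos hμ hG g y).ne'
  field_simp

/-- real valued Harnack -/
lemma exists_harnack_real (hS : IsGenSet S) (hμ : IsRWMeasure S μ) (hG : ∀ x y, GE μ x y ≠ ⊤) :
    ∃ c : ℝ, 0 < c ∧ c ≤ 1 ∧ ∀ g x z : Γ,
      c ^ (wl S g) * (GE μ (x * g) z).toReal ≤ (GE μ x z).toReal := by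
  obtain ⟨c, h0, h1, h2⟩ := exists_harnack hS hμ
  have hc : c ≠ ⊤ := (h1.trans_lt ENNReal.one_lt_top).ne
  refine ⟨c.toReal, ENNReal.toReal_pos h0.ne' hc, ?_, fun g x z => ?_⟩
  · exact ENNReal.toReal_mono ENNReal.one_ne_top h1 |>.trans (by simp)
  · have := ENNReal.toReal_mono (hG x z) (h2 g x z)
    simpa using this

/-- upper and lower bounds on the Martin kernel -/
lemma martinK_bounds (hS : IsGenSet S) (hμ : IsRWMeasure S μ) (hG : ∀ x y, GE μ x y ≠ ⊤) :
    ∃ c : ℝ, 0 < c ∧ c ≤ 1 ∧ ∀ g y : Γ,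
      c ^ (wl S g) ≤ martinK μ g y ∧ martinK μ g y ≤ (c ^ (wl S g))⁻¹ := by
  obtain ⟨c, h0, h1, h2⟩ := exists_harnack_real hS hμ hG
  refine ⟨c, h0, h1, fun g y => ?_⟩
  rw [martinK_eq hμ hG]
  constructor
  · rw [le_div_iff₀ (GEr_pos hμ hG _ _)]
    have := h2 g⁻¹ g y
    rwa [wl_inv hS, mul_inv_cancel] at this
  · rw [div_le_iff₀ (GEr_pos hμ hG _ _), ← div_eq_inv_mul, le_div_iff₀ (pow_pos h0 _), mul_comm]
    have := h2 g 1 y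
    rwa [one_mul] at this

end walk

end Part6

section Part7


/-! ### Geometry and topology of the boundary -/

section bdry

variable {S : Set Γ} {δ : ℝ}

/-- a chosen representing sequence -/
noncomputable def rep (B : Boundary Γ S) (ξ : B.pt) : ℕ → Γ := (B.cls_surj ξ).choose

lemma rep_conv (B : Boundary Γ S) (ξ : B.pt) : ConvInf S (rep B ξ) := (B.cls_surj ξ).choose_spec.1

lemma rep_cls (B : Boundary Γ S) (ξ : B.pt) : B.cls (rep B ξ) = ξ := (B.cls_surj ξ).choose_spec.2

/-- `(x|ξ) ≥ r` -/
def Lb (B : Boundary Γ S) (x : Γ) (ξ : B.pt) (r : ℝ) : Prop :=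
  ∀ᶠ n in atTop, r ≤ gp S 1 x (rep B ξ n)

/-- `(ξ|η) ≥ r` -/
def near (B : Boundary Γ S) (ξ η : B.pt) (r : ℝ) : Prop :=
  ∀ᶠ p : ℕ × ℕ in atTop, r ≤ gp S 1 (rep B ξ p.1) (rep B η p.2)

lemma ev_pair {P : ℕ → ℕ → Prop} : (∀ᶠ p : ℕ × ℕ in atTop, P p.1 p.2) ↔
    ∃ N, ∀ i j, N ≤ i → N ≤ j → P i j := by
  rw [eventually_atTop]
  constructor
  · rintro ⟨⟨a, b⟩, h⟩
    refine ⟨max a b, fun i j hi hj => h (i, j) ⟨?_, ?_⟩⟩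
    · exact (le_max_left _ _).trans hi
    · exact (le_max_right _ _).trans hj
  · rintro ⟨N, h⟩
    exact ⟨(N, N), fun p hp => h _ _ hp.1 hp.2⟩

lemma near_iff (B : Boundary Γ S) {ξ η : B.pt} {r : ℝ} : near B ξ η r ↔
    ∃ N, ∀ i j, N ≤ i → N ≤ j → r ≤ gp S 1 (rep B ξ i) (rep B η j) :=
  ev_pair (P := fun i j => r ≤ gp S 1 (rep B ξ i) (rep B η j))

lemma Lb_iff (B : Boundary Γ S) {x : Γ} {ξ : B.pt} {r : ℝ} : Lb B x ξ r ↔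
    ∃ N, ∀ i, N ≤ i → r ≤ gp S 1 x (rep B ξ i) := eventually_atTop

lemma Lb.mono {B : Boundary Γ S} {x : Γ} {ξ : B.pt} {r r' : ℝ} (h : Lb B x ξ r) (hr : r' ≤ r) :
    Lb B x ξ r' := Filter.Eventually.mono h fun _ h => hr.trans h

lemma near.mono {B : Boundary Γ S} {ξ η : B.pt} {r r' : ℝ} (h : near B ξ η r) (hr : r' ≤ r) :
    near B ξ η r' := Filter.Eventually.mono h fun _ h => hr.trans h

lemma near.symm' (hS : IsGenSet S) {B : Boundary Γ S} {ξ η : B.pt} {r : ℝ} (h : near B ξ η r) :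
    near B η ξ r := by
  rw [near_iff] at h ⊢
  obtain ⟨N, h⟩ := h
  exact ⟨N, fun i j hi hj => by rw [gp_comm hS]; exact h j i hj hi⟩

lemma near.trans' (hS : IsGenSet S) (hδ : IsHyperbolic S δ) {B : Boundary Γ S} {ξ η ζ : B.pt}
    {r : ℝ} (h : near B ξ η r) (h' : near B η ζ r) : near B ξ ζ (r - δ) := by
  rw [near_iff] at *
  obtain ⟨N, h⟩ := h
  obtain ⟨N', h'⟩ := h'
  refine ⟨max N N', fun i j hi hj => ?_⟩
  exact gp_large hS hδ (h i (max N N') ((le_max_left _ _).trans hi) (le_max_left _ _))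
    (h' (max N N') j (le_max_right _ _) ((le_max_right _ _).trans hj))

lemma Lb.near_of (hS : IsGenSet S) (hδ : IsHyperbolic S δ) {B : Boundary Γ S} {x : Γ} {ξ η : B.pt}
    {r : ℝ} (h : Lb B x ξ r) (h' : Lb B x η r) : near B ξ η (r - δ) := by
  rw [Lb_iff] at *
  rw [near_iff]
  obtain ⟨N, h⟩ := h
  obtain ⟨N', h'⟩ := h'
  refine ⟨max N N', fun i j hi hj => ?_⟩
  exact gp_large hS hδ (z := x) (by rw [gp_comm hS]; exact h i ((le_max_left _ _).trans hi))
    (h' j ((le_max_right _ _).trans hj))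

lemma Lb.near_trans (hS : IsGenSet S) (hδ : IsHyperbolic S δ) {B : Boundary Γ S} {x : Γ}
    {ξ η : B.pt} {r : ℝ} (h : Lb B x ξ r) (h' : HarmonicBoundary.near B ξ η r) :
    Lb B x η (r - δ) := by
  rw [Lb_iff] at *
  rw [near_iff] at h'
  obtain ⟨N, h⟩ := h
  obtain ⟨N', h'⟩ := h'
  refine ⟨max N N', fun j hj => ?_⟩
  exact gp_large hS hδ (h (max N N') (le_max_left _ _))
    (h' (max N N') j (le_max_right _ _) ((le_max_right _ _).trans hj))

lemma Lb.left_trans (hS : IsGenSet S) (hδ : IsHyperbolic S δ) {B : Boundary Γ S} {x y : Γ}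
    {ξ : B.pt} {r : ℝ} (h : Lb B x ξ r) (h' : r ≤ gp S 1 y x) : Lb B y ξ (r - δ) :=
  Filter.Eventually.mono h fun _ h => gp_large hS hδ h' h

lemma Lb.gp_ge (hS : IsGenSet S) (hδ : IsHyperbolic S δ) {B : Boundary Γ S} {x y : Γ}
    {ξ : B.pt} {r : ℝ} (h : Lb B x ξ r) (h' : Lb B y ξ r) : r - δ ≤ HarmonicBoundary.gp S 1 x y := by
  obtain ⟨n, h1, h2⟩ := (Filter.Eventually.and h h').exists
  exact gp_large hS hδ h1 (by rw [gp_comm hS]; exact h2)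

lemma Lb.le_wl (hS : IsGenSet S) {B : Boundary Γ S} {x : Γ} {ξ : B.pt} {r : ℝ} (h : Lb B x ξ r) :
    r ≤ wl S x := by
  obtain ⟨n, h1⟩ := Filter.Eventually.exists h
  have := gp_le_left hS 1 x (rep B ξ n)
  rw [dd_one_right hS] at this
  linarith

lemma Lb_nonpos (hS : IsGenSet S) (B : Boundary Γ S) (x : Γ) (ξ : B.pt) {r : ℝ} (h : r ≤ 0) :
    Lb B x ξ r := Filter.Eventually.of_forall fun _ => h.trans (gp_nonneg hS _ _ _)

lemma rep_equiv (B : Boundary Γ S) {ξ : B.pt} {u : ℕ → Γ} (hu : ConvInf S u) (h : B.cls u = ξ) :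
    EquivSeq S u (rep B ξ) :=
  (B.cls_eq _ _ hu (rep_conv B ξ)).1 (by rw [h, rep_cls])

lemma Lb_of_seq (hS : IsGenSet S) (hδ : IsHyperbolic S δ) {B : Boundary Γ S} {x : Γ} {ξ : B.pt}
    {r : ℝ} {u : ℕ → Γ} (hu : ConvInf S u) (hc : B.cls u = ξ)
    (h : ∃ᶠ n in atTop, r ≤ gp S 1 x (u n)) : Lb B x ξ (r - δ) := by
  obtain ⟨N, hN⟩ := (equivSeq_iff S _ _).1 (rep_equiv B hu hc) r
  obtain ⟨n, hn, h⟩ := frequently_atTop.1 h N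
  rw [Lb_iff]
  exact ⟨N, fun i hi => gp_large hS hδ h (hN n i hn hi)⟩

lemma Lb.seq (hS : IsGenSet S) (hδ : IsHyperbolic S δ) {B : Boundary Γ S} {x : Γ} {ξ : B.pt}
    {r : ℝ} (h : Lb B x ξ r) {u : ℕ → Γ} (hu : ConvInf S u) (hc : B.cls u = ξ) :
    ∀ᶠ n in atTop, r - δ ≤ gp S 1 x (u n) := by
  obtain ⟨N, hN⟩ := (equivSeq_iff S _ _).1 (rep_equiv B hu hc) r
  obtain ⟨i, hi, hiN⟩ := (Filter.Eventually.and h (eventually_ge_atTop N)).exists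
  rw [eventually_atTop]
  exact ⟨N, fun n hn => gp_large hS hδ hi (by rw [gp_comm hS]; exact hN n i hn hiN)⟩

lemma seq_of_not_Lb (hS : IsGenSet S) (hδ : IsHyperbolic S δ) {B : Boundary Γ S} {x : Γ} {ξ : B.pt}
    {r : ℝ} (h : ¬ Lb B x ξ r) {u : ℕ → Γ} (hu : ConvInf S u) (hc : B.cls u = ξ) :
    ∀ᶠ n in atTop, gp S 1 x (u n) ≤ r + δ := by
  by_contra hcon
  apply h
  have h1 : ∃ᶠ n in atTop, r + δ ≤ gp S 1 x (u n) := by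
    rw [not_eventually] at hcon
    exact hcon.mono fun n hn => (not_le.1 hn).le
  have := Lb_of_seq hS hδ hu hc h1
  rwa [add_sub_cancel_right] at this

lemma Lb_tendsto (hS : IsGenSet S) {B : Boundary Γ S} {ξ : B.pt} {u : ℕ → Γ}
    (hu : ConvInf S u) (hc : B.cls u = ξ) (r : ℝ) : ∀ᶠ n in atTop, Lb B (u n) ξ r := by
  obtain ⟨N, hN⟩ := (equivSeq_iff S _ _).1 (rep_equiv B hu hc) r
  rw [eventually_atTop]
  exact ⟨N, fun n hn => (Lb_iff B).2 ⟨N, fun i hi => hN n i hn hi⟩⟩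

lemma exists_Lb (hS : IsGenSet S) (B : Boundary Γ S) (ξ : B.pt) (r : ℝ) : ∃ x, Lb B x ξ r := by
  obtain ⟨n, h⟩ := (Lb_tendsto hS (rep_conv B ξ) (rep_cls B ξ) r).exists
  exact ⟨_, h⟩

lemma near_refl (B : Boundary Γ S) (ξ : B.pt) (r : ℝ) : near B ξ ξ r := by
  rw [near_iff]
  exact (convInf_iff S _).1 (rep_conv B ξ) r

lemma eq_of_near (B : Boundary Γ S) {ξ η : B.pt} (h : ∀ r, near B ξ η r) : ξ = η := by
  rw [← rep_cls B ξ, ← rep_cls B η, B.cls_eq _ _ (rep_conv B ξ) (rep_conv B η), equivSeq_iff]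
  intro R
  exact (near_iff B).1 (h R)

lemma exists_not_near (B : Boundary Γ S) {ξ η : B.pt} (h : ξ ≠ η) : ∃ r, ¬ near B ξ η r := by
  by_contra hc; push Not at hc; exact h (eq_of_near B hc)

lemma near_of_seq (hS : IsGenSet S) (hδ : IsHyperbolic S δ) {B : Boundary Γ S} {ξ η : B.pt}
    {r : ℝ} {u v : ℕ → Γ} (hu : ConvInf S u) (hc : B.cls u = ξ) (hv : ConvInf S v)
    (hc' : B.cls v = η)
    (h : ∃ᶠ p : ℕ × ℕ in atTop, r ≤ gp S 1 (u p.1) (v p.2)) : near B ξ η (r - 2 * δ) := by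
  obtain ⟨N, hN⟩ := (equivSeq_iff S _ _).1 (rep_equiv B hu hc) r
  obtain ⟨N', hN'⟩ := (equivSeq_iff S _ _).1 (rep_equiv B hv hc') r
  obtain ⟨⟨i, j⟩, hij, h⟩ := frequently_atTop.1 h (N, N')
  have hd := hδ.1
  rw [near_iff]
  refine ⟨max N N', fun i' j' hi' hj' => ?_⟩
  have h1 : r - δ ≤ gp S 1 (rep B ξ i') (v j) := gp_large hS hδ
    (by rw [gp_comm hS]; exact hN i i' hij.1 ((le_max_left _ _).trans hi')) h
  have h2 : r - δ ≤ gp S 1 (v j) (rep B η j') :=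
    (by linarith : r - δ ≤ r).trans (hN' j j' hij.2 ((le_max_right _ _).trans hj'))
  have := gp_large hS hδ h1 h2
  linarith

lemma near.seq (hS : IsGenSet S) (hδ : IsHyperbolic S δ) {B : Boundary Γ S} {ξ η : B.pt}
    {r : ℝ} (h : near B ξ η r) {u v : ℕ → Γ} (hu : ConvInf S u) (hc : B.cls u = ξ)
    (hv : ConvInf S v) (hc' : B.cls v = η) :
    ∀ᶠ p : ℕ × ℕ in atTop, r - 2 * δ ≤ gp S 1 (u p.1) (v p.2) := by
  obtain ⟨N, hN⟩ := (equivSeq_iff S _ _).1 (rep_equiv B hu hc) r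
  obtain ⟨N', hN'⟩ := (equivSeq_iff S _ _).1 (rep_equiv B hv hc') r
  obtain ⟨M, hM⟩ := (near_iff B).1 h
  have hd := hδ.1
  set K := max M (max N N')
  have k1 : M ≤ K := le_max_left _ _
  have k2 : N ≤ K := (le_max_left _ _).trans (le_max_right _ _)
  have k3 : N' ≤ K := (le_max_right _ _).trans (le_max_right _ _)
  refine (ev_pair (P := fun i j => r - 2 * δ ≤ gp S 1 (u i) (v j))).2 ⟨K, fun i j hi hj => ?_⟩
  have h1 := gp_large hS hδ (hN i K (k2.trans hi) k2) (hM K K k1 k1)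
  have h2 : r - δ ≤ gp S 1 (rep B η K) (v j) := by
    rw [gp_comm hS]
    exact (by linarith : r - δ ≤ r).trans (hN' j K (k3.trans hj) k3)
  have := gp_large hS hδ h1 h2
  linarith

/-- description of open sets -/
lemma isOpen_iff_near (hS : IsGenSet S) (hδ : IsHyperbolic S δ) (B : Boundary Γ S) (O : Set B.pt) :
    IsOpen[btop B] O ↔ ∀ p ∈ O, ∃ r : ℝ, ∀ q, near B q p r → q ∈ O := by
  have hd := hδ.1
  constructor
  · intro h p hp
    obtain ⟨r, hr, hsub⟩ := h p hp
    refine ⟨r.toReal + 1, fun q hq => hsub ?_⟩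
    show r < bgp B q p
    have h1 : ENNReal.ofReal (r.toReal + 1) ≤ bgp B q p := by
      unfold bgp
      refine le_trans ?_ (le_iSup₂ (⟨rep B q, rep_conv B q, rep_cls B q⟩ :
        {u : ℕ → Γ // ConvInf S u ∧ B.cls u = q})
        (⟨rep B p, rep_conv B p, rep_cls B p⟩ : {u : ℕ → Γ // ConvInf S u ∧ B.cls u = p}))
      refine Filter.le_liminf_of_le (by isBoundedDefault) ?_
      exact Filter.Eventually.mono hq fun x hx => ENNReal.ofReal_le_ofReal hx
    refine lt_of_lt_of_le ?_ h1
    rw [ENNReal.lt_ofReal_iff_toReal_lt hr]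
    linarith
  · intro h p hp
    obtain ⟨r, hsub⟩ := h p hp
    refine ⟨ENNReal.ofReal (r + 2 * δ), ENNReal.ofReal_ne_top, fun q hq => hsub q ?_⟩
    have hq' : ENNReal.ofReal (r + 2 * δ) < bgp B q p := hq
    unfold bgp at hq'
    rw [lt_iSup_iff] at hq'
    obtain ⟨u, hq'⟩ := hq'
    rw [lt_iSup_iff] at hq'
    obtain ⟨v, hq'⟩ := hq'
    have h2 := Filter.eventually_lt_of_lt_liminf hq'
    have := near_of_seq hS hδ (r := r + 2 * δ) u.2.1 u.2.2 v.2.1 v.2.2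
      (Filter.Eventually.frequently (h2.mono fun p hp => ?_))
    · rwa [add_sub_cancel_right] at this
    · by_contra hc
      push Not at hc
      exact absurd hp (not_lt.2 (ENNReal.ofReal_le_ofReal hc.le))

/-- the interior -/
lemma isOpen_inner (hS : IsGenSet S) (hδ : IsHyperbolic S δ) (B : Boundary Γ S) (E : Set B.pt) :
    IsOpen[btop B] {p | ∃ r : ℝ, ∀ q, near B q p r → q ∈ E} := by
  rw [isOpen_iff_near hS hδ]
  have hd := hδ.1
  rintro p ⟨r, hr⟩
  refine ⟨r + δ, fun q hq => ⟨r + δ, fun q' hq' => hr q' ?_⟩⟩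
  have := hq'.trans' hS hδ hq
  rwa [add_sub_cancel_right] at this

/-- the shadow of `x`, made closed -/
def hull (B : Boundary Γ S) (x : Γ) (r : ℝ) : Set B.pt :=
  {p | ∀ t : ℝ, ∃ q, near B q p t ∧ Lb B x q r}

lemma isClosed_hull (hS : IsGenSet S) (hδ : IsHyperbolic S δ) (B : Boundary Γ S) (x : Γ) (r : ℝ) :
    IsClosed[btop B] (hull B x r) := by
  rw [← @isOpen_compl_iff]
  convert isOpen_inner hS hδ B {q | ¬ Lb B x q r} using 1
  ext p
  show ¬ (∀ t : ℝ, ∃ q, near B q p t ∧ Lb B x q r) ↔ ∃ t : ℝ, ∀ q, near B q p t → ¬ Lb B x q r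
  push Not
  rfl

lemma Lb.mem_hull {B : Boundary Γ S} {x : Γ} {ξ : B.pt} {r : ℝ} (h : Lb B x ξ r) :
    ξ ∈ hull B x r := fun t => ⟨ξ, near_refl B ξ t, h⟩

lemma Lb_of_mem_hull (hS : IsGenSet S) (hδ : IsHyperbolic S δ) {B : Boundary Γ S} {x : Γ}
    {ξ : B.pt} {r : ℝ} (h : ξ ∈ hull B x r) : Lb B x ξ (r - δ) := by
  obtain ⟨q, h1, h2⟩ := h r
  exact h2.near_trans hS hδ h1

lemma isClosed_single (hS : IsGenSet S) (hδ : IsHyperbolic S δ) (B : Boundary Γ S) (ξ : B.pt) :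
    IsClosed[btop B] {ξ} := by
  rw [← @isOpen_compl_iff, isOpen_iff_near hS hδ]
  intro p hp
  obtain ⟨r, hr⟩ := exists_not_near B hp
  refine ⟨r, fun q hq hqe => hr ?_⟩
  rw [Set.mem_singleton_iff] at hqe
  subst hqe
  exact hq.symm' hS

lemma smul_seq (hS : IsGenSet S) (B : Boundary Γ S) (g : Γ) (ξ : B.pt) :
    ConvInf S (fun n => g * rep B ξ n) ∧ B.cls (fun n => g * rep B ξ n) = B.smul g ξ :=
  ⟨(rep_conv B ξ).mul_left hS g, by rw [← B.smul_cls g _ (rep_conv B ξ), rep_cls]⟩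

lemma gp_mul_ge (hS : IsGenSet S) (g x y : Γ) : gp S 1 x y - wl S g ≤ gp S 1 (g * x) (g * y) := by
  have h1 := gp_left S g g⁻¹ x y
  rw [mul_inv_cancel] at h1
  rw [h1]
  have := gp_base hS 1 g⁻¹ x y
  rw [dd_one_left, wl_inv hS] at this
  linarith

lemma near.smul (hS : IsGenSet S) (hδ : IsHyperbolic S δ) {B : Boundary Γ S} {ξ η : B.pt}
    {r : ℝ} (h : near B ξ η r) (g : Γ) :
    near B (B.smul g ξ) (B.smul g η) (r - wl S g - 2 * δ) := by
  apply near_of_seq hS hδ (smul_seq hS B g ξ).1 (smul_seq hS B g ξ).2 (smul_seq hS B g η).1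
    (smul_seq hS B g η).2
  apply Filter.Eventually.frequently
  refine Filter.Eventually.mono h fun p hp => ?_
  have := gp_mul_ge hS g (rep B ξ p.1) (rep B η p.2)
  linarith

lemma Lb.smul (hS : IsGenSet S) (hδ : IsHyperbolic S δ) {B : Boundary Γ S} {x : Γ} {ξ : B.pt}
    {r : ℝ} (h : Lb B x ξ r) (g : Γ) : Lb B (g * x) (B.smul g ξ) (r - wl S g - δ) := by
  apply Lb_of_seq hS hδ (smul_seq hS B g ξ).1 (smul_seq hS B g ξ).2
  apply Filter.Eventually.frequently
  refine Filter.Eventually.mono h fun p hp => ?_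
  have := gp_mul_ge hS g x (rep B ξ p)
  linarith

/-- points far from `x⁻¹` are sent close to `x` -/
lemma Lb_smul_of_far (hS : IsGenSet S) (hδ : IsHyperbolic S δ) {B : Boundary Γ S} {x : Γ}
    {ξ : B.pt} {r : ℝ} (h : ¬ Lb B x⁻¹ ξ r) : Lb B x (B.smul x ξ) (wl S x - r - 2 * δ) := by
  have h1 := seq_of_not_Lb hS hδ h (rep_conv B ξ) (rep_cls B ξ)
  have := Lb_of_seq hS hδ (smul_seq hS B x ξ).1 (smul_seq hS B x ξ).2
    (r := wl S x - r - δ) (x := x) (Filter.Eventually.frequently (h1.mono fun n hn => ?_))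
  · exact this.mono (by linarith)
  · have e1 := gp_add hS 1 (x * rep B ξ n) x
    have e2 := gp_left S x 1 (rep B ξ n) x⁻¹
    rw [mul_one, mul_inv_cancel] at e2
    rw [e2, gp_comm hS 1 (rep B ξ n), dd_one_left, gp_comm hS] at e1
    linarith

lemma continuous_smul' (hS : IsGenSet S) (hδ : IsHyperbolic S δ) (B : Boundary Γ S) (g : Γ) :
    @Continuous _ _ (btop B) (btop B) (B.smul g) := by
  rw [@continuous_def _ _ (btop B) (btop B)]
  intro O hO
  rw [isOpen_iff_near hS hδ] at hO ⊢
  intro p hp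
  obtain ⟨r, hr⟩ := hO _ hp
  refine ⟨r + wl S g + 2 * δ, fun q hq => hr _ ?_⟩
  exact (hq.smul hS hδ g).mono (by linarith)

/-- compactness -/
lemma exists_subseq (hS : IsGenSet S) (hδ : IsHyperbolic S δ) {z : ℕ → Γ}
    (hz : Tendsto (fun n => wl S (z n)) atTop atTop) :
    ∃ φ : ℕ → ℕ, StrictMono φ ∧ ConvInf S (fun n => z (φ n)) := by
  have hle : (hyperfilter ℕ : Filter ℕ) ≤ atTop := Nat.hyperfilter_le_atTop
  have key : ∀ m : ℕ, ∃ h : Γ, ∀ᶠ n in (hyperfilter ℕ : Filter ℕ), (m : ℝ) ≤ gp S 1 h (z n) := by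
    intro m
    have hfin := ball_finite hS m
    have h1 : ∀ᶠ n in (hyperfilter ℕ : Filter ℕ), ∃ h ∈ {g | wl S g ≤ m}, (m : ℝ) ≤ gp S 1 h (z n) := by
      filter_upwards [hle (hz.eventually_ge_atTop m)] with n hn
      obtain ⟨y, hy1, hy2⟩ := geod_pt hS (z n) hn
      refine ⟨y, hy1.le, ?_⟩
      rw [gp_eq, dd_one_right hS, dd_one_right hS]
      have : dd S y (z n) = (wl S (z n) : ℝ) - m := by
        show ((wl S (y⁻¹ * z n) : ℕ) : ℝ) = _
        rw [hy2, Nat.cast_sub hn]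
      rw [this, hy1]; linarith
    rw [Ultrafilter.eventually_exists_mem_iff hfin] at h1
    obtain ⟨h, _, hh⟩ := h1
    exact ⟨h, hh⟩
  choose h hh using key
  have hfreq : ∀ m : ℕ, ∃ᶠ n in atTop, ∀ k ≤ m, (k : ℝ) ≤ gp S 1 (h k) (z n) := by
    intro m
    have : ∀ᶠ n in (hyperfilter ℕ : Filter ℕ), ∀ k ≤ m, (k : ℝ) ≤ gp S 1 (h k) (z n) := by
      have := (Set.finite_Iic m).eventually_all (l := (hyperfilter ℕ : Filter ℕ))
        (p := fun k n => (k : ℝ) ≤ gp S 1 (h k) (z n))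
      exact (this.2 fun k _ => hh k)
    exact (this.frequently).filter_mono hle
  obtain ⟨φ, hφ, hp⟩ := extraction_forall_of_frequently hfreq
  refine ⟨φ, hφ, (convInf_iff S _).2 fun R => ?_⟩
  obtain ⟨N, hN⟩ := exists_nat_ge (R + δ)
  refine ⟨N, fun i j hi hj => ?_⟩
  have := gp_large hS hδ (by rw [gp_comm hS]; exact hp i N hi) (hp j N hj)
  linarith

end bdry

end Part7

section Part8


/-! ### The boundary kernel -/

/-- standing assumptions -/
structure Ctx {S : Set Γ} (δ : ℝ) (μ : Γ → ℝ) (B : Boundary Γ S) (Kb : Γ → B.pt → ℝ) : Prop where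
  hS : IsGenSet S
  hδ : IsHyperbolic S δ
  hne : Nonelementary Γ
  hμ : IsRWMeasure S μ
  hG : ∀ x y, GE μ x y ≠ ⊤
  hKb : ∀ (x : Γ) (ξ : B.pt) (u : ℕ → Γ), ConvInf S u → B.cls u = ξ →
      Tendsto (fun n => martinK μ x (u n)) atTop (𝓝 (Kb x ξ))

namespace Ctx

variable {S : Set Γ} {δ : ℝ} {μ : Γ → ℝ} {B : Boundary Γ S} {Kb : Γ → B.pt → ℝ}

lemma lim (X : Ctx δ μ B Kb) (x : Γ) (ξ : B.pt) :
    Tendsto (fun n => martinK μ x (rep B ξ n)) atTop (𝓝 (Kb x ξ)) :=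
  X.hKb x ξ _ (rep_conv B ξ) (rep_cls B ξ)

lemma bounds (X : Ctx δ μ B Kb) : ∃ c : ℝ, 0 < c ∧ c ≤ 1 ∧ ∀ (g : Γ) (ξ : B.pt),
    c ^ (wl S g) ≤ Kb g ξ ∧ Kb g ξ ≤ (c ^ (wl S g))⁻¹ := by
  obtain ⟨c, h0, h1, h⟩ := martinK_bounds X.hS X.hμ X.hG
  refine ⟨c, h0, h1, fun g ξ => ⟨?_, ?_⟩⟩
  · exact ge_of_tendsto' (X.lim g ξ) fun n => (h g _).1
  · exact le_of_tendsto' (X.lim g ξ) fun n => (h g _).2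

lemma pos (X : Ctx δ μ B Kb) (g : Γ) (ξ : B.pt) : 0 < Kb g ξ := by
  obtain ⟨c, h0, h1, h⟩ := X.bounds
  exact (pow_pos h0 _).trans_le (h g ξ).1

lemma Kpos (X : Ctx δ μ B Kb) (g y : Γ) : 0 < martinK μ g y := martinK_pos X.hμ X.hG g y

lemma cocycle (X : Ctx δ μ B Kb) (g h : Γ) (ξ : B.pt) :
    Kb (g * h) ξ = Kb g ξ * Kb h (B.smul g⁻¹ ξ) := by
  have h1 := X.lim (g * h) ξ
  have h2 := X.lim g ξ
  have h3 := X.hKb h _ _ (smul_seq X.hS B g⁻¹ ξ).1 (smul_seq X.hS B g⁻¹ ξ).2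
  have h4 := h2.mul h3
  simp_rw [← martinK_cocycle X.hμ X.hG] at h4
  exact tendsto_nhds_unique h1 h4

lemma K_one (X : Ctx δ μ B Kb) (ξ : B.pt) : Kb 1 ξ = 1 := by
  have h := X.cocycle 1 1 ξ
  rw [inv_one, smul_one, mul_one] at h
  have := X.pos 1 ξ
  nlinarith

lemma K_inv (X : Ctx δ μ B Kb) (g : Γ) (ξ : B.pt) : Kb g⁻¹ ξ = (Kb g (B.smul g ξ))⁻¹ := by
  have h := X.cocycle g⁻¹ g ξ
  rw [inv_inv, inv_mul_cancel, X.K_one] at h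
  have := X.pos g (B.smul g ξ)
  field_simp
  linarith

lemma wl_tendsto_of_gp (X : Ctx δ μ B Kb) {z z' : ℕ → Γ} (h : ∀ n : ℕ, (n : ℝ) ≤ gp S 1 (z n) (z' n)) :
    Tendsto (fun n => wl S (z n)) atTop atTop := by
  refine tendsto_atTop_mono (fun n => ?_) tendsto_id
  have h1 := gp_le_left X.hS 1 (z n) (z' n)
  rw [dd_one_right X.hS] at h1
  exact_mod_cast (h n).trans h1

lemma unif (X : Ctx δ μ B Kb) (b : Γ) {ε : ℝ} (hε : 0 < ε) :
    ∃ M : ℝ, ∀ z z' : Γ, M ≤ gp S 1 z z' → martinK μ b z ≤ (1 + ε) * martinK μ b z' := by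
  by_contra hcon
  push Not at hcon
  choose z z' h1 h2 using fun n : ℕ => hcon n
  obtain ⟨φ, hφ, hc⟩ := exists_subseq X.hS X.hδ (X.wl_tendsto_of_gp h1)
  have heq : EquivSeq S (fun n => z (φ n)) (fun n => z' (φ n)) := by
    rw [equivSeq_iff]
    intro R
    obtain ⟨N, hN⟩ := (convInf_iff S _).1 hc (R + δ)
    obtain ⟨N', hN'⟩ := exists_nat_ge (R + δ)
    refine ⟨max N N', fun i j hi hj => ?_⟩
    have a1 := hN i j ((le_max_left _ _).trans hi) ((le_max_left _ _).trans hj)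
    have a2 : R + δ ≤ gp S 1 (z (φ j)) (z' (φ j)) := by
      refine hN'.trans (le_trans ?_ (h1 (φ j)))
      exact_mod_cast ((le_max_right _ _).trans hj).trans (hφ.id_le j)
    have := gp_large X.hS X.hδ a1 a2
    linarith
  have hc' : ConvInf S (fun n => z' (φ n)) := convInf_of_equiv X.hS X.hδ (heq.symm' X.hS)
  have t1 := X.hKb b _ _ hc rfl
  have t2 := X.hKb b _ _ hc' rfl
  rw [← (B.cls_eq _ _ hc hc').2 heq] at t2
  have := le_of_tendsto_of_tendsto' (t2.const_mul (1 + ε)) t1 fun n => (h2 (φ n)).le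
  have hp := X.pos b (B.cls fun n => z (φ n))
  nlinarith

lemma unif_bdry (X : Ctx δ μ B Kb) (b : Γ) {ε : ℝ} (hε : 0 < ε) :
    ∃ M : ℝ, ∀ (z : Γ) (ξ : B.pt), Lb B z ξ M → martinK μ b z ≤ (1 + ε) * Kb b ξ ∧
      Kb b ξ ≤ (1 + ε) * martinK μ b z := by
  obtain ⟨M, hM⟩ := X.unif b hε
  refine ⟨M, fun z ξ h => ⟨?_, ?_⟩⟩
  · exact ge_of_tendsto ((X.lim b ξ).const_mul _) (Filter.Eventually.mono h fun n hn => hM _ _ hn)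
  · exact le_of_tendsto (X.lim b ξ) (Filter.Eventually.mono h fun n hn => hM _ _
      (by rw [gp_comm X.hS]; exact hn))

lemma unif_near (X : Ctx δ μ B Kb) (b : Γ) {ε : ℝ} (hε : 0 < ε) :
    ∃ M : ℝ, ∀ (ξ η : B.pt), near B ξ η M → Kb b ξ ≤ (1 + ε) * Kb b η := by
  obtain ⟨M, hM⟩ := X.unif b hε
  refine ⟨M, fun ξ η h => ?_⟩
  obtain ⟨N, hN⟩ := (near_iff B).1 h
  refine le_of_tendsto_of_tendsto (X.lim b ξ) ((X.lim b η).const_mul _) ?_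
  filter_upwards [eventually_ge_atTop N] with n hn
  exact hM _ _ (hN n n hn hn)

lemma continuous_K (X : Ctx δ μ B Kb) (g : Γ) : @Continuous _ _ (btop B) _ (Kb g) := by
  rw [@continuous_def _ _ (btop B)]
  intro O hO
  rw [isOpen_iff_near X.hS X.hδ]
  intro p hp
  obtain ⟨ε, hε, hsub⟩ := Metric.isOpen_iff.1 hO _ hp
  have hp0 := X.pos g p
  set t := min 1 (ε / (4 * Kb g p))
  have ht : 0 < t := by positivity
  have ht1 : t ≤ 1 := min_le_left _ _
  have ht2 : t * Kb g p ≤ ε / 4 := by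
    have : t ≤ ε / (4 * Kb g p) := min_le_right _ _
    calc t * Kb g p ≤ ε / (4 * Kb g p) * Kb g p := by gcongr
      _ = ε / 4 := by field_simp
  obtain ⟨M, hM⟩ := X.unif_near g ht
  refine ⟨M, fun q hq => hsub ?_⟩
  have h1 := hM _ _ hq
  have h2 := hM _ _ (hq.symm' X.hS)
  have hq0 := X.pos g q
  rw [Metric.mem_ball, Real.dist_eq, abs_lt]
  constructor
  · nlinarith
  · nlinarith

lemma harmonic (X : Ctx δ μ B Kb) (g : Γ) (ω : B.pt) :
    ∑' s, mE μ s * ENNReal.ofReal (Kb (g * s) ω) = ENNReal.ofReal (Kb g ω) := by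
  classical
  have hfin : ∀ f : Γ → ℝ≥0∞, ∑' s, mE μ s * f s = ∑ s ∈ X.hS.1.toFinset, mE μ s * f s := by
    intro f
    apply tsum_eq_sum
    intro s hs
    have : mE μ s = 0 := by
      by_contra h; exact hs (by simpa using mE_ne_zero X.hμ h)
    rw [this, zero_mul]
  rw [hfin]
  have hK : ∀ x y, ENNReal.ofReal (martinK μ x y) = GE μ x y / GE μ 1 y := by
    intro x y
    rw [martinK_eq X.hμ X.hG, ENNReal.ofReal_div_of_pos (GEr_pos X.hμ X.hG _ _),
      ENNReal.ofReal_toReal (X.hG _ _), ENNReal.ofReal_toReal (X.hG _ _)]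
  have t1 : Tendsto (fun n => ∑ s ∈ X.hS.1.toFinset, mE μ s * ENNReal.ofReal (martinK μ (g * s) (rep B ω n)))
      atTop (𝓝 (∑ s ∈ X.hS.1.toFinset, mE μ s * ENNReal.ofReal (Kb (g * s) ω))) := by
    apply tendsto_finsetSum
    intro s _
    exact ENNReal.Tendsto.const_mul (ENNReal.tendsto_ofReal (X.lim _ _)) (Or.inr ENNReal.ofReal_ne_top)
  have t2 := ENNReal.tendsto_ofReal (X.lim g ω)
  refine tendsto_nhds_unique t1 (t2.congr' ?_)
  obtain ⟨N, hN⟩ := (convInf_iff S _).1 (rep_conv B ω) (wl S g + 1)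
  filter_upwards [eventually_ge_atTop N] with n hn
  rw [← hfin, hK]
  simp_rw [hK]
  have hne : g ≠ rep B ω n := by
    intro h
    have h1 := (hN n n hn hn).trans (gp_le_left X.hS 1 _ _)
    rw [dd_one_right X.hS, ← h] at h1
    linarith
  rw [GE_step μ g, if_neg hne, zero_add]
  simp_rw [ENNReal.div_eq_inv_mul]
  rw [← ENNReal.tsum_mul_left]
  apply tsum_congr
  intro s
  ring

lemma harmonic_n (X : Ctx δ μ B Kb) (n : ℕ) (g : Γ) (ω : B.pt) :
    ∑' x, pE μ n g x * ENNReal.ofReal (Kb x ω) = ENNReal.ofReal (Kb g ω) := by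
  classical
  induction n generalizing g with
  | zero =>
    simp only [pE]
    rw [tsum_eq_single g]
    · simp
    · intro z hz; simp [hz.symm]
  | succ n ih =>
    simp only [pE]
    simp_rw [← ENNReal.tsum_mul_right]
    rw [ENNReal.tsum_comm]
    simp_rw [mul_assoc, ENNReal.tsum_mul_left, ih]
    exact X.harmonic g ω

end Ctx

end Part8

section Part9


/-! ### Dynamics on the boundary and invariant measures -/

section dyn

variable {S : Set Γ} {δ : ℝ}

lemma exists_subseq_bdry (hS : IsGenSet S) (hδ : IsHyperbolic S δ) {B : Boundary Γ S}
    (η : ℕ → B.pt) : ∃ (φ : ℕ → ℕ) (ξ : B.pt), StrictMono φ ∧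
      ∀ r : ℝ, ∀ᶠ n in atTop, near B (η (φ n)) ξ r := by
  choose z hz using fun n : ℕ => exists_Lb hS B (η n) n
  have h1 : Tendsto (fun n => wl S (z n)) atTop atTop := by
    refine tendsto_atTop_mono (fun n => ?_) tendsto_id
    exact_mod_cast (hz n).le_wl hS
  obtain ⟨φ, hφ, hc⟩ := exists_subseq hS hδ h1
  refine ⟨φ, B.cls (fun n => z (φ n)), hφ, fun r => ?_⟩
  obtain ⟨N, hN⟩ := exists_nat_ge (r + δ)
  filter_upwards [Lb_tendsto hS hc rfl (r + δ), eventually_ge_atTop N] with n h1 h2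
  have h3 : Lb B (z (φ n)) (η (φ n)) (r + δ) := (hz (φ n)).mono
    (hN.trans (by exact_mod_cast h2.trans (hφ.id_le n)))
  have := h3.near_of hS hδ h1
  rwa [add_sub_cancel_right] at this

lemma wl_tendsto (hS : IsGenSet S) {u : ℕ → Γ} (hu : ConvInf S u) (R : ℝ) :
    ∀ᶠ n in atTop, R ≤ wl S (u n) := by
  obtain ⟨N, hN⟩ := (convInf_iff S _).1 hu R
  filter_upwards [eventually_ge_atTop N] with n hn
  have := (hN n n hn hn).trans (gp_le_left hS 1 _ _)
  rwa [dd_one_right hS] at this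

/-- north-south dynamics -/
lemma dyn_conv (hS : IsGenSet S) (hδ : IsHyperbolic S δ) {B : Boundary Γ S} {u : ℕ → Γ}
    {a b η : B.pt} (hu : ConvInf S u) (ha : B.cls u = a) (hv : ConvInf S (fun n => (u n)⁻¹))
    (hb : B.cls (fun n => (u n)⁻¹) = b) (hη : η ≠ b) (r : ℝ) :
    ∀ᶠ n in atTop, near B (B.smul (u n) η) a r := by
  obtain ⟨t, ht⟩ := exists_not_near B hη.symm
  filter_upwards [Lb_tendsto hS hv hb (t + δ), Lb_tendsto hS hu ha (r + δ),
    wl_tendsto hS hu (r + δ + (t + δ) + 2 * δ)] with n h1 h2 h3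
  have h4 : ¬ Lb B (u n)⁻¹ η (t + δ) := by
    intro h5
    apply ht
    have := h1.near_of hS hδ h5
    rwa [add_sub_cancel_right] at this
  have h5 := (Lb_smul_of_far hS hδ h4).mono (r' := r + δ) (by linarith)
  have := h5.near_of hS hδ h2
  rwa [add_sub_cancel_right] at this

lemma dyn_lox (hS : IsGenSet S) (hδ : IsHyperbolic S δ) {B : Boundary Γ S} {p : Γ} (hp : Lox S p)
    {η : B.pt} (hη : η ≠ minusPt B p) (r : ℝ) :
    ∀ᶠ n in atTop, near B (B.smul (p ^ n) η) (plusPt B p) r := by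
  have h := (hp.inv hS hδ).convInf
  have e : (fun n : ℕ => (p ^ n)⁻¹) = fun n : ℕ => p⁻¹ ^ n := by funext n; rw [inv_pow]
  refine dyn_conv hS hδ (u := fun n => p ^ n) hp.convInf rfl ?_ (b := minusPt B p) ?_ hη r
  · rw [e]; exact h
  · rw [e]; rfl

lemma smul_plus (hS : IsGenSet S) (hδ : IsHyperbolic S δ) (B : Boundary Γ S) {p : Γ}
    (hp : Lox S p) : B.smul p (plusPt B p) = plusPt B p := by
  unfold plusPt
  rw [B.smul_cls _ _ hp.convInf]
  have := cls_comp B hp.convInf (tendsto_add_atTop_nat 1)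
  simp only [pow_succ'] at this
  exact this

lemma no_fixed (hS : IsGenSet S) (hδ : IsHyperbolic S δ) (hne : Nonelementary Γ)
    (B : Boundary Γ S) (η : B.pt) : ∃ k, B.smul k η ≠ η := by
  by_contra hcon
  push Not at hcon
  obtain ⟨p, hp⟩ := exists_inf hS hδ hne
  have hl := lox_of_inf hS hδ hp
  by_cases h : η = minusPt B p
  · obtain ⟨k, hk, _⟩ := exists_moving hS hδ hne B (hl.inv hS hδ)
    apply hk
    show B.smul k (minusPt B p) = minusPt B p
    rw [← h]; exact hcon k
  · have : η = plusPt B p := by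
      apply eq_of_near
      intro r
      obtain ⟨n, hn⟩ := (dyn_lox hS hδ hl h r).exists
      rwa [hcon] at hn
    obtain ⟨k, hk, _⟩ := exists_moving hS hδ hne B hl
    apply hk
    rw [← this]; exact hcon k

/-- a closed invariant set containing a point is everything -/
lemma minimal (hS : IsGenSet S) (hδ : IsHyperbolic S δ) (hne : Nonelementary Γ)
    (B : Boundary Γ S) (Z : Set B.pt) (hinv : ∀ g, ∀ ξ ∈ Z, B.smul g ξ ∈ Z)
    (hcl : ∀ ξ, (∀ r, ∃ η ∈ Z, near B η ξ r) → ξ ∈ Z) {η : B.pt} (hη : η ∈ Z) (ξ : B.pt) :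
    ξ ∈ Z := by
  obtain ⟨k, hk⟩ := no_fixed hS hδ hne B η
  obtain ⟨t, ht⟩ := exists_not_near B hk
  apply hcl
  intro r
  obtain ⟨n, h1, h2⟩ := ((Lb_tendsto hS (rep_conv B ξ) (rep_cls B ξ) (r + δ)).and
    (wl_tendsto hS (rep_conv B ξ) (r + δ + (t + δ) + 2 * δ))).exists
  set x := rep B ξ n
  have key : ∀ ζ : B.pt, ¬ Lb B x⁻¹ ζ (t + δ) → near B (B.smul x ζ) ξ r := by
    intro ζ hζ
    have h5 := (Lb_smul_of_far hS hδ hζ).mono (r' := r + δ) (by linarith)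
    have := h5.near_of hS hδ h1
    rwa [add_sub_cancel_right] at this
  by_cases hc : Lb B x⁻¹ η (t + δ)
  · refine ⟨_, hinv x _ (hinv k _ hη), key _ fun h => ht ?_⟩
    have := h.near_of hS hδ hc
    rwa [add_sub_cancel_right] at this
  · exact ⟨_, hinv x _ hη, key _ hc⟩

end dyn

/-- standing assumptions, with the measure -/
structure MCtx {S : Set Γ} (δ : ℝ) (μ : Γ → ℝ) (B : Boundary Γ S) (Kb : Γ → B.pt → ℝ)
    [mB : MeasurableSpace B.pt] (ν : Measure B.pt) : Prop extends Ctx δ μ B Kb where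
  hmB : mB = @borel B.pt (btop B)
  hν : IsProbabilityMeasure ν
  hRN : ∀ (g : Γ) (A : Set B.pt), MeasurableSet A →
      ν (B.smul g ⁻¹' A) = ∫⁻ ω in A, ENNReal.ofReal (Kb g ω) ∂ν

namespace MCtx

variable {S : Set Γ} {δ : ℝ} {μ : Γ → ℝ} {B : Boundary Γ S} {Kb : Γ → B.pt → ℝ}
  [mB : MeasurableSpace B.pt] {ν : Measure B.pt}

lemma meas_closed (X : MCtx δ μ B Kb ν) {C : Set B.pt} (h : IsClosed[btop B] C) :
    MeasurableSet C := by
  let _ := btop B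
  have : BorelSpace B.pt := ⟨X.hmB⟩
  exact h.measurableSet

lemma meas_hull (X : MCtx δ μ B Kb ν) (x : Γ) (r : ℝ) : MeasurableSet (hull B x r) :=
  X.meas_closed (isClosed_hull X.hS X.hδ B x r)

lemma meas_single (X : MCtx δ μ B Kb ν) (ξ : B.pt) : MeasurableSet ({ξ} : Set B.pt) :=
  X.meas_closed (isClosed_single X.hS X.hδ B ξ)

lemma meas_smul (X : MCtx δ μ B Kb ν) (g : Γ) : Measurable (B.smul g) := by
  let _ := btop B
  have : BorelSpace B.pt := ⟨X.hmB⟩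
  exact (continuous_smul' X.hS X.hδ B g).measurable

lemma meas_K (X : MCtx δ μ B Kb ν) (g : Γ) : Measurable (Kb g) := by
  let _ := btop B
  have : BorelSpace B.pt := ⟨X.hmB⟩
  exact (X.continuous_K g).measurable

/-- a shrinking sequence of closed neighbourhoods -/
lemma exists_nbhds (X : MCtx δ μ B Kb ν) (ξ : B.pt) : ∃ W : ℕ → Set B.pt,
    (∀ m, MeasurableSet (W m)) ∧ Antitone W ∧ (∀ m, ∃ r, ∀ q, near B q ξ r → q ∈ W m) ∧
    (∀ r, ∃ m, ∀ q ∈ W m, near B q ξ r) ∧ (⋂ m, W m) = {ξ} := by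
  have hd := X.hδ.1
  choose x hx using fun m : ℕ => exists_Lb X.hS B ξ (m + δ)
  have hnear : ∀ (m : ℕ) q, q ∈ hull B (x m) m → near B q ξ (m - 2 * δ) := by
    intro m q hq
    have h1 := Lb_of_mem_hull X.hS X.hδ hq
    have h2 := (hx m).mono (r' := m - δ) (by linarith)
    exact (h1.near_of X.hS X.hδ h2).mono (by linarith)
  have hself : ∀ m : ℕ, ∀ q, near B q ξ (m + δ) → q ∈ hull B (x m) m := by
    intro m q hq
    have := (hx m).near_trans X.hS X.hδ (hq.symm' X.hS)
    rw [add_sub_cancel_right] at this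
    exact this.mem_hull
  have hP : ∀ r, ∃ m, ∀ q ∈ ⋂ k ≤ m, hull B (x k) k, near B q ξ r := by
    intro r
    obtain ⟨m, hm⟩ := exists_nat_ge (r + 2 * δ)
    refine ⟨m, fun q hq => (hnear m q ?_).mono (by linarith)⟩
    exact Set.mem_iInter₂.1 hq m le_rfl
  refine ⟨fun m => ⋂ k ≤ m, hull B (x k) k, ?_, ?_, ?_, hP, ?_⟩
  · intro m
    exact MeasurableSet.biInter (Set.to_countable (Set.Iic m)) fun k _ => X.meas_hull _ _
  · intro m m' h q hq
    rw [Set.mem_iInter₂] at *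
    exact fun k hk => hq k (hk.trans h)
  · intro m
    refine ⟨m + δ, fun q hq => Set.mem_iInter₂.2 fun k hk => hself k q (hq.mono ?_)⟩
    have : (k : ℝ) ≤ m := by exact_mod_cast hk
    linarith
  · ext q
    simp only [Set.mem_iInter, Set.mem_singleton_iff]
    constructor
    · intro h
      apply eq_of_near
      intro r
      obtain ⟨m, hm⟩ := hP r
      exact hm q (by simpa using h m)
    · rintro rfl m k hk
      exact hself k q (near_refl B q _)

/-- there is no invariant measure -/
lemma no_invariant (X : MCtx δ μ B Kb ν) :
    ¬ ∀ (g : Γ) (A : Set B.pt), MeasurableSet A → ν (B.smul g ⁻¹' A) = ν A := by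
  intro hinv
  have := X.hν
  obtain ⟨p, hp⟩ := exists_inf X.hS X.hδ X.hne
  have hl := lox_of_inf X.hS X.hδ hp
  have hpm := plus_ne_minus X.hS X.hδ B hl
  have h1 : ν {minusPt B p}ᶜ ≤ ν {plusPt B p} := by
    obtain ⟨W, hW1, hW2, hW3, _, hW4⟩ := X.exists_nbhds (plusPt B p)
    have hlim := tendsto_measure_iInter_atTop (μ := ν) (fun m => (hW1 m).nullMeasurableSet) hW2
      ⟨0, measure_ne_top ν _⟩
    rw [hW4] at hlim
    refine ge_of_tendsto' hlim fun m => ?_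
    set E : ℕ → Set B.pt := fun N => {ω | ∀ n ≥ N, B.smul (p ^ n) ω ∈ W m}
    have hE : {minusPt B p}ᶜ ⊆ ⋃ N, E N := by
      intro ω hω
      obtain ⟨r, hr⟩ := hW3 m
      obtain ⟨N, hN⟩ := eventually_atTop.1 (dyn_lox X.hS X.hδ hl hω r)
      exact Set.mem_iUnion.2 ⟨N, fun n hn => hr _ (hN n hn)⟩
    have hmono : Monotone E := fun a b hab ω hω n hn => hω n (le_trans hab hn)
    refine (measure_mono hE).trans ?_
    rw [hmono.measure_iUnion]
    refine iSup_le fun N => ?_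
    rw [Function.comp_apply, ← hinv (p ^ N) _ (hW1 m)]
    exact measure_mono fun ω hω => hω N le_rfl
  have h2 : ν ({plusPt B p, minusPt B p}ᶜ) = 0 := by
    have e : ({minusPt B p}ᶜ : Set B.pt) = {plusPt B p} ∪ {plusPt B p, minusPt B p}ᶜ := by
      ext q
      simp only [Set.mem_compl_iff, Set.mem_singleton_iff, Set.mem_union, Set.mem_insert_iff, not_or]
      constructor
      · intro h; by_cases hq : q = plusPt B p
        · exact Or.inl hq
        · exact Or.inr ⟨hq, h⟩
      · rintro (h | h)
        · rw [h]; exact hpm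
        · exact h.2
    have hd : Disjoint ({plusPt B p} : Set B.pt) ({plusPt B p, minusPt B p}ᶜ) := by
      rw [Set.disjoint_left]; intro q hq hq'; exact hq' (Or.inl hq)
    rw [e, measure_union' hd (X.meas_single _)] at h1
    have := ENNReal.le_of_add_le_add_left (measure_ne_top ν {plusPt B p})
      (h1.trans (le_of_eq (add_zero _).symm))
    exact le_antisymm this bot_le
  have hmeas : MeasurableSet (({plusPt B p, minusPt B p} : Set B.pt)ᶜ) :=
    ((X.meas_single _).union (X.meas_single _)).compl
  have h3 : ∀ k, B.smul k (plusPt B p) ≠ plusPt B p → B.smul k (plusPt B p) ≠ minusPt B p →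
      ν {minusPt B p} = 1 := by
    intro k hk1 hk2
    have h4 := hinv k⁻¹ _ hmeas
    rw [h2] at h4
    have h5 : ({B.smul k (minusPt B p)} : Set B.pt)ᶜ ⊆
        ({plusPt B p, minusPt B p}ᶜ) ∪ (B.smul k⁻¹ ⁻¹' {plusPt B p, minusPt B p}ᶜ) := by
      intro q hq
      by_contra hc
      rw [Set.mem_union, not_or] at hc
      obtain ⟨c1, c2⟩ := hc
      have c1' : q = plusPt B p ∨ q = minusPt B p := by
        by_contra h; exact c1 h
      have c2' : B.smul k⁻¹ q = plusPt B p ∨ B.smul k⁻¹ q = minusPt B p := by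
        by_contra h; exact c2 h
      rcases c2' with c | c
      · have : q = B.smul k (plusPt B p) := by rw [← c, smul_inv_smul X.hS]
        rcases c1' with c1' | c1'
        · exact hk1 (this ▸ c1')
        · exact hk2 (this ▸ c1')
      · exact hq (by rw [Set.mem_singleton_iff, ← c, smul_inv_smul X.hS])
    have h6 : ν ({B.smul k (minusPt B p)} : Set B.pt)ᶜ = 0 :=
      le_antisymm ((measure_mono h5).trans ((measure_union_le _ _).trans (by rw [h2, h4, add_zero])))
        bot_le
    have h7 := (prob_compl_eq_zero_iff (X.meas_single (B.smul k (minusPt B p)))).1 h6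
    rw [← h7, ← hinv k _ (X.meas_single (B.smul k (minusPt B p)))]
    congr 1
    ext q
    simp only [Set.mem_singleton_iff, Set.mem_preimage]
    constructor
    · rintro rfl; rfl
    · intro h; rw [← inv_smul_smul X.hS B k q, h, inv_smul_smul X.hS]
  obtain ⟨k, hk1, hk2⟩ := exists_moving X.hS X.hδ X.hne B hl
  have h4 := h3 k hk1 hk2
  obtain ⟨k', hk1', _⟩ := exists_moving X.hS X.hδ X.hne B (hl.inv X.hS X.hδ)
  have hk' : B.smul k' (minusPt B p) ≠ minusPt B p := hk1'
  have h5 : ν {B.smul k' (minusPt B p)} = 1 := by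
    rw [← h4, ← hinv k' _ (X.meas_single (B.smul k' (minusPt B p)))]
    congr 1
    ext q
    simp only [Set.mem_singleton_iff, Set.mem_preimage]
    constructor
    · intro h; rw [← inv_smul_smul X.hS B k' q, h, inv_smul_smul X.hS]
    · rintro rfl; rfl
  have hd : Disjoint ({B.smul k' (minusPt B p)} : Set B.pt) {minusPt B p} := by
    simpa using hk'
  have h6 := measure_union (μ := ν) hd (X.meas_single (minusPt B p))
  rw [h4, h5] at h6
  have h7 := prob_le_one (μ := ν) (s := {B.smul k' (minusPt B p)} ∪ {minusPt B p})
  rw [h6] at h7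
  norm_num at h7

end MCtx

end Part9

section Part10


/-! ### Exponential decay -/

/-- `Σ_h p⁽ⁿ⁾(e,h) √K(h,η)` -/
noncomputable def qq {S : Set Γ} {B : Boundary Γ S} (μ : Γ → ℝ) (Kb : Γ → B.pt → ℝ) (n : ℕ)
    (η : B.pt) : ℝ≥0∞ := ∑' h, pE μ n 1 h * ENNReal.ofReal (√(Kb h η))

namespace Ctx

variable {S : Set Γ} {δ : ℝ} {μ : Γ → ℝ} {B : Boundary Γ S} {Kb : Γ → B.pt → ℝ}

lemma qq_add (X : Ctx δ μ B Kb) (n k : ℕ) (η : B.pt) :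
    qq μ Kb (n + k) η = ∑' g, pE μ n 1 g * ENNReal.ofReal (√(Kb g η)) * qq μ Kb k (B.smul g⁻¹ η) := by
  unfold qq
  simp_rw [pE_add, ← ENNReal.tsum_mul_right, ← ENNReal.tsum_mul_left]
  rw [ENNReal.tsum_comm]
  apply tsum_congr
  intro g
  rw [← (Equiv.mulLeft g).tsum_eq]
  apply tsum_congr
  intro h
  simp only [Equiv.coe_mulLeft]
  have e := pE_inv μ k g 1 h
  rw [mul_one] at e
  rw [e, X.cocycle g h η, Real.sqrt_mul (X.pos g η).le, ENNReal.ofReal_mul (Real.sqrt_nonneg _)]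
  ring

lemma qq_gap (X : Ctx δ μ B Kb) (n : ℕ) (η : B.pt) :
    qq μ Kb n η + ∑' h, pE μ n 1 h * ENNReal.ofReal ((1 - √(Kb h η)) ^ 2 / 2) = 1 := by
  have h1 := X.harmonic_n n 1 η
  have h2 := pE_total X.hμ n (1 : Γ)
  rw [X.K_one, ENNReal.ofReal_one] at h1
  unfold qq
  rw [← ENNReal.tsum_add]
  have : ∀ h, pE μ n 1 h * ENNReal.ofReal (√(Kb h η)) +
      pE μ n 1 h * ENNReal.ofReal ((1 - √(Kb h η)) ^ 2 / 2) =
      (2⁻¹ : ℝ≥0∞) * (pE μ n 1 h + pE μ n 1 h * ENNReal.ofReal (Kb h η)) := by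
    intro h
    rw [← mul_add, ← ENNReal.ofReal_add (Real.sqrt_nonneg _) (by positivity)]
    have e : √(Kb h η) + (1 - √(Kb h η)) ^ 2 / 2 = 2⁻¹ * (1 + Kb h η) := by
      have := Real.sq_sqrt (X.pos h η).le
      nlinarith
    rw [e, ENNReal.ofReal_mul (by norm_num), ENNReal.ofReal_add zero_le_one (X.pos h η).le,
      ENNReal.ofReal_one, ENNReal.ofReal_inv_of_pos (by norm_num)]
    simp only [ENNReal.ofReal_ofNat]
    ring
  simp_rw [this]
  rw [ENNReal.tsum_mul_left, ENNReal.tsum_add, h1, h2, one_add_one_eq_two]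
  exact ENNReal.inv_mul_cancel (by norm_num) (by norm_num)

lemma qq_le_one (X : Ctx δ μ B Kb) (n : ℕ) (η : B.pt) : qq μ Kb n η ≤ 1 := by
  rw [← X.qq_gap n η]; exact le_self_add

lemma qq_anti (X : Ctx δ μ B Kb) (n k : ℕ) (η : B.pt) : qq μ Kb (n + k) η ≤ qq μ Kb n η := by
  rw [X.qq_add]
  unfold qq
  apply ENNReal.tsum_le_tsum
  intro h
  exact mul_le_of_le_one_right' (X.qq_le_one _ _)

end Ctx

namespace MCtx

variable {S : Set Γ} {δ : ℝ} {μ : Γ → ℝ} {B : Boundary Γ S} {Kb : Γ → B.pt → ℝ}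
  [mB : MeasurableSpace B.pt] {ν : Measure B.pt}

lemma qq_lt (X : MCtx δ μ B Kb ν) : ∃ N : ℕ, 1 ≤ N ∧ ∃ θ : ℝ, 0 < θ ∧ θ < 1 ∧ ∀ η,
    qq μ Kb N η ≤ ENNReal.ofReal θ := by
  by_contra hcon
  push Not at hcon
  have h0 : ∀ N : ℕ, ∃ η, ENNReal.ofReal (1 - 1 / (N + 2)) < qq μ Kb (N + 1) η := by
    intro N
    have h2 : (2 : ℝ) ≤ (N : ℝ) + 2 := by have := Nat.cast_nonneg (α := ℝ) N; linarith
    have h3 : 1 / ((N : ℝ) + 2) ≤ 1 / 2 := one_div_le_one_div_of_le (by norm_num) h2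
    have h4 : 0 < 1 / ((N : ℝ) + 2) := by positivity
    exact hcon (N + 1) (by omega) _ (by linarith) (by linarith)
  choose η hη using h0
  -- pointwise convergence to one
  have hconv : ∀ h : Γ, Tendsto (fun N => Kb h (η N)) atTop (𝓝 1) := by
    intro h
    obtain ⟨n, hn1, hn⟩ := pE_pos X.hμ 1 h
    have hb : ∀ N ≥ n, (1 - √(Kb h (η N))) ^ 2 ≤ 2 / (pE μ n 1 h).toReal * (1 / (N + 2)) := by
      intro N hN
      have a1 : ENNReal.ofReal (1 - 1 / (N + 2)) ≤ qq μ Kb n (η N) := by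
        refine (hη N).le.trans ?_
        obtain ⟨k, hk⟩ := Nat.exists_eq_add_of_le (show n ≤ N + 1 by omega)
        rw [hk]; exact X.qq_anti n k _
      have a2 := X.qq_gap n (η N)
      have a3 := ENNReal.le_tsum (f := fun h => pE μ n 1 h * ENNReal.ofReal ((1 - √(Kb h (η N))) ^ 2 / 2)) h
      have a4 : ENNReal.ofReal (1 - 1 / (N + 2)) +
          pE μ n 1 h * ENNReal.ofReal ((1 - √(Kb h (η N))) ^ 2 / 2) ≤ 1 := by
        rw [← a2]; exact add_le_add a1 a3
      rw [← ENNReal.ofReal_toReal (pE_ne_top X.hμ n 1 h), ← ENNReal.ofReal_mul ENNReal.toReal_nonneg,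
        ← ENNReal.ofReal_add _ (by positivity), ENNReal.ofReal_le_one] at a4
      · have hp : 0 < (pE μ n 1 h).toReal := ENNReal.toReal_pos hn.ne' (pE_ne_top X.hμ n 1 h)
        rw [div_mul_eq_mul_div, le_div_iff₀ hp]
        linarith
      · have : 1 / ((N : ℝ) + 2) ≤ 1 / 1 := one_div_le_one_div_of_le (by norm_num)
          (by have := Nat.cast_nonneg (α := ℝ) N; linarith)
        linarith
    have t0 : Tendsto (fun N : ℕ => 2 / (pE μ n 1 h).toReal * (1 / ((N : ℝ) + 2))) atTop (𝓝 0) := by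
      have : Tendsto (fun N : ℕ => 1 / ((N : ℝ) + 2)) atTop (𝓝 0) := by
        have := tendsto_one_div_add_atTop_nhds_zero_nat (𝕜 := ℝ)
        have := (tendsto_add_atTop_iff_nat 1).2 this
        refine this.congr fun N => ?_
        push_cast; ring_nf
      simpa using this.const_mul (2 / (pE μ n 1 h).toReal)
    have t1 : Tendsto (fun N => (1 - √(Kb h (η N))) ^ 2) atTop (𝓝 0) := by
      refine tendsto_of_tendsto_of_tendsto_of_le_of_le' tendsto_const_nhds t0
        (Eventually.of_forall fun N => by positivity) ?_
      filter_upwards [eventually_ge_atTop n] with N hN using hb N hN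
    have t2 : Tendsto (fun N => 1 - √(Kb h (η N))) atTop (𝓝 0) := by
      have := t1.sqrt
      simp only [Real.sqrt_sq_eq_abs, Real.sqrt_zero] at this
      exact (tendsto_zero_iff_abs_tendsto_zero _).2 this
    have t3 : Tendsto (fun N => (1 - (1 - √(Kb h (η N)))) ^ 2) atTop (𝓝 ((1 - 0) ^ 2)) :=
      (tendsto_const_nhds.sub t2).pow 2
    simp only [sub_sub_cancel, sub_zero, one_pow] at t3
    refine t3.congr fun N => Real.sq_sqrt (X.pos h _).le
  obtain ⟨φ, ξ, hφ, hξ⟩ := exists_subseq_bdry X.hS X.hδ η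
  have hle : ∀ a b : ℝ, (∀ ε > 0, a ≤ (1 + ε) * b) → a ≤ b := by
    intro a b hab
    have t : Tendsto (fun ε : ℝ => (1 + ε) * b) (𝓝[>] 0) (𝓝 ((1 + 0) * b)) := by
      apply Tendsto.mono_left _ nhdsWithin_le_nhds
      exact (Continuous.tendsto (by fun_prop) 0)
    rw [add_zero, one_mul] at t
    exact ge_of_tendsto t (eventually_mem_nhdsWithin.mono fun ε hε => hab ε hε)
  have hξ1 : ∀ h, Kb h ξ = 1 := by
    intro h
    have t := (hconv h).comp hφ.tendsto_atTop
    apply le_antisymm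
    · apply hle
      intro ε hε
      obtain ⟨M, hM⟩ := X.unif_near h hε
      refine ge_of_tendsto (t.const_mul _) ?_
      filter_upwards [hξ M] with n hn
      exact hM _ _ (hn.symm' X.hS)
    · apply hle
      intro ε hε
      obtain ⟨M, hM⟩ := X.unif_near h hε
      refine le_of_tendsto t ?_
      filter_upwards [hξ M] with n hn
      exact hM _ _ hn
  have hall : ∀ ζ : B.pt, ζ ∈ {ζ : B.pt | ∀ h, Kb h ζ = 1} := by
    refine minimal X.hS X.hδ X.hne B _ ?_ ?_ (η := ξ) hξ1
    · intro g ζ hζ h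
      have := X.cocycle g⁻¹ h ζ
      rw [hζ, hζ, inv_inv, one_mul] at this
      exact this.symm
    · intro ζ hζ h
      apply le_antisymm
      · apply hle
        intro ε hε
        obtain ⟨M, hM⟩ := X.unif_near h hε
        obtain ⟨η', h1, h2⟩ := hζ M
        have := hM _ _ (h2.symm' X.hS)
        rwa [h1 h] at this
      · apply hle
        intro ε hε
        obtain ⟨M, hM⟩ := X.unif_near h hε
        obtain ⟨η', h1, h2⟩ := hζ M
        have := hM _ _ h2
        rwa [h1 h] at this
  apply X.no_invariant
  intro g A hA
  rw [X.hRN g A hA]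
  have : ∀ ω, Kb g ω = 1 := fun ω => hall ω g
  simp [this]

lemma qq_decay (X : MCtx δ μ B Kb ν) : ∃ C ρ : ℝ, 0 < C ∧ 0 < ρ ∧ ρ < 1 ∧ ∀ n η,
    qq μ Kb n η ≤ ENNReal.ofReal (C * ρ ^ n) := by
  obtain ⟨N, hN, θ, h0, h1, h⟩ := X.qq_lt
  have hpow : ∀ k η, qq μ Kb (N * k) η ≤ ENNReal.ofReal (θ ^ k) := by
    intro k
    induction k with
    | zero => intro η; simpa using X.qq_le_one 0 η
    | succ k ih =>
      intro η
      rw [show N * (k + 1) = N + N * k by ring, X.qq_add]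
      calc _ ≤ ∑' g, pE μ N 1 g * ENNReal.ofReal (√(Kb g η)) * ENNReal.ofReal (θ ^ k) :=
            ENNReal.tsum_le_tsum fun g => by gcongr; exact ih _
        _ = qq μ Kb N η * ENNReal.ofReal (θ ^ k) := by rw [ENNReal.tsum_mul_right]; rfl
        _ ≤ ENNReal.ofReal θ * ENNReal.ofReal (θ ^ k) := by gcongr; exact h η
        _ = _ := by rw [← ENNReal.ofReal_mul h0.le, pow_succ']
  set ρ := θ ^ ((N : ℝ)⁻¹)
  have hN0 : N ≠ 0 := by omega
  have hρN : ρ ^ N = θ := Real.rpow_inv_natCast_pow h0.le hN0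
  have hρ0 : 0 < ρ := Real.rpow_pos_of_pos h0 _
  have hρ1 : ρ < 1 := Real.rpow_lt_one h0.le h1 (by positivity)
  refine ⟨θ⁻¹, ρ, inv_pos.2 h0, hρ0, hρ1, fun n η => ?_⟩
  have e := Nat.div_add_mod n N
  calc qq μ Kb n η ≤ qq μ Kb (N * (n / N)) η := by
        conv_lhs => rw [← e]
        exact X.qq_anti _ _ _
    _ ≤ ENNReal.ofReal (θ ^ (n / N)) := hpow _ _
    _ ≤ _ := by
        apply ENNReal.ofReal_le_ofReal
        rw [← div_eq_inv_mul, le_div_iff₀ h0]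
        conv_rhs => rw [← e, pow_add, pow_mul, hρN]
        gcongr
        rw [← hρN]
        exact pow_le_pow_of_le_one hρ0.le hρ1.le (Nat.mod_lt _ (by omega)).le

lemma exists_K_ge (X : MCtx δ μ B Kb ν) (x : Γ) : ∃ ω, 1 ≤ Kb x ω := by
  have := X.hν
  by_contra hcon
  push Not at hcon
  have h1 := X.hRN x Set.univ MeasurableSet.univ
  rw [Set.preimage_univ, measure_univ, Measure.restrict_univ] at h1
  have hm : Measurable fun ω => ENNReal.ofReal (Kb x ω) := (X.meas_K x).ennreal_ofReal
  have h2 : ∫⁻ ω, ENNReal.ofReal (Kb x ω) ∂ν < ∫⁻ ω, 1 ∂ν := by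
    apply lintegral_strict_mono
    · exact (NeZero.ne ν)
    · exact aemeasurable_const
    · rw [← h1]; simp
    · exact Eventually.of_forall fun ω => by
        rw [← ENNReal.ofReal_one]
        exact (ENNReal.ofReal_lt_ofReal_iff zero_lt_one).2 (hcon ω)
  rw [← h1, lintegral_const, measure_univ, mul_one] at h2
  exact lt_irrefl _ h2

lemma pE_decay (X : MCtx δ μ B Kb ν) : ∃ C ρ : ℝ, 0 < C ∧ 0 < ρ ∧ ρ < 1 ∧ ∀ n x y,
    pE μ n x y ≤ ENNReal.ofReal (C * ρ ^ n) := by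
  obtain ⟨C, ρ, hC, h0, h1, h⟩ := X.qq_decay
  refine ⟨C, ρ, hC, h0, h1, fun n x y => ?_⟩
  have e := pE_inv μ n x 1 (x⁻¹ * y)
  rw [mul_one, mul_inv_cancel_left] at e
  rw [e]
  obtain ⟨ω, hω⟩ := X.exists_K_ge (x⁻¹ * y)
  refine le_trans ?_ (h n ω)
  refine le_trans ?_ (ENNReal.le_tsum (x⁻¹ * y))
  apply le_mul_of_one_le_right'
  rw [← ENNReal.ofReal_one]
  exact ENNReal.ofReal_le_ofReal (Real.one_le_sqrt.2 hω)

/-- tails of the Green series -/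
lemma tail_decay (X : MCtx δ μ B Kb ν) : ∃ C ρ : ℝ, 0 < C ∧ 0 < ρ ∧ ρ < 1 ∧ ∀ (N : ℕ) (x y : Γ),
    ∑' n, pE μ (n + N) x y ≤ ENNReal.ofReal (C * ρ ^ N) := by
  obtain ⟨C, ρ, hC, h0, h1, h⟩ := X.pE_decay
  have h1' : 0 < 1 - ρ := by linarith
  refine ⟨C / (1 - ρ), ρ, by positivity, h0, h1, fun N x y => ?_⟩
  calc ∑' n, pE μ (n + N) x y ≤ ∑' n, ENNReal.ofReal (C * ρ ^ (n + N)) :=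
        ENNReal.tsum_le_tsum fun n => h _ _ _
    _ = ENNReal.ofReal (∑' n, C * ρ ^ (n + N)) := by
        rw [ENNReal.ofReal_tsum_of_nonneg]
        · intro n; positivity
        · simp_rw [pow_add, ← mul_assoc]
          exact ((summable_geometric_of_lt_one h0.le h1).mul_left C).mul_right _
    _ = _ := by
        congr 1
        simp_rw [pow_add, ← mul_assoc]
        rw [tsum_mul_right, tsum_mul_left, tsum_geometric_of_lt_one h0.le h1]
        field_simp

lemma GE_decay (X : MCtx δ μ B Kb ν) : ∃ C ρ : ℝ, 0 < C ∧ 0 < ρ ∧ ρ < 1 ∧ ∀ (x : Γ),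
    GE μ 1 x ≤ ENNReal.ofReal (C * ρ ^ (wl S x)) := by
  obtain ⟨C, ρ, hC, h0, h1, h⟩ := X.tail_decay
  refine ⟨C, ρ, hC, h0, h1, fun x => ?_⟩
  refine le_trans (le_of_eq ?_) (h (wl S x) 1 x)
  unfold GE
  rw [← ENNReal.summable.sum_add_tsum_nat_add' (k := wl S x) (f := fun n => pE μ n 1 x),
    Finset.sum_eq_zero, zero_add]
  intro n hn
  by_contra hc
  have := pE_support X.hS X.hμ hc
  rw [dd_one_left] at this
  rw [Finset.mem_range] at hn
  have : wl S x ≤ n := by exact_mod_cast this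
  omega

end MCtx

end Part10

section Part11


/-! ### Paths avoiding a set -/

section avoid

open Classical in
/-- weight of the paths of length `n` from `x` to `z` avoiding `U` -/
noncomputable def aE (μ : Γ → ℝ) (U : Set Γ) : ℕ → Γ → Γ → ℝ≥0∞
  | 0 => fun x z => if x = z ∧ x ∉ U then 1 else 0
  | n + 1 => fun x z => if x ∈ U then 0 else ∑' s : Γ, mE μ s * aE μ U n (x * s) z

/-- Green function of the walk killed in `U` -/
noncomputable def AE (μ : Γ → ℝ) (U : Set Γ) (x z : Γ) : ℝ≥0∞ := ∑' n, aE μ U n x z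

variable {S : Set Γ} {δ : ℝ} {μ : Γ → ℝ} {U : Set Γ}

lemma aE_le (μ : Γ → ℝ) (U : Set Γ) (n : ℕ) (x z : Γ) : aE μ U n x z ≤ pE μ n x z := by
  induction n generalizing x with
  | zero =>
    simp only [aE, pE]
    split_ifs with h1 h2 h2
    · exact le_rfl
    · exact absurd h1.1 h2
    · exact zero_le_one
    · exact le_rfl
  | succ n ih =>
    simp only [aE, pE]
    split_ifs
    · exact bot_le
    · exact ENNReal.tsum_le_tsum fun s => by gcongr; exact ih _

lemma aE_empty (μ : Γ → ℝ) (n : ℕ) (x z : Γ) : aE μ ∅ n x z = pE μ n x z := by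
  induction n generalizing x with
  | zero =>
    simp only [aE, pE]
    by_cases h : x = z <;> simp [h]
  | succ n ih => simp [aE, pE, ih]

lemma AE_empty (μ : Γ → ℝ) (x z : Γ) : AE μ ∅ x z = GE μ x z := by
  unfold AE GE; simp_rw [aE_empty]

lemma aE_left {n : ℕ} {x z : Γ} (h : x ∈ U) : aE μ U n x z = 0 := by
  cases n <;> simp [aE, h]

lemma aE_right {n : ℕ} {x z : Γ} (h : z ∈ U) : aE μ U n x z = 0 := by
  induction n generalizing x with
  | zero =>
    simp only [aE]
    rw [if_neg]
    rintro ⟨rfl, h'⟩; exact h' h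
  | succ n ih => simp [aE, ih]

lemma aE_add (μ : Γ → ℝ) (U : Set Γ) (n k : ℕ) (x z : Γ) :
    aE μ U (n + k) x z = ∑' y, aE μ U n x y * aE μ U k y z := by
  classical
  induction n generalizing x with
  | zero =>
    rw [Nat.zero_add, tsum_eq_single x]
    · by_cases h : x ∈ U
      · simp [aE_left h]
      · simp [aE, h]
    · intro y hy; simp [aE, hy.symm]
  | succ n ih =>
    rw [show n + 1 + k = (n + k) + 1 by ring]
    by_cases h : x ∈ U
    · simp [aE_left h]
    · simp only [aE, h, if_false, ih]
      simp_rw [← ENNReal.tsum_mul_left, ← ENNReal.tsum_mul_right]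
      rw [ENNReal.tsum_comm]
      simp_rw [mul_assoc]

lemma aE_one (μ : Γ → ℝ) (U : Set Γ) {x z : Γ} (hx : x ∉ U) (hz : z ∉ U) :
    aE μ U 1 x z = mE μ (x⁻¹ * z) := by
  classical
  simp only [aE, hx, if_false]
  rw [tsum_eq_single (x⁻¹ * z)]
  · simp [hz]
  · intro s hs
    rw [if_neg, mul_zero]
    rintro ⟨rfl, _⟩; apply hs; simp

lemma aE_refl (μ : Γ → ℝ) (U : Set Γ) (n : ℕ) (x z : Γ) :
    aE (refl μ) U n x z = aE μ U n z x := by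
  classical
  induction n generalizing z with
  | zero =>
    simp only [aE]
    by_cases h : x = z
    · simp [h]
    · simp [h, Ne.symm h]
  | succ n ih =>
    by_cases hz : z ∈ U
    · rw [aE_left hz, aE_right hz]
    rw [aE_add]
    simp only [aE.eq_2 μ, hz, if_false]
    rw [← (Equiv.mulLeft z).tsum_eq]
    apply tsum_congr
    intro s
    rw [mul_comm]
    simp only [Equiv.coe_mulLeft, ih]
    by_cases hs : z * s ∈ U
    · rw [aE_left hs, aE_left hs, zero_mul, mul_zero]
    rw [aE_one _ _ hs hz]
    congr 1
    simp [mE, refl]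

lemma AE_refl (μ : Γ → ℝ) (U : Set Γ) (x z : Γ) : AE (refl μ) U x z = AE μ U z x := by
  unfold AE; simp_rw [aE_refl]

lemma AE_left {x z : Γ} (h : x ∈ U) : AE μ U x z = 0 := by
  unfold AE; simp [aE_left h]

lemma AE_right {x z : Γ} (h : z ∈ U) : AE μ U x z = 0 := by
  unfold AE; simp [aE_right h]

/-- first hitting decomposition, as an inequality -/
lemma AE_hit (μ : Γ → ℝ) (B0 U : Set Γ) (z : Γ) (f : Γ → ℝ≥0∞)
    (hf : ∀ a, ∑' s, mE μ s * f (a * s) ≤ f a) (hU : ∀ a ∈ U, AE μ B0 a z ≤ f a) (a : Γ) :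
    AE μ B0 a z ≤ AE μ U a z + f a := by
  classical
  have key : ∀ N a, ∑ n ∈ Finset.range N, aE μ B0 n a z ≤
      ∑ n ∈ Finset.range N, aE μ U n a z + f a := by
    intro N
    induction N with
    | zero => intro a; simp
    | succ N ih =>
      intro a
      by_cases ha : a ∈ U
      · refine (ENNReal.sum_le_tsum _).trans ((hU a ha).trans le_add_self)
      by_cases hb : a ∈ B0
      · simp [aE_left hb]
      rw [Finset.sum_range_succ', Finset.sum_range_succ']
      have h0 : aE μ B0 0 a z = aE μ U 0 a z := by simp [aE, ha, hb]
      have e : ∀ V : Set Γ, a ∉ V → ∑ n ∈ Finset.range N, aE μ V (n + 1) a z =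
          ∑' s, mE μ s * ∑ n ∈ Finset.range N, aE μ V n (a * s) z := by
        intro V hV
        simp only [aE, hV, if_false]
        simp_rw [Finset.mul_sum]
        rw [Summable.tsum_finsetSum (fun i _ => ENNReal.summable)]
      rw [h0, e B0 hb, e U ha]
      calc _ ≤ ∑' s, mE μ s * (∑ n ∈ Finset.range N, aE μ U n (a * s) z + f (a * s)) + aE μ U 0 a z := by
            gcongr; exact ih _
        _ = ∑' s, mE μ s * ∑ n ∈ Finset.range N, aE μ U n (a * s) z +
            ∑' s, mE μ s * f (a * s) + aE μ U 0 a z := by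
            rw [← ENNReal.tsum_add]; simp_rw [mul_add]
        _ ≤ ∑' s, mE μ s * ∑ n ∈ Finset.range N, aE μ U n (a * s) z + f a + aE μ U 0 a z := by
            gcongr; exact hf a
        _ = _ := by ring
  unfold AE
  rw [ENNReal.tsum_eq_iSup_nat]
  refine iSup_le fun N => (key N a).trans ?_
  gcongr
  exact ENNReal.sum_le_tsum _

lemma aE_length (hS : IsGenSet S) (hδ : IsHyperbolic S δ) (hμ : IsRWMeasure S μ) {c : Γ} {r : ℝ}
    (hU : ∀ y, dd S c y < r → y ∈ U) (k : ℕ) : ∀ (n : ℕ) (x z : Γ), n ≤ 2 ^ k →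
    aE μ U n x z ≠ 0 → r - 1 - k * δ ≤ gp S c x z := by
  induction k with
  | zero =>
    intro n x z hn h
    have hx : r ≤ dd S c x := by
      by_contra hc; push Not at hc; exact h (aE_left (hU x hc))
    have hz : r ≤ dd S c z := by
      by_contra hc; push Not at hc; exact h (aE_right (hU z hc))
    have h1 : pE μ n x z ≠ 0 := fun h0 => h (le_antisymm ((aE_le μ U n x z).trans h0.le) bot_le)
    have h2 := pE_support hS hμ h1
    have h3 : (n : ℝ) ≤ 1 := by
      have : n ≤ 1 := by simpa using hn
      exact_mod_cast this
    rw [gp_eq, dd_comm hS x c, dd_comm hS z c]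
    push_cast
    linarith
  | succ k ih =>
    intro n x z hn h
    have hsplit : ∃ n1 n2, n = n1 + n2 ∧ n1 ≤ 2 ^ k ∧ n2 ≤ 2 ^ k := by
      refine ⟨min n (2 ^ k), n - 2 ^ k, ?_, min_le_right _ _, ?_⟩
      · omega
      · rw [pow_succ] at hn; omega
    obtain ⟨n1, n2, rfl, h1, h2⟩ := hsplit
    rw [aE_add] at h
    simp only [ne_eq, ENNReal.tsum_eq_zero, not_forall, mul_eq_zero, not_or] at h
    obtain ⟨y, hy1, hy2⟩ := h
    have := gp_large hS hδ (ih n1 x y h1 hy1) (ih n2 y z h2 hy2)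
    push_cast
    linarith

/-- paths avoiding a ball have small weight -/
lemma AE_small (hS : IsGenSet S) (hδ : IsHyperbolic S δ) (hμ : IsRWMeasure S μ) {C ρ : ℝ}
    (ht : ∀ (N : ℕ) (x y : Γ), ∑' n, pE μ (n + N) x y ≤ ENNReal.ofReal (C * ρ ^ N))
    {c : Γ} {r : ℝ} (k : ℕ) (hU : ∀ y, dd S c y < r → y ∈ U)
    {x z : Γ} (hg : gp S c x z < r - 1 - k * δ) :
    AE μ U x z ≤ ENNReal.ofReal (C * ρ ^ (2 ^ k)) := by
  refine le_trans ?_ (ht (2 ^ k) x z)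
  unfold AE
  rw [← ENNReal.summable.sum_add_tsum_nat_add' (k := 2 ^ k) (f := fun n => aE μ U n x z),
    Finset.sum_eq_zero, zero_add]
  · exact ENNReal.tsum_le_tsum fun n => aE_le _ _ _ _ _
  · intro n hn
    by_contra hc
    have := aE_length hS hδ hμ hU k n x z (Finset.mem_range.1 hn).le hc
    linarith

/-- the tree like estimate -/
lemma gp_tree (hS : IsGenSet S) (hδ : IsHyperbolic S δ) {α a b x : Γ} {s m : ℝ}
    (h1 : dd S 1 α = s) (h2 : gp S 1 α x = s) (ha : s ≤ gp S 1 a x) (hb : gp S 1 b x ≤ m)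
    (hm : m + 3 * δ < s) : gp S α a b ≤ 2 * δ := by
  have hd := hδ.1
  have e1 := gp_add hS 1 a α
  have e2 := gp_add hS 1 b α
  have a1 : s - δ ≤ gp S 1 a α := gp_large hS hδ ha (by rw [gp_comm hS, h2])
  have b1 : gp S 1 b α ≤ m + δ := by
    by_contra hc
    push Not at hc
    have : m + δ < s := by linarith
    have h3 := hyp_gp hS hδ 1 b α x
    rw [h2] at h3
    have : m + δ < min (gp S 1 b α) s := lt_min hc this
    linarith
  have h3 := hyp_gp hS hδ α a b 1
  by_contra hc
  push Not at hc
  have : 2 * δ < min (gp S α a b) (gp S α b 1) := lt_min hc (by linarith)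
  linarith

/-- points roughly on the way from `1` to `x`, not too far -/
def Vset (S : Set Γ) (x : Γ) (s : ℝ) : Set Γ := {a | (wl S a : ℝ) ≤ s ∧ (wl S a : ℝ) / 2 ≤ gp S 1 a x}

lemma avoid_step (hS : IsGenSet S) (hδ : IsHyperbolic S δ) (hδ1 : 1 ≤ δ) (hμ : IsRWMeasure S μ)
    {C ρ : ℝ} {τ : ℕ} (hρ0 : 0 < ρ) (hρ1 : ρ < 1) (hC : 0 < C)
    (ht : ∀ (N : ℕ) (x y : Γ), ∑' n, pE μ (n + N) x y ≤ ENNReal.ofReal (C * ρ ^ N))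
    (hl : ∀ (x y : Γ) (N : ℕ), dd S x y ≤ N → ENNReal.ofReal (ρ ^ (τ * N)) ≤ GE μ x y)
    {R : ℝ} (k0 m t0 : ℕ) (hk0 : 2 ^ k0 = 4 * m) (hm : 1 ≤ m) (hmt : 16 * τ * t0 ≤ m)
    (ht0 : 3 * ((k0 + 3) * δ + 2) + 9 * δ + R + 5 * δ + 1 ≤ t0) (hR : 0 ≤ R)
    (j : ℕ) {x b : Γ} (hb : (wl S b : ℝ) ≤ 8 * t0 * 4 ^ j) (hbx : (wl S b : ℝ) ≤ 2 * t0 ∨ gp S 1 b x ≤ R + δ)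
    {η : ℝ} (hη : 0 ≤ η)
    (ih : ∀ a ∈ Vset S x (2 * t0 * 4 ^ j),
      AE μ {y | (wl S y : ℝ) ≤ 2 * t0} a b ≤ ENNReal.ofReal η * GE μ a b)
    (a : Γ) (ha : a ∈ Vset S x (8 * t0 * 4 ^ j)) :
    AE μ {y | (wl S y : ℝ) ≤ 2 * t0} a b ≤ ENNReal.ofReal (η + C * ρ ^ m * ρ ^ j) * GE μ a b := by
  rcases hbx with hb0 | hbx
  · rw [AE_right (show b ∈ {y | (wl S y : ℝ) ≤ 2 * t0} from hb0)]; exact bot_le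
  have h4 : (1 : ℝ) + j ≤ 4 ^ j := by
    have := one_add_mul_le_pow (a := (3 : ℝ)) (by norm_num) j
    norm_num at this
    have hj := Nat.cast_nonneg (α := ℝ) j
    linarith
  have hj := Nat.cast_nonneg (α := ℝ) j
  have hk := Nat.cast_nonneg (α := ℝ) k0
  have ht0' : 0 ≤ (t0 : ℝ) := Nat.cast_nonneg _
  have hkδ : 0 ≤ (k0 : ℝ) * δ := by positivity
  have hjδ : 0 ≤ (j : ℝ) * δ := by positivity
  by_cases hsmall : (wl S a : ℝ) ≤ 2 * t0 * 4 ^ j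
  · refine (ih a ⟨hsmall, ha.2⟩).trans ?_
    gcongr
    have : 0 ≤ C * ρ ^ m * ρ ^ j := by positivity
    linarith
  push Not at hsmall
  set t : ℕ := t0 * 4 ^ j with htdef
  have htr : (t : ℝ) = t0 * 4 ^ j := by rw [htdef]; push_cast; ring
  have htge : (1 + (j : ℝ)) * t0 ≤ t := by rw [htr, mul_comm]; gcongr
  have hax : (t : ℝ) ≤ gp S 1 a x := by
    refine le_trans ?_ ha.2
    rw [htr]; linarith
  have hxt : t ≤ wl S x := by
    have := hax.trans (gp_le_right hS 1 a x)
    rw [dd_one_right hS] at this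
    exact_mod_cast this
  obtain ⟨α, hα1, hα2⟩ := geod_pt hS x hxt
  have hα3 : gp S 1 α x = t := by
    rw [gp_eq, dd_one_right hS, dd_one_right hS]
    have : dd S α x = (wl S x : ℝ) - t := by
      show ((wl S (α⁻¹ * x) : ℕ) : ℝ) = _
      rw [hα2, Nat.cast_sub hxt]
    rw [this, hα1]; linarith
  have hα0 : dd S 1 α = t := by rw [dd_one_left, hα1]
  set k : ℕ := k0 + 3 * j
  have hkr : (k : ℝ) = k0 + 3 * j := by push_cast [k]; ring
  set r : ℝ := (k + 3) * δ + 2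
  have hr : r = (k0 + 3 * j + 3) * δ + 2 := by rw [← hkr]
  have hrt : 3 * r ≤ t := by nlinarith
  have hRt : R + δ + 3 * δ < t := by nlinarith
  have hgp := gp_tree hS hδ hα0 hα3 hax hbx hRt
  have hsm := AE_small (U := {y | dd S α y < r}) hS hδ hμ ht (c := α) (r := r) k (fun y hy => hy)
    (x := a) (z := b) (by simp only [r]; linarith)
  have hhit := AE_hit μ {y | (wl S y : ℝ) ≤ 2 * t0} {y | dd S α y < r} b
    (fun a => ENNReal.ofReal η * GE μ a b) (fun a => by
      simp_rw [mul_left_comm _ (ENNReal.ofReal η)]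
      rw [ENNReal.tsum_mul_left]
      gcongr
      exact GE_super μ a b) (fun a' ha' => ih a' ?_) a
  · refine hhit.trans ?_
    rw [ENNReal.ofReal_add hη (by positivity), add_mul, add_comm]
    gcongr
    refine hsm.trans ?_
    have hdab : dd S a b ≤ (16 * t : ℕ) := by
      have h1 := dd_tri hS a 1 b
      rw [dd_one_right hS, dd_one_left] at h1
      have h2 := ha.1
      push_cast
      rw [htr]
      linarith
    calc ENNReal.ofReal (C * ρ ^ 2 ^ k) ≤ ENNReal.ofReal (C * ρ ^ m * ρ ^ j * ρ ^ (τ * (16 * t))) := by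
          apply ENNReal.ofReal_le_ofReal
          rw [mul_assoc, mul_assoc]
          gcongr
          rw [← pow_add, ← pow_add]
          apply pow_le_pow_of_le_one hρ0.le hρ1.le
          have e1 : 2 ^ k = 4 * m * 8 ^ j := by
            simp only [k]; rw [pow_add, hk0, pow_mul]; norm_num
          have e2 : τ * (16 * t) ≤ m * 8 ^ j := by
            rw [htdef]
            calc τ * (16 * (t0 * 4 ^ j)) = 16 * τ * t0 * 4 ^ j := by ring
              _ ≤ m * 8 ^ j := by gcongr; norm_num
          have e3 : j ≤ 8 ^ j := (Nat.lt_pow_self (by norm_num)).le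
          have e4 : 1 ≤ 8 ^ j := Nat.one_le_pow _ _ (by norm_num)
          have e5 : 8 ^ j ≤ m * 8 ^ j := Nat.le_mul_of_pos_left _ hm
          have e6 : m ≤ m * 8 ^ j := Nat.le_mul_of_pos_right _ e4
          rw [e1, show 4 * m * 8 ^ j = 4 * (m * 8 ^ j) by ring]
          omega
      _ = ENNReal.ofReal (C * ρ ^ m * ρ ^ j) * ENNReal.ofReal (ρ ^ (τ * (16 * t))) := by
          rw [← ENNReal.ofReal_mul (by positivity)]
      _ ≤ _ := by gcongr; exact hl _ _ _ hdab
  · have ha'' : dd S α a' < r := ha'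
    have h1 := dd_tri hS 1 α a'
    rw [hα0, dd_one_left] at h1
    have h2 := gp_lip hS 1 α a' x
    rw [hα3] at h2
    refine ⟨?_, ?_⟩
    · rw [show (2 : ℝ) * t0 * 4 ^ j = 2 * t by rw [htr]; ring]; linarith
    · linarith

end avoid

end Part11

section Part12


lemma IsHyperbolic.mono {S : Set Γ} {δ δ' : ℝ} (h : IsHyperbolic S δ) (hd : δ ≤ δ') :
    IsHyperbolic S δ' := ⟨h.1.trans hd, fun x y z => le_trans (by linarith) (h.2 x y z)⟩

lemma GE_diag (μ : Γ → ℝ) (y : Γ) : 1 ≤ GE μ y y := by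
  classical
  unfold GE
  refine le_trans (le_of_eq ?_) (ENNReal.le_tsum 0)
  simp [pE]

namespace MCtx

variable {S : Set Γ} {δ : ℝ} {μ : Γ → ℝ} {B : Boundary Γ S} {Kb : Γ → B.pt → ℝ}
  [mB : MeasurableSpace B.pt] {ν : Measure B.pt}

lemma mono (X : MCtx δ μ B Kb ν) {δ' : ℝ} (h : δ ≤ δ') : MCtx δ' μ B Kb ν :=
  { X with hδ := X.hδ.mono h }

lemma GE_lower (X : MCtx δ μ B Kb ν) {ρ : ℝ} (hρ0 : 0 < ρ) (hρ1 : ρ < 1) :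
    ∃ τ : ℕ, ∀ (x y : Γ) (N : ℕ), dd S x y ≤ N → ENNReal.ofReal (ρ ^ (τ * N)) ≤ GE μ x y := by
  obtain ⟨c, h0, h1, h2⟩ := exists_harnack X.hS X.hμ
  have hc : c ≠ ⊤ := (h1.trans_lt ENNReal.one_lt_top).ne
  obtain ⟨τ, hτ⟩ := exists_pow_lt_of_lt_one (ENNReal.toReal_pos h0.ne' hc) hρ1
  refine ⟨τ, fun x y N h => ?_⟩
  have h3 := h2 (x⁻¹ * y) x y
  rw [mul_inv_cancel_left] at h3
  have hN : wl S (x⁻¹ * y) ≤ N := by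
    have : ((wl S (x⁻¹ * y) : ℕ) : ℝ) ≤ N := h
    exact_mod_cast this
  have hτ' : ENNReal.ofReal (ρ ^ τ) ≤ c := ENNReal.ofReal_le_of_le_toReal hτ.le
  calc ENNReal.ofReal (ρ ^ (τ * N)) = ENNReal.ofReal (ρ ^ τ) ^ N := by
        rw [pow_mul, ENNReal.ofReal_pow (by positivity)]
    _ ≤ c ^ N := by gcongr
    _ ≤ c ^ (wl S (x⁻¹ * y)) := pow_le_pow_right_of_le_one' h1 hN
    _ = c ^ (wl S (x⁻¹ * y)) * 1 := (mul_one _).symm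
    _ ≤ c ^ (wl S (x⁻¹ * y)) * GE μ y y := by gcongr; exact GE_diag μ y
    _ ≤ _ := h3

lemma avoid (X : MCtx δ μ B Kb ν) {ε R : ℝ} (hε : 0 < ε) (hR : 0 ≤ R) :
    ∃ r : ℝ, ∀ x z : Γ, gp S 1 x z ≤ R →
      AE μ {y | (wl S y : ℝ) ≤ r} x z ≤ ENNReal.ofReal ε * GE μ x z := by
  wlog hδ1 : 1 ≤ δ generalizing δ
  · exact this (X.mono (le_max_left δ 1)) (le_max_right δ 1)
  have hS := X.hS
  have hδ := X.hδ
  obtain ⟨C, ρ, hC, hρ0, hρ1, ht⟩ := X.tail_decay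
  obtain ⟨τ, hl⟩ := X.GE_lower hρ0 hρ1
  have hl' : ∀ (x y : Γ) (N : ℕ), dd S x y ≤ N → ENNReal.ofReal (ρ ^ (τ * N)) ≤ GE (refl μ) x y := by
    intro x y N h
    rw [GE_refl]
    exact hl y x N (by rwa [dd_comm hS])
  have ht' : ∀ (N : ℕ) (x y : Γ), ∑' n, pE (refl μ) (n + N) x y ≤ ENNReal.ofReal (C * ρ ^ N) := by
    intro N x y
    simp_rw [pE_refl]
    exact ht N y x
  obtain ⟨A, hA⟩ := exists_nat_ge (29 * δ + 7 + R)
  have h1ρ : 0 < 1 - ρ := by linarith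
  have e1 : ∀ᶠ k : ℕ in atTop, 2 * C * ρ ^ k / (1 - ρ) ≤ ε := by
    have h : Tendsto (fun k : ℕ => 2 * C * ρ ^ k / (1 - ρ)) atTop (𝓝 (2 * C * 0 / (1 - ρ))) :=
      ((tendsto_pow_atTop_nhds_zero_of_lt_one hρ0.le hρ1).const_mul _).div_const _
    rw [mul_zero, zero_div] at h
    exact h.eventually_le_const hε
  have e1' : ∀ᶠ k : ℕ in atTop, 2 * C * ρ ^ (2 ^ k) / (1 - ρ) ≤ ε :=
    (tendsto_pow_atTop_atTop_of_one_lt (r := 2) (by norm_num)).eventually e1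
  have e2 : ∀ᶠ k : ℕ in atTop, 16 * τ * (A * (k + 1)) ≤ 2 ^ k := by
    have h1 : Tendsto (fun k : ℕ => (16 * τ * A : ℝ) * ((k : ℝ) / 2 ^ k + 1 / 2 ^ k)) atTop
        (𝓝 ((16 * τ * A : ℝ) * (0 + 0))) := by
      refine Tendsto.const_mul _ (Tendsto.add ?_ ?_)
      · have := tendsto_pow_const_div_const_pow_of_one_lt 1 (r := (2 : ℝ)) (by norm_num)
        simpa using this
      · have := tendsto_pow_atTop_nhds_zero_of_lt_one (r := (1 / 2 : ℝ)) (by norm_num) (by norm_num)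
        simpa using this
    rw [add_zero, mul_zero] at h1
    filter_upwards [h1.eventually_le_const (zero_lt_one)] with k hk
    have h2 : (0 : ℝ) < 2 ^ k := by positivity
    rw [← add_div, ← mul_div_assoc, div_le_one h2] at hk
    have : ((16 * τ * (A * (k + 1)) : ℕ) : ℝ) ≤ ((2 ^ k : ℕ) : ℝ) := by
      push_cast; linarith
    exact_mod_cast this
  obtain ⟨k, hk1, hk2⟩ := (e1'.and e2).exists
  set m : ℕ := 2 ^ k with hm
  set t0 : ℕ := A * (k + 1) with ht0
  have hm1 : 1 ≤ m := Nat.one_le_two_pow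
  have hk0 : 2 ^ (k + 2) = 4 * m := by rw [hm, pow_add]; ring
  have hkk := Nat.cast_nonneg (α := ℝ) k
  have ht0' : 3 * (((k + 2 : ℕ) + 3) * δ + 2) + 9 * δ + R + 5 * δ + 1 ≤ (t0 : ℝ) := by
    rw [ht0]; push_cast
    nlinarith
  have htpos : R + δ < (t0 : ℝ) := by
    push_cast at ht0'
    nlinarith
  have ht00 : (0 : ℝ) ≤ t0 := Nat.cast_nonneg _
  refine ⟨2 * t0, fun x z hxz => ?_⟩
  have claim : ∀ j : ℕ, ∀ a ∈ Vset S x (2 * t0 * 4 ^ j), ∀ b ∈ Vset S z (2 * t0 * 4 ^ j),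
      AE μ {y | (wl S y : ℝ) ≤ 2 * t0} a b ≤
        ENNReal.ofReal (∑ i ∈ Finset.range j, 2 * (C * ρ ^ m * ρ ^ i)) * GE μ a b := by
    intro j
    induction j with
    | zero =>
      intro a ha b hb
      have ha' : a ∈ {y | (wl S y : ℝ) ≤ 2 * t0} := by simpa using ha.1
      rw [AE_left ha']; exact bot_le
    | succ j ih =>
      have h8 : (2 : ℝ) * t0 * 4 ^ (j + 1) = 8 * t0 * 4 ^ j := by ring
      rw [h8]
      have hη : 0 ≤ ∑ i ∈ Finset.range j, 2 * (C * ρ ^ m * ρ ^ i) :=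
        Finset.sum_nonneg fun i _ => by positivity
      have h4 : (0 : ℝ) < 4 ^ j := by positivity
      have left : ∀ a ∈ Vset S x (8 * t0 * 4 ^ j), ∀ b ∈ Vset S z (2 * t0 * 4 ^ j),
          AE μ {y | (wl S y : ℝ) ≤ 2 * t0} a b ≤
          ENNReal.ofReal ((∑ i ∈ Finset.range j, 2 * (C * ρ ^ m * ρ ^ i)) + C * ρ ^ m * ρ ^ j) *
            GE μ a b := by
        intro a ha b hb
        refine avoid_step hS hδ hδ1 X.hμ hρ0 hρ1 hC ht hl (k + 2) m t0 hk0 hm1 hk2 ht0' hR j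
          (x := x) (b := b) ?_ ?_ hη (fun a ha => ih a ha b hb) a ha
        · have := hb.1
          have : 0 ≤ (t0 : ℝ) * 4 ^ j := by positivity
          linarith
        · by_cases hs : (wl S b : ℝ) ≤ 2 * t0
          · exact Or.inl hs
          · right
            push Not at hs
            refine gp_small hS hδ (x := z) (by rwa [gp_comm hS]) ?_
            rw [gp_comm hS]
            linarith [hb.2]
      intro a ha b hb
      have key := avoid_step hS hδ hδ1 (refl_rw hS X.hμ) hρ0 hρ1 hC ht' hl' (k + 2) m t0 hk0 hm1 hk2
          ht0' hR j (x := z) (b := a) ha.1 ?_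
          (η := (∑ i ∈ Finset.range j, 2 * (C * ρ ^ m * ρ ^ i)) + C * ρ ^ m * ρ ^ j) (by positivity)
          (fun b hb => ?_) b hb
      · rw [AE_refl, GE_refl] at key
        refine key.trans (le_of_eq ?_)
        rw [Finset.sum_range_succ]; congr 2; ring
      · by_cases hs : (wl S a : ℝ) ≤ 2 * t0
        · exact Or.inl hs
        · right
          push Not at hs
          refine gp_small hS hδ (x := x) hxz ?_
          rw [gp_comm hS]
          linarith [ha.2]
      · rw [AE_refl, GE_refl]
        exact left a ha b hb
  by_cases ht0z : t0 = 0
  · rw [ht0z] at htpos; norm_num at htpos; linarith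
  have ht01 : (1 : ℝ) ≤ t0 := by exact_mod_cast Nat.one_le_iff_ne_zero.mpr ht0z
  obtain ⟨j, hj⟩ := pow_unbounded_of_one_lt ((max (wl S x) (wl S z) : ℕ) : ℝ) (by norm_num : (1 : ℝ) < 4)
  have hmem : ∀ y : Γ, (wl S y : ℝ) ≤ 4 ^ j → y ∈ Vset S y (2 * t0 * 4 ^ j) := by
    intro y hy
    refine ⟨?_, ?_⟩
    · have : (0 : ℝ) < 4 ^ j := by positivity
      nlinarith
    · rw [gp_eq, dd_self, dd_one_right X.hS]
      have := Nat.cast_nonneg (α := ℝ) (wl S y)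
      linarith
  have hx : (wl S x : ℝ) ≤ 4 ^ j := le_trans (by exact_mod_cast le_max_left _ _) hj.le
  have hz : (wl S z : ℝ) ≤ 4 ^ j := le_trans (by exact_mod_cast le_max_right _ _) hj.le
  refine (claim j x (hmem x hx) z (hmem z hz)).trans ?_
  gcongr
  rw [← Finset.mul_sum, ← Finset.mul_sum]
  refine le_trans ?_ hk1
  have hg : ∑ i ∈ Finset.range j, ρ ^ i ≤ 1 / (1 - ρ) := by
    rw [geom_sum_eq hρ1.ne, ← neg_div_neg_eq]
    rw [neg_sub, neg_sub]
    gcongr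
    have := pow_pos hρ0 j
    linarith
  calc 2 * (C * ρ ^ m * ∑ i ∈ Finset.range j, ρ ^ i) ≤ 2 * (C * ρ ^ m * (1 / (1 - ρ))) := by gcongr
    _ = _ := by ring

end MCtx

end Part12

section Part13


namespace MCtx

variable {S : Set Γ} {δ : ℝ} {μ : Γ → ℝ} {B : Boundary Γ S} {Kb : Γ → B.pt → ℝ}
  [mB : MeasurableSpace B.pt] {ν : Measure B.pt}

lemma lemH0 (X : MCtx δ μ B Kb ν) {ε R : ℝ} (hε : 0 < ε) (hR : 0 ≤ R) :
    ∃ M : ℝ, ∀ y z z' : Γ, gp S 1 y z ≤ R → M ≤ gp S 1 z z' →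
      martinK μ y z ≤ (1 + ε) * martinK μ y z' := by
  set e := ε / (2 + ε) with he
  have he0 : 0 < e := by positivity
  have he2 : e * (2 + ε) = ε := by rw [he]; field_simp
  have he1 : e < 1 := by rw [he, div_lt_one (by positivity)]; linarith
  obtain ⟨r, hr⟩ := X.avoid he0 hR
  have hfin : {b : Γ | (wl S b : ℝ) ≤ r}.Finite := by
    refine (ball_finite X.hS ⌊r⌋₊).subset fun b hb => ?_
    exact Nat.le_floor hb
  choose M0 hM0 using fun b => X.unif b he0
  obtain ⟨M, hM⟩ : ∃ M : ℝ, ∀ b ∈ {b : Γ | (wl S b : ℝ) ≤ r}, M0 b ≤ M := by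
    obtain ⟨M, hM⟩ := (hfin.image M0).bddAbove
    exact ⟨M, fun b hb => hM ⟨b, hb, rfl⟩⟩
  refine ⟨M, fun y z z' hyz hzz => ?_⟩
  have hG := X.hG
  have hμ := X.hμ
  have p1 := GEr_pos hμ hG 1 z
  have p2 := GEr_pos hμ hG 1 z'
  set q : ℝ := (1 + e) * ((GE μ 1 z).toReal / (GE μ 1 z').toReal) with hq
  have hq0 : 0 < q := by positivity
  have key := AE_hit μ ∅ {b : Γ | (wl S b : ℝ) ≤ r} z (fun a => ENNReal.ofReal q * GE μ a z') ?_ ?_ y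
  · rw [AE_empty] at key
    have h2 : GE μ y z ≤ ENNReal.ofReal e * GE μ y z + ENNReal.ofReal q * GE μ y z' :=
      key.trans (by gcongr; exact hr y z hyz)
    have h3 := ENNReal.toReal_mono (by
      refine ENNReal.add_ne_top.2 ⟨ENNReal.mul_ne_top ENNReal.ofReal_ne_top (hG _ _),
        ENNReal.mul_ne_top ENNReal.ofReal_ne_top (hG _ _)⟩) h2
    rw [ENNReal.toReal_add (ENNReal.mul_ne_top ENNReal.ofReal_ne_top (hG _ _))
      (ENNReal.mul_ne_top ENNReal.ofReal_ne_top (hG _ _)), ENNReal.toReal_mul, ENNReal.toReal_mul,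
      ENNReal.toReal_ofReal he0.le, ENNReal.toReal_ofReal hq0.le] at h3
    rw [martinK_eq hμ hG, martinK_eq hμ hG, div_le_iff₀ p1]
    have h4 : (1 + ε) * (1 - e) = 1 + e := by linarith
    have h5 : (1 - e) * (GE μ y z).toReal ≤ (1 - e) * ((1 + ε) * ((GE μ y z').toReal / (GE μ 1 z').toReal) * (GE μ 1 z).toReal) := by
      have : (1 - e) * ((1 + ε) * ((GE μ y z').toReal / (GE μ 1 z').toReal) * (GE μ 1 z).toReal) =
          q * (GE μ y z').toReal := by
        rw [hq, ← h4]; ring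
      rw [this]; linarith
    exact le_of_mul_le_mul_left h5 (by linarith)
  · intro a
    simp_rw [mul_left_comm _ (ENNReal.ofReal q)]
    rw [ENNReal.tsum_mul_left]
    gcongr
    exact GE_super μ a z'
  · intro b hb
    rw [AE_empty]
    have h1 := hM0 b z z' ((hM b hb).trans hzz)
    rw [martinK_eq hμ hG, martinK_eq hμ hG, div_le_iff₀ p1] at h1
    rw [← ENNReal.ofReal_toReal (hG b z), ← ENNReal.ofReal_toReal (hG b z'),
      ← ENNReal.ofReal_mul hq0.le]
    apply ENNReal.ofReal_le_ofReal
    refine h1.trans (le_of_eq ?_)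
    rw [hq]; ring

lemma lemH1 (X : MCtx δ μ B Kb ν) {ε R : ℝ} (hε : 0 < ε) (hR : 0 ≤ R) :
    ∃ M : ℝ, ∀ y z z' : Γ, gp S 1 y z ≤ R → M ≤ gp S 1 z z' →
      martinK μ y z ≤ (1 + ε) * martinK μ y z' ∧ martinK μ y z' ≤ (1 + ε) * martinK μ y z := by
  have hδ0 := X.hδ.1
  obtain ⟨M, hM⟩ := X.lemH0 hε (R := R + δ) (by linarith)
  refine ⟨max M (R + δ + 1), fun y z z' h h' => ⟨hM y z z' (by linarith) ((le_max_left _ _).trans h'), ?_⟩⟩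
  refine hM y z' z ?_ ?_
  · rw [gp_comm X.hS]
    exact gp_small X.hS X.hδ (x := z) (by rwa [gp_comm X.hS]) (lt_of_lt_of_le (by linarith) ((le_max_right M _).trans h'))
  · rw [gp_comm X.hS]; exact (le_max_left _ _).trans (h')

lemma lemH (X : MCtx δ μ B Kb ν) {ε R : ℝ} (hε : 0 < ε) (hR : 0 ≤ R) :
    ∃ M : ℝ, ∀ (y : Γ) (ξ ξ' : B.pt), ¬ Lb B y ξ R → near B ξ ξ' M →
      Kb y ξ ≤ (1 + ε) * Kb y ξ' ∧ Kb y ξ' ≤ (1 + ε) * Kb y ξ := by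
  have hδ0 := X.hδ.1
  obtain ⟨M, hM⟩ := X.lemH1 hε (R := R + δ) (by linarith)
  refine ⟨M, fun y ξ ξ' h h' => ?_⟩
  obtain ⟨N, hN⟩ := (near_iff B).1 h'
  have h1 := seq_of_not_Lb X.hS X.hδ h (rep_conv B ξ) (rep_cls B ξ)
  constructor
  · refine le_of_tendsto_of_tendsto (X.lim y ξ) ((X.lim y ξ').const_mul _) ?_
    filter_upwards [eventually_ge_atTop N, h1] with n hn hn1
    exact (hM _ _ _ hn1 (hN n n hn hn)).1
  · refine le_of_tendsto_of_tendsto (X.lim y ξ') ((X.lim y ξ).const_mul _) ?_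
    filter_upwards [eventually_ge_atTop N, h1] with n hn hn1
    exact (hM _ _ _ hn1 (hN n n hn hn)).2

end MCtx

end Part13

section Part14


namespace MCtx

variable {S : Set Γ} {δ : ℝ} {μ : Γ → ℝ} {B : Boundary Γ S} {Kb : Γ → B.pt → ℝ}
  [mB : MeasurableSpace B.pt] {ν : Measure B.pt}

lemma null_smul (X : MCtx δ μ B Kb ν) (g : Γ) {A : Set B.pt} (hA : MeasurableSet A) (h : ν A = 0) :
    ν (B.smul g ⁻¹' A) = 0 := by
  rw [X.hRN g A hA, Measure.restrict_eq_zero.2 h, lintegral_zero_measure]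

lemma null_smul' (X : MCtx δ μ B Kb ν) (g : Γ) {A : Set B.pt} (hA : MeasurableSet A)
    (h : ν (B.smul g ⁻¹' A) = 0) : ν A = 0 := by
  have h1 := X.null_smul g⁻¹ (X.meas_smul g hA) h
  have e : B.smul g⁻¹ ⁻¹' (B.smul g ⁻¹' A) = A := by
    ext ω
    simp only [Set.mem_preimage]
    rw [smul_inv_smul X.hS]
  rwa [e] at h1

lemma pos_smul (X : MCtx δ μ B Kb ν) (g : Γ) {A : Set B.pt} (hA : MeasurableSet A) (h : 0 < ν A) :
    0 < ν (B.smul g ⁻¹' A) := by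
  rw [pos_iff_ne_zero] at h ⊢
  exact fun h0 => h (X.null_smul' g hA h0)

lemma no_atom (X : MCtx δ μ B Kb ν) (η : B.pt) : ν {η} = 0 := by
  have := X.hν
  by_contra h0
  have hpos : 0 < (ν {η}).toReal := ENNReal.toReal_pos h0 (measure_ne_top _ _)
  set L : ℝ := ((ν {η}).toReal)⁻¹ with hL
  have hLpos : 0 < L := by positivity
  have hK : ∀ g, Kb g η ≤ L := by
    intro g
    have h1 := X.hRN g {η} (X.meas_single η)
    have h2 : ∫⁻ ω in {η}, ENNReal.ofReal (Kb g ω) ∂ν = ENNReal.ofReal (Kb g η) * ν {η} := by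
      rw [setLIntegral_congr_fun (X.meas_single η) (g := fun _ => ENNReal.ofReal (Kb g η))]
      · rw [setLIntegral_const]
      · intro ω hω
        rw [Set.mem_singleton_iff.1 hω]
    rw [h2] at h1
    have h3 : ENNReal.ofReal (Kb g η) * ν {η} ≤ 1 := h1 ▸ prob_le_one
    have h4 := ENNReal.toReal_mono ENNReal.one_ne_top h3
    rw [ENNReal.toReal_mul, ENNReal.toReal_ofReal (X.pos g η).le, ENNReal.toReal_one] at h4
    rw [hL, ← one_div, le_div_iff₀ hpos]
    exact h4
  obtain ⟨C, ρ, hC, h0, h1, h⟩ := X.qq_decay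
  have key : ∀ n, 1 ≤ √L * (C * ρ ^ n) := by
    intro n
    have e := X.harmonic_n n 1 η
    rw [X.K_one, ENNReal.ofReal_one] at e
    have h5 : (1 : ℝ≥0∞) ≤ ENNReal.ofReal (√L) * qq μ Kb n η := by
      rw [← e]
      unfold qq
      rw [← ENNReal.tsum_mul_left]
      refine ENNReal.tsum_le_tsum fun x => ?_
      rw [mul_left_comm, ← ENNReal.ofReal_mul (Real.sqrt_nonneg _)]
      gcongr
      have hx := X.pos x η
      calc Kb x η = √(Kb x η) * √(Kb x η) := (Real.mul_self_sqrt hx.le).symm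
        _ ≤ √L * √(Kb x η) := by gcongr; exact hK x
    have h6 : (1 : ℝ≥0∞) ≤ ENNReal.ofReal (√L * (C * ρ ^ n)) := by
      rw [ENNReal.ofReal_mul (Real.sqrt_nonneg _)]
      exact h5.trans (by gcongr; exact h n η)
    rwa [ENNReal.one_le_ofReal] at h6
  have hlim : Tendsto (fun n : ℕ => √L * (C * ρ ^ n)) atTop (𝓝 (√L * (C * 0))) :=
    ((tendsto_pow_atTop_nhds_zero_of_lt_one h0.le h1).const_mul _).const_mul _
  rw [mul_zero, mul_zero] at hlim
  obtain ⟨n, hn⟩ := (hlim.eventually_lt_const zero_lt_one).exists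
  exact absurd (key n) (not_le.2 hn)

lemma small_nbhd (X : MCtx δ μ B Kb ν) (η : B.pt) {ε : ℝ≥0∞} (hε : 0 < ε) :
    ∃ W : Set B.pt, MeasurableSet W ∧ ν W < ε ∧ ∃ r, ∀ q, near B q η r → q ∈ W := by
  have := X.hν
  obtain ⟨W, h1, h2, h3, h4, h5⟩ := X.exists_nbhds η
  have h6 := tendsto_measure_iInter_atTop (μ := ν) (fun m => (h1 m).nullMeasurableSet) h2
    ⟨0, measure_ne_top _ _⟩
  rw [h5, X.no_atom] at h6
  obtain ⟨m, hm⟩ := (h6.eventually_lt_const hε).exists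
  exact ⟨W m, h1 m, hm, h3 m⟩

lemma small_hull (X : MCtx δ μ B Kb ν) {ε : ℝ≥0∞} (hε : 0 < ε) :
    ∃ R : ℝ, 0 ≤ R ∧ ∀ y : Γ, ν (hull B y R) ≤ ε := by
  by_contra hcon
  push Not at hcon
  choose y hy using fun n : ℕ => hcon n (Nat.cast_nonneg n)
  have hne : ∀ n, (hull B (y n) n).Nonempty := by
    intro n
    by_contra h
    rw [Set.not_nonempty_iff_eq_empty] at h
    have := hy n
    rw [h, measure_empty] at this
    exact absurd this (not_lt.2 bot_le)
  choose ω hω using hne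
  obtain ⟨φ, ξ, hφ, hξ⟩ := exists_subseq_bdry X.hS X.hδ ω
  obtain ⟨W, hW1, hW2, r, hr⟩ := X.small_nbhd ξ hε
  have hφ' : Tendsto (fun n => ((φ n : ℕ) : ℝ)) atTop atTop :=
    tendsto_natCast_atTop_atTop.comp hφ.tendsto_atTop
  obtain ⟨n, h1, h2⟩ := ((hξ (r + δ)).and (hφ'.eventually_ge_atTop (r + 3 * δ))).exists
  have hδ0 := X.hδ.1
  have hsub : hull B (y (φ n)) (φ n) ⊆ W := by
    intro q hq
    apply hr
    have a1 := Lb_of_mem_hull X.hS X.hδ hq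
    have a2 := Lb_of_mem_hull X.hS X.hδ (hω (φ n))
    have a3 := a1.near_of X.hS X.hδ a2
    exact ((a3.mono (r' := r + δ) (by linarith)).trans' X.hS X.hδ h1).mono (by linarith)
  exact absurd (measure_mono hsub) (not_le.2 (hW2.trans (hy _)))

lemma concentration (X : MCtx δ μ B Kb ν) {ε : ℝ≥0∞} (hε : 0 < ε) (m : ℝ) :
    ∃ N : ℕ, ∀ x : Γ, N ≤ wl S x → ν (B.smul x ⁻¹' (hull B x m))ᶜ ≤ ε := by
  obtain ⟨R, hR, h⟩ := X.small_hull hε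
  obtain ⟨N, hN⟩ := exists_nat_ge (m + R + 2 * δ)
  refine ⟨N, fun x hx => le_trans (measure_mono ?_) (h x⁻¹)⟩
  intro ξ hξ
  by_contra hcon
  apply hξ
  have h1 : ¬ Lb B x⁻¹ ξ R := fun hL => hcon hL.mem_hull
  have h2 := Lb_smul_of_far X.hS X.hδ h1
  have h3 : (N : ℝ) ≤ wl S x := by exact_mod_cast hx
  exact (h2.mono (r' := m) (by linarith)).mem_hull

lemma full_support (X : MCtx δ μ B Kb ν) (ξ : B.pt) {r : ℝ} {W : Set B.pt} (hW : MeasurableSet W)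
    (h : ∀ q, near B q ξ r → q ∈ W) : 0 < ν W := by
  have := X.hν
  have hδ0 := X.hδ.1
  set Z : Set B.pt := {ξ | ∀ (r : ℝ) (W : Set B.pt), MeasurableSet W →
    (∀ q, near B q ξ r → q ∈ W) → 0 < ν W} with hZ
  have hne : Z.Nonempty := by
    by_contra hem
    rw [Set.not_nonempty_iff_eq_empty] at hem
    have := Γ_countable X.hS
    have hnull : ν (⋃ (x : Γ) (m : ℕ) (h : ν (hull B x m) = 0), hull B x m) = 0 := by
      refine measure_iUnion_null fun x => measure_iUnion_null fun m => ?_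
      refine measure_iUnion_null fun h => h
    have huniv : (⋃ (x : Γ) (m : ℕ) (h : ν (hull B x m) = 0), hull B x m) = Set.univ := by
      rw [Set.eq_univ_iff_forall]
      intro η
      have hη : η ∉ Z := by rw [hem]; exact Set.notMem_empty _
      simp only [hZ, Set.mem_ofPred, not_forall, not_lt, nonpos_iff_eq_zero] at hη
      obtain ⟨r, W, hW, hsub, h0⟩ := hη
      obtain ⟨m, hm⟩ := exists_nat_ge (r + 2 * δ)
      obtain ⟨x, hx⟩ := exists_Lb X.hS B η m
      simp only [Set.mem_iUnion]
      refine ⟨x, m, measure_mono_null (fun q hq => hsub q ?_) h0, hx.mem_hull⟩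
      have a1 := Lb_of_mem_hull X.hS X.hδ hq
      exact (a1.near_of X.hS X.hδ (hx.mono (by linarith))).mono (by linarith)
    rw [huniv, measure_univ] at hnull
    exact one_ne_zero hnull
  obtain ⟨η, hη⟩ := hne
  have hξ : ξ ∈ Z := by
    refine minimal X.hS X.hδ X.hne B Z ?_ ?_ hη ξ
    · intro g ζ hζ r W hW hsub
      have := hζ (r + wl S g + 2 * δ) (B.smul g ⁻¹' W) (X.meas_smul g hW) fun q hq => ?_
      · rw [pos_iff_ne_zero] at this ⊢
        exact fun h0 => this (X.null_smul g hW h0)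
      · exact hsub _ ((hq.smul X.hS X.hδ g).mono (by linarith))
    · intro ζ hζ r W hW hsub
      obtain ⟨η, hη, hn⟩ := hζ (r + δ)
      refine hη (r + δ) W hW fun q hq => hsub q ?_
      exact (hq.trans' X.hS X.hδ hn).mono (by linarith)
  exact hξ r W hW h

end MCtx

end Part14

section Part15


/-- averaged oscillation of the translates of `ν` on `A` -/
noncomputable def Vn {S : Set Γ} (μ : Γ → ℝ) (B : Boundary Γ S) [MeasurableSpace B.pt]
    (ν : Measure B.pt) (n : ℕ) (A : Set B.pt) : ℝ≥0∞ :=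
  ∑' x, pE μ n 1 x * (ν (B.smul x ⁻¹' A) * ν (B.smul x ⁻¹' Aᶜ))

namespace MCtx

variable {S : Set Γ} {δ : ℝ} {μ : Γ → ℝ} {B : Boundary Γ S} {Kb : Γ → B.pt → ℝ}
  [mB : MeasurableSpace B.pt] {ν : Measure B.pt}

lemma stat_n (X : MCtx δ μ B Kb ν) (n : ℕ) {A : Set B.pt} (hA : MeasurableSet A) :
    ∑' x, pE μ n 1 x * ν (B.smul x ⁻¹' A) = ν A := by
  have := Γ_countable X.hS
  have h1 : ∀ x, pE μ n 1 x * ν (B.smul x ⁻¹' A) =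
      ∫⁻ ω in A, pE μ n 1 x * ENNReal.ofReal (Kb x ω) ∂ν := by
    intro x
    rw [X.hRN x A hA, lintegral_const_mul _ (X.meas_K x).ennreal_ofReal]
  simp_rw [h1]
  rw [← lintegral_tsum fun x => ((X.meas_K x).ennreal_ofReal.const_mul _).aemeasurable]
  simp_rw [X.harmonic_n n 1, X.K_one]
  simp

lemma ball_vanish (X : MCtx δ μ B Kb ν) (N : ℕ) :
    Tendsto (fun n => ∑' x, pE μ n 1 x * Set.indicator {x | wl S x < N} (fun _ => (1 : ℝ≥0∞)) x)
      atTop (𝓝 0) := by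
  obtain ⟨C, ρ, hC, h0, h1, h⟩ := X.pE_decay
  have hfin : {x : Γ | wl S x < N}.Finite := (ball_finite X.hS N).subset fun x (hx : wl S x < N) => show wl S x ≤ N from hx.le
  have hb : ∀ n, ∑' x, pE μ n 1 x * Set.indicator {x | wl S x < N} (fun _ => (1 : ℝ≥0∞)) x ≤
      ENNReal.ofReal (hfin.toFinset.card * (C * ρ ^ n)) := by
    intro n
    rw [tsum_eq_sum (s := hfin.toFinset)]
    · calc _ ≤ ∑ x ∈ hfin.toFinset, ENNReal.ofReal (C * ρ ^ n) := by
            refine Finset.sum_le_sum fun x _ => ?_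
            refine le_trans (mul_le_of_le_one_right bot_le ?_) (h n 1 x)
            exact Set.indicator_le (s := {x | wl S x < N}) (f := fun _ => (1 : ℝ≥0∞)) (g := fun _ => 1) (fun _ _ => le_rfl) x
        _ = _ := by
            rw [Finset.sum_const, nsmul_eq_mul, ENNReal.ofReal_mul (Nat.cast_nonneg _),
              ENNReal.ofReal_natCast]
    · intro x hx
      rw [Set.Finite.mem_toFinset] at hx
      rw [Set.indicator_of_notMem hx, mul_zero]
  refine tendsto_of_tendsto_of_tendsto_of_le_of_le tendsto_const_nhds ?_ (fun n => bot_le) hb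
  have hlim : Tendsto (fun n : ℕ => (hfin.toFinset.card : ℝ) * (C * ρ ^ n)) atTop
      (𝓝 ((hfin.toFinset.card : ℝ) * (C * 0))) :=
    ((tendsto_pow_atTop_nhds_zero_of_lt_one h0.le h1).const_mul _).const_mul _
  have := ENNReal.tendsto_ofReal hlim
  simpa using this

lemma prob_smul (X : MCtx δ μ B Kb ν) (x : Γ) (A : Set B.pt) : ν (B.smul x ⁻¹' A) ≤ 1 := by
  have := X.hν
  exact prob_le_one

/-- pointwise domination criterion -/
lemma Vn_tendsto (X : MCtx δ μ B Kb ν) {A : Set B.pt}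
    (h : ∀ ε : ℝ≥0∞, 0 < ε → ∃ (N : ℕ) (T : Set B.pt) (W : ℕ → ℝ≥0∞), MeasurableSet T ∧ ν T ≤ ε ∧
      Tendsto W atTop (𝓝 0) ∧ ∀ n, Vn μ B ν n A ≤ W n + ε +
        ∑' x, pE μ n 1 x * ν (B.smul x ⁻¹' T)) :
    Tendsto (fun n => Vn μ B ν n A) atTop (𝓝 0) := by
  rw [ENNReal.tendsto_nhds_zero]
  intro ε hε
  have hε3 : 0 < ε / 3 := ENNReal.div_pos hε.ne' (by norm_num)
  obtain ⟨N, T, W, hT, hT', hW, hle⟩ := h (ε / 3) hε3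
  rw [ENNReal.tendsto_nhds_zero] at hW
  filter_upwards [hW (ε / 3) hε3] with n hn
  refine (hle n).trans ?_
  rw [X.stat_n n hT]
  calc W n + ε / 3 + ν T ≤ ε / 3 + ε / 3 + ε / 3 := by gcongr
    _ = ε := ENNReal.add_thirds ε

lemma Vn_closed (X : MCtx δ μ B Kb ν) {C : Set B.pt} (hC : IsClosed[btop B] C) :
    Tendsto (fun n => Vn μ B ν n C) atTop (𝓝 0) := by
  have := X.hν
  have hcount := Γ_countable X.hS
  have hδ0 := X.hδ.1
  set U : ℕ → Set B.pt := fun m => ⋃ (x : Γ) (_ : (hull B x m ∩ C).Nonempty), hull B x m with hU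
  have hmono : ∀ (x : Γ) {r r' : ℝ}, r ≤ r' → hull B x r' ⊆ hull B x r := by
    intro x r r' hr p hp t
    obtain ⟨q, h1, h2⟩ := hp t
    exact ⟨q, h1, h2.mono hr⟩
  have hUm : ∀ m, MeasurableSet (U m) := fun m =>
    MeasurableSet.iUnion fun x => MeasurableSet.iUnion fun _ => X.meas_hull x m
  have hUa : Antitone U := by
    intro m m' hm ω hω
    simp only [hU, Set.mem_iUnion] at hω ⊢
    obtain ⟨x, ⟨q, hq, hqC⟩, hx⟩ := hω
    have hr : (m : ℝ) ≤ m' := by exact_mod_cast hm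
    exact ⟨x, ⟨q, hmono x hr hq, hqC⟩, hmono x hr hx⟩
  have hUC : (⋂ m, U m) ⊆ C := by
    intro ω hω
    by_contra hn
    rw [← @isOpen_compl_iff, isOpen_iff_near X.hS X.hδ] at hC
    obtain ⟨r, hr⟩ := hC ω hn
    obtain ⟨m, hm⟩ := exists_nat_ge (r + 2 * δ)
    have h1 := Set.mem_iInter.1 hω m
    simp only [hU, Set.mem_iUnion] at h1
    obtain ⟨x, ⟨q, hq, hqC⟩, hx⟩ := h1
    refine hr q ?_ hqC
    exact ((Lb_of_mem_hull X.hS X.hδ hq).near_of X.hS X.hδ (Lb_of_mem_hull X.hS X.hδ hx)).mono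
      (by linarith)
  have hCm := X.meas_closed hC
  have hlim : Tendsto (fun m => ν (U m \ C)) atTop (𝓝 0) := by
    have h6 := tendsto_measure_iInter_atTop (μ := ν) (s := fun m => U m \ C)
      (fun m => ((hUm m).diff hCm).nullMeasurableSet)
      (fun m m' h => Set.sdiff_subset_sdiff_left (hUa h)) ⟨0, measure_ne_top _ _⟩
    have e : ⋂ m, U m \ C = ∅ := by
      rw [Set.eq_empty_iff_forall_notMem]
      intro ω hω
      rw [Set.mem_iInter] at hω
      exact (hω 0).2 (hUC (Set.mem_iInter.2 fun m => (hω m).1))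
    rwa [e, measure_empty] at h6
  apply X.Vn_tendsto
  intro ε hε
  obtain ⟨m, hm⟩ := ((ENNReal.tendsto_nhds_zero.1 hlim) ε hε).exists
  obtain ⟨N, hN⟩ := X.concentration hε m
  refine ⟨N, U m \ C, _, (hUm m).diff hCm, hm, X.ball_vanish N, fun n => ?_⟩
  have e1 : ε = ∑' x, pE μ n 1 x * ε := by
    rw [ENNReal.tsum_mul_right, pE_total X.hμ, one_mul]
  conv_rhs => rw [e1]
  rw [← ENNReal.tsum_add, ← ENNReal.tsum_add]
  unfold Vn
  refine ENNReal.tsum_le_tsum fun x => ?_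
  rw [← mul_add, ← mul_add]
  gcongr
  by_cases hx : wl S x < N
  · rw [Set.indicator_of_mem (show x ∈ {x | wl S x < N} from hx)]
    calc ν (B.smul x ⁻¹' C) * ν (B.smul x ⁻¹' Cᶜ) ≤ 1 * 1 :=
          mul_le_mul' (X.prob_smul x _) (X.prob_smul x _)
      _ = 1 := one_mul 1
      _ ≤ _ := by rw [add_assoc]; exact le_self_add
  · have hx' := hN x (not_lt.1 hx)
    by_cases hne : (hull B x m ∩ C).Nonempty
    · calc ν (B.smul x ⁻¹' C) * ν (B.smul x ⁻¹' Cᶜ) ≤ 1 * ν (B.smul x ⁻¹' Cᶜ) := by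
            gcongr; exact X.prob_smul x _
        _ ≤ ν ((B.smul x ⁻¹' hull B x m)ᶜ ∪ B.smul x ⁻¹' (U m \ C)) := by
            rw [one_mul]
            apply measure_mono
            intro ω hω
            by_cases hh : B.smul x ω ∈ hull B x m
            · right
              refine ⟨?_, hω⟩
              simp only [hU, Set.mem_iUnion]
              exact ⟨x, hne, hh⟩
            · left; exact hh
        _ ≤ ε + ν (B.smul x ⁻¹' (U m \ C)) := (measure_union_le _ _).trans (by gcongr)
        _ ≤ _ := by gcongr; exact le_add_self
    · calc ν (B.smul x ⁻¹' C) * ν (B.smul x ⁻¹' Cᶜ) ≤ ν (B.smul x ⁻¹' C) * 1 := by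
            gcongr; exact X.prob_smul x _
        _ ≤ ν ((B.smul x ⁻¹' hull B x m)ᶜ) := by
            rw [mul_one]
            apply measure_mono
            intro ω hω hh
            exact hne ⟨_, hh, hω⟩
        _ ≤ ε := hx'
        _ ≤ _ := by rw [add_right_comm]; exact le_add_self

lemma Vn_all (X : MCtx δ μ B Kb ν) {A : Set B.pt} (hA : MeasurableSet A) :
    Tendsto (fun n => Vn μ B ν n A) atTop (𝓝 0) := by
  have := X.hν
  let _ := btop B
  have hgen : mB = MeasurableSpace.generateFrom {s : Set B.pt | IsClosed s} := by
    rw [X.hmB, borel_eq_generateFrom_isClosed]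
  refine MeasurableSpace.induction_on_inter (C := fun A _ => Tendsto (fun n => Vn μ B ν n A) atTop (𝓝 0))
    hgen isPiSystem_isClosed ?_ (fun t ht => X.Vn_closed ht) ?_ ?_ A hA
  · simp [Vn]
  · intro t ht h
    refine h.congr fun n => ?_
    unfold Vn
    simp_rw [compl_compl, mul_comm (ν (B.smul _ ⁻¹' t))]
  · intro f hd hf h
    apply X.Vn_tendsto
    intro ε hε
    have hT : Tendsto (fun k => ν (⋃ i, f (i + k))) atTop (𝓝 0) := by
      have hs : ∑' i, ν (f i) ≠ ⊤ := by
        rw [← measure_iUnion hd hf]; exact measure_ne_top _ _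
      have h1 := ENNReal.tendsto_sum_nat_add (fun i => ν (f i)) hs
      refine tendsto_of_tendsto_of_tendsto_of_le_of_le tendsto_const_nhds h1 (fun _ => bot_le) fun k => ?_
      exact measure_iUnion_le _
    obtain ⟨k, hk⟩ := ((ENNReal.tendsto_nhds_zero.1 hT) ε hε).exists
    refine ⟨0, ⋃ i, f (i + k), fun n => ∑ i ∈ Finset.range k, Vn μ B ν n (f i),
      MeasurableSet.iUnion fun i => hf _, hk, ?_, fun n => ?_⟩
    · have := tendsto_finsetSum (Finset.range k) (fun i _ => h i)
      simpa using this
    · refine le_trans ?_ (add_le_add_left le_self_add _)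
      unfold Vn
      beta_reduce
      rw [← Summable.tsum_finsetSum (fun i _ => ENNReal.summable), ← ENNReal.tsum_add]
      refine ENNReal.tsum_le_tsum fun x => ?_
      rw [← Finset.mul_sum, ← mul_add]
      gcongr
      have hsub : B.smul x ⁻¹' (⋃ i, f i) ⊆ (⋃ i ∈ Finset.range k, B.smul x ⁻¹' f i) ∪
          B.smul x ⁻¹' (⋃ i, f (i + k)) := by
        intro ω hω
        obtain ⟨i, hi⟩ := Set.mem_iUnion.1 hω
        by_cases hik : i < k
        · left
          simp only [Set.mem_iUnion]
          exact ⟨i, Finset.mem_range.2 hik, hi⟩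
        · right
          refine Set.mem_iUnion.2 ⟨i - k, ?_⟩
          rw [Nat.sub_add_cancel (not_lt.1 hik)]; exact hi
      calc ν (B.smul x ⁻¹' ⋃ i, f i) * ν (B.smul x ⁻¹' (⋃ i, f i)ᶜ)
          ≤ (∑ i ∈ Finset.range k, ν (B.smul x ⁻¹' f i) + ν (B.smul x ⁻¹' (⋃ i, f (i + k)))) *
            ν (B.smul x ⁻¹' (⋃ i, f i)ᶜ) := by
            gcongr
            refine (measure_mono hsub).trans ((measure_union_le _ _).trans ?_)
            gcongr
            exact measure_biUnion_finset_le _ _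
        _ = ∑ i ∈ Finset.range k, ν (B.smul x ⁻¹' f i) * ν (B.smul x ⁻¹' (⋃ i, f i)ᶜ) +
            ν (B.smul x ⁻¹' (⋃ i, f (i + k))) * ν (B.smul x ⁻¹' (⋃ i, f i)ᶜ) := by
            rw [add_mul, Finset.sum_mul]
        _ ≤ ∑ i ∈ Finset.range k, ν (B.smul x ⁻¹' f i) * ν (B.smul x ⁻¹' (f i)ᶜ) +
            ν (B.smul x ⁻¹' (⋃ i, f (i + k))) * 1 := by
            gcongr with i hi
            · exact Set.subset_iUnion f i
            · exact X.prob_smul x _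
        _ = _ := by rw [mul_one]

/-- some far translate of `ν` is almost concentrated on `A` -/
lemma lemX0 (X : MCtx δ μ B Kb ν) {A : Set B.pt} (hA : MeasurableSet A) (hpos : 0 < ν A)
    {ε : ℝ≥0∞} (hε : 0 < ε) (hε' : ε ≠ ⊤) (N : ℕ) :
    ∃ x : Γ, N ≤ wl S x ∧ ν (B.smul x ⁻¹' Aᶜ) ≤ ε := by
  by_contra hcon
  push Not at hcon
  have hle : ∀ n, ν A ≤ (∑' x, pE μ n 1 x * Set.indicator {x | wl S x < N} (fun _ => (1 : ℝ≥0∞)) x)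
      + ε⁻¹ * Vn μ B ν n A := by
    intro n
    rw [← X.stat_n n hA]
    unfold Vn
    rw [← ENNReal.tsum_mul_left, ← ENNReal.tsum_add]
    refine ENNReal.tsum_le_tsum fun x => ?_
    rw [mul_left_comm, ← mul_add]
    gcongr
    by_cases hx : wl S x < N
    · rw [Set.indicator_of_mem (show x ∈ {x | wl S x < N} from hx)]
      exact (X.prob_smul x _).trans le_self_add
    · have h1 := hcon x (not_lt.1 hx)
      refine le_trans ?_ le_add_self
      calc ν (B.smul x ⁻¹' A) = ε⁻¹ * (ν (B.smul x ⁻¹' A) * ε) := by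
            rw [mul_comm _ ε, ← mul_assoc, ENNReal.inv_mul_cancel hε.ne' hε', one_mul]
        _ ≤ _ := by gcongr
  have hlim : Tendsto (fun n => (∑' x, pE μ n 1 x * Set.indicator {x | wl S x < N} (fun _ => (1 : ℝ≥0∞)) x)
      + ε⁻¹ * Vn μ B ν n A) atTop (𝓝 (0 + ε⁻¹ * 0)) :=
    (X.ball_vanish N).add (ENNReal.Tendsto.const_mul (X.Vn_all hA) (Or.inr (ENNReal.inv_ne_top.2 hε.ne')))
  rw [mul_zero, add_zero] at hlim
  have := ge_of_tendsto' hlim hle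
  exact absurd this (not_le.2 hpos)

lemma smul_bound (X : MCtx δ μ B Kb ν) (k : Γ) : ∃ L : ℝ≥0∞, 0 < L ∧ L ≠ ⊤ ∧ ∀ A, MeasurableSet A →
    ν (B.smul k ⁻¹' A) ≤ L * ν A := by
  obtain ⟨c, hc0, hc1, hc⟩ := X.bounds
  refine ⟨ENNReal.ofReal ((c ^ wl S k)⁻¹), ENNReal.ofReal_pos.2 (by positivity), ENNReal.ofReal_ne_top, fun A hA => ?_⟩
  rw [X.hRN k A hA, ← setLIntegral_const]
  exact lintegral_mono fun ω => ENNReal.ofReal_le_ofReal (hc k ω).2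

lemma lemX (X : MCtx δ μ B Kb ν) (ξ : B.pt) : ∃ R : ℝ, 0 ≤ R ∧ ∀ (A : Set B.pt), MeasurableSet A →
    0 < ν A → ∀ (ε : ℝ≥0∞), 0 < ε → ε ≠ ⊤ → ∀ N : ℕ,
    ∃ x : Γ, N ≤ wl S x ∧ ¬ Lb B x⁻¹ ξ R ∧ ν (B.smul x ⁻¹' Aᶜ) ≤ ε := by
  have hδ0 := X.hδ.1
  obtain ⟨k, hk⟩ := no_fixed X.hS X.hδ X.hne B ξ
  obtain ⟨r, hr⟩ := exists_not_near B hk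
  obtain ⟨L, hL0, hL, hLk⟩ := X.smul_bound k
  refine ⟨max 0 (r + wl S k + 2 * δ), le_max_left _ _, fun A hA hpos ε hε hε' N => ?_⟩
  obtain ⟨x, hx1, hx2⟩ := X.lemX0 hA hpos (ε := min ε (ε / L)) (lt_min hε (ENNReal.div_pos hε.ne' hL))
    (ne_top_of_le_ne_top hε' (min_le_left _ _)) (N + wl S k)
  by_cases h : Lb B x⁻¹ ξ (max 0 (r + wl S k + 2 * δ))
  · refine ⟨x * k, ?_, ?_, ?_⟩
    · have h1 := wl_mul X.hS (x * k) k⁻¹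
      rw [mul_inv_cancel_right, wl_inv X.hS] at h1
      omega
    · intro h'
      apply hr
      have h1 := h'.smul X.hS X.hδ k
      rw [mul_inv_rev, mul_inv_cancel_left] at h1
      have hw := Nat.cast_nonneg (α := ℝ) (wl S k)
      have h2 := (h1.mono (r' := r + δ) (by linarith [le_max_right 0 (r + wl S k + 2 * δ)])).near_of X.hS X.hδ
        (h.mono (by linarith [le_max_right 0 (r + wl S k + 2 * δ)]))
      exact h2.mono (by linarith)
    · have e : B.smul (x * k) ⁻¹' Aᶜ = B.smul k ⁻¹' (B.smul x ⁻¹' Aᶜ) := by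
        ext ω; simp only [Set.mem_preimage]; rw [smul_mul X.hS]
      rw [e]
      refine (hLk _ (X.meas_smul x hA.compl)).trans ?_
      calc L * ν (B.smul x ⁻¹' Aᶜ) ≤ L * (ε / L) := by gcongr; exact hx2.trans (min_le_right _ _)
        _ = ε := ENNReal.mul_div_cancel hL0.ne' hL
  · exact ⟨x, by omega, h, hx2.trans (min_le_left _ _)⟩

end MCtx

end Part15

section Part16


/-- `a` and `b` agree up to the factor `e` -/
def ap (e a b : ℝ) : Prop := a ≤ e * b ∧ b ≤ e * a

lemma ap.symm' {e a b : ℝ} (h : ap e a b) : ap e b a := ⟨h.2, h.1⟩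

lemma ap.mul' {e f a b c d : ℝ} (h : ap e a b) (h' : ap f c d) (ha : 0 < a) (hb : 0 < b) (hc : 0 < c)
    (hd : 0 < d) : ap (e * f) (a * c) (b * d) := by
  refine ⟨?_, ?_⟩
  · calc a * c ≤ (e * b) * (f * d) := mul_le_mul h.1 h'.1 hc.le (ha.le.trans h.1)
      _ = _ := by ring
  · calc b * d ≤ (e * a) * (f * c) := mul_le_mul h.2 h'.2 hd.le (hb.le.trans h.2)
      _ = _ := by ring

lemma ap.inv' {e a b : ℝ} (h : ap e a b) (ha : 0 < a) (hb : 0 < b) : ap e a⁻¹ b⁻¹ := by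
  refine ⟨?_, ?_⟩
  · rw [← div_eq_mul_inv, inv_le_iff_one_le_mul₀ ha, div_mul_eq_mul_div, le_div_iff₀ hb, one_mul]
    exact h.2
  · rw [← div_eq_mul_inv, inv_le_iff_one_le_mul₀ hb, div_mul_eq_mul_div, le_div_iff₀ ha, one_mul]
    exact h.1

lemma ap.trans' {e f a b c : ℝ} (h : ap e a b) (h' : ap f b c) (he : 0 ≤ e) (hf : 0 ≤ f) :
    ap (e * f) a c := by
  refine ⟨h.1.trans ?_, h'.2.trans ?_⟩
  · rw [mul_assoc]; gcongr; exact h'.1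
  · rw [mul_comm e f, mul_assoc]; gcongr; exact h.2

lemma ap_close {Λ ε : ℝ} (hΛ : 0 < Λ) (hε : 0 < ε) : ∃ e : ℝ, 0 < e ∧ ∀ (a b : ℝ) (k : ℕ), 0 < a → 0 < b →
    a ≤ Λ → k ≤ 4 → ap ((1 + e) ^ k) a b → |b - a| < ε := by
  refine ⟨min 1 (ε / (241 * Λ)), by positivity, fun a b k ha hb haΛ hk h => ?_⟩
  set e := min 1 (ε / (241 * Λ)) with he
  have he0 : 0 < e := by positivity
  have he1 : e ≤ 1 := min_le_left _ _
  have he2 : e * (241 * Λ) ≤ ε := by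
    rw [← le_div_iff₀ (by positivity)]; exact min_le_right _ _
  have hq : (1 + e) ^ k ≤ 1 + 15 * e := by
    calc (1 + e) ^ k ≤ (1 + e) ^ 4 := pow_le_pow_right₀ (by linarith) hk
      _ ≤ 1 + 15 * e := by nlinarith [mul_pos he0 he0, mul_pos (mul_pos he0 he0) he0]
  have h1 : a ≤ (1 + 15 * e) * b := h.1.trans (by gcongr)
  have h2 : b ≤ (1 + 15 * e) * a := h.2.trans (by gcongr)
  have hea : e * a ≤ e * Λ := by gcongr
  have hb2 : b ≤ 16 * a := h2.trans (by gcongr; linarith)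
  have heb : e * b ≤ e * (16 * a) := by gcongr
  have hpos : 0 < e * Λ := by positivity
  rw [abs_lt]
  constructor <;> nlinarith

namespace MCtx

variable {S : Set Γ} {δ : ℝ} {μ : Γ → ℝ} {B : Boundary Γ S} {Kb : Γ → B.pt → ℝ}
  [mB : MeasurableSpace B.pt] {ν : Measure B.pt}

lemma meas_rs (X : MCtx δ μ B Kb ν) (g : Γ) (l ε : ℝ) {A : Set B.pt} (hA : MeasurableSet A) :
    MeasurableSet {ω | ω ∈ A ∧ B.smul g⁻¹ ω ∈ A ∧ |Kb g ω - l| < ε} := by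
  refine hA.inter ((X.meas_smul g⁻¹ hA).inter ?_)
  have h : Measurable fun ω => |Kb g ω - l| := by
    have := (X.meas_K g).sub_const l
    exact continuous_abs.measurable.comp this
  exact measurableSet_lt h measurable_const

lemma rs_one (X : MCtx δ μ B Kb ν) : (1 : ℝ) ∈ ratioSet B ν Kb := by
  refine ⟨zero_le_one, fun ε hε A hA hpos => ⟨1, ?_⟩⟩
  refine lt_of_lt_of_le hpos (measure_mono fun ω hω => ⟨hω, ?_, ?_⟩)
  · rw [inv_one, smul_one]; exact hω
  · rw [X.K_one, sub_self, abs_zero]; exact hε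

lemma rs_mul (X : MCtx δ μ B Kb ν) {l l' : ℝ} (hl : l ∈ ratioSet B ν Kb) (hl' : l' ∈ ratioSet B ν Kb) :
    l * l' ∈ ratioSet B ν Kb := by
  refine ⟨mul_nonneg hl.1 hl'.1, fun ε hε A hA hpos => ?_⟩
  have hcont : ContinuousAt (fun p : ℝ × ℝ => p.1 * p.2) (l, l') := continuous_mul.continuousAt
  obtain ⟨d, hd, hd'⟩ := Metric.continuousAt_iff.1 hcont ε hε
  obtain ⟨g, hg⟩ := hl.2 d hd A hA hpos
  set A1 := {ω | ω ∈ A ∧ B.smul g⁻¹ ω ∈ A ∧ |Kb g ω - l| < d} with hA1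
  have mA1 : MeasurableSet A1 := X.meas_rs g l d hA
  obtain ⟨k, hk⟩ := hl'.2 d hd (B.smul g ⁻¹' A1) (X.meas_smul g mA1) (X.pos_smul g mA1 hg)
  have hk2 := X.pos_smul g⁻¹ (X.meas_rs k l' d (X.meas_smul g mA1)) hk
  refine ⟨g * k, lt_of_lt_of_le hk2 (measure_mono ?_)⟩
  rintro ω ⟨h1, h2, h3⟩
  rw [Set.mem_preimage, smul_inv_smul X.hS] at h1
  rw [Set.mem_preimage] at h2
  refine ⟨h1.1, ?_, ?_⟩
  · rw [mul_inv_rev, smul_mul X.hS]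
    have := h2.2.1
    rwa [inv_smul_smul X.hS] at this
  · rw [X.cocycle]
    have := hd' (x := (Kb g ω, Kb k (B.smul g⁻¹ ω))) (by
      rw [Prod.dist_eq]
      exact max_lt (by rw [Real.dist_eq]; exact h1.2.2) (by rw [Real.dist_eq]; exact h3))
    rwa [Real.dist_eq] at this

lemma rs_inv (X : MCtx δ μ B Kb ν) {l : ℝ} (hl : l ∈ ratioSet B ν Kb) (h0 : 0 < l) :
    l⁻¹ ∈ ratioSet B ν Kb := by
  refine ⟨inv_nonneg.2 hl.1, fun ε hε A hA hpos => ?_⟩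
  have hcont : ContinuousAt (fun p : ℝ => p⁻¹) l := continuousAt_inv₀ h0.ne'
  obtain ⟨d, hd, hd'⟩ := Metric.continuousAt_iff.1 hcont ε hε
  obtain ⟨g, hg⟩ := hl.2 d hd A hA hpos
  have hk2 := X.pos_smul g (X.meas_rs g l d hA) hg
  refine ⟨g⁻¹, lt_of_lt_of_le hk2 (measure_mono ?_)⟩
  rintro ω ⟨h1, h2, h3⟩
  rw [inv_smul_smul X.hS] at h2
  refine ⟨h2, by rwa [inv_inv], ?_⟩
  rw [X.K_inv]
  have := hd' (x := Kb g (B.smul g ω)) (by rw [Real.dist_eq]; exact h3)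
  rwa [Real.dist_eq] at this

lemma rs_closed (X : MCtx δ μ B Kb ν) {l : ℝ} (h0 : 0 ≤ l) (h : ∀ ε > 0, ∃ l' ∈ ratioSet B ν Kb, |l' - l| < ε) :
    l ∈ ratioSet B ν Kb := by
  refine ⟨h0, fun ε hε A hA hpos => ?_⟩
  obtain ⟨l', hl', hd⟩ := h (ε / 2) (by linarith)
  obtain ⟨g, hg⟩ := hl'.2 (ε / 2) (by linarith) A hA hpos
  refine ⟨g, lt_of_lt_of_le hg (measure_mono ?_)⟩
  rintro ω ⟨h1, h2, h3⟩
  refine ⟨h1, h2, ?_⟩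
  have := abs_add_le (Kb g ω - l') (l' - l)
  rw [sub_add_sub_cancel] at this
  linarith

/-- a positive measure neighbourhood of `ξ` -/
lemma exists_W (X : MCtx δ μ B Kb ν) (ξ : B.pt) (r : ℝ) : ∃ W : Set B.pt, MeasurableSet W ∧ 0 < ν W ∧
    ∀ q ∈ W, near B q ξ r := by
  obtain ⟨W, h1, h2, h3, h4, h5⟩ := X.exists_nbhds ξ
  obtain ⟨m, hm⟩ := h4 r
  obtain ⟨r', hr'⟩ := h3 m
  exact ⟨W m, h1 m, X.full_support ξ (h1 m) hr', hm⟩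

lemma rfun_pos (X : MCtx δ μ B Kb ν) (g : Γ) : 0 < rfun B Kb g := by
  unfold rfun
  split_ifs
  · exact zero_lt_one
  · exact X.pos _ _

lemma K_plus_mem (X : MCtx δ μ B Kb ν) {g : Γ} (hg : Lox S g) :
    Kb g (plusPt B g) ∈ ratioSet B ν Kb := by
  have hδ0 := X.hδ.1
  have := X.hν
  set lam := Kb g (plusPt B g) with hlam
  have hl0 : 0 < lam := X.pos _ _
  refine ⟨hl0.le, fun ε hε A hA hpos => ?_⟩
  have hfix := smul_plus X.hS X.hδ B hg
  have hfix' : B.smul g⁻¹ (plusPt B g) = plusPt B g := by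
    conv_lhs => rw [← hfix]
    rw [inv_smul_smul X.hS]
  obtain ⟨e, he, hap⟩ := ap_close hl0 hε
  obtain ⟨R, hR, hX⟩ := X.lemX (plusPt B g)
  obtain ⟨M, hM⟩ := X.lemH he hR
  obtain ⟨M', hM'⟩ := X.unif_near g he
  set r0 := max M M'
  obtain ⟨W, hW1, hW2, hW3⟩ := X.exists_W (plusPt B g) (r0 + wl S g + 2 * δ)
  obtain ⟨L, hL0, hL, hLg⟩ := X.smul_bound g⁻¹
  have hνW := measure_ne_top ν W
  have h1L : 1 + L ≠ ⊤ := ENNReal.add_ne_top.2 ⟨ENNReal.one_ne_top, hL⟩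
  have h1L0 : 1 + L ≠ 0 := (lt_of_lt_of_le zero_lt_one le_self_add).ne'
  set ε' := ν W / 2 / (1 + L) with hε'
  have hε0 : 0 < ε' := ENNReal.div_pos (ENNReal.div_pos hW2.ne' (by norm_num)).ne' h1L
  have hεt : ε' ≠ ⊤ := ENNReal.div_ne_top (ENNReal.div_ne_top hνW (by norm_num)) h1L0
  have hsum : ε' + L * ε' < ν W := by
    calc ε' + L * ε' = (1 + L) * (ν W / 2 / (1 + L)) := by rw [hε']; ring
      _ = ν W / 2 := ENNReal.mul_div_cancel h1L0 h1L
      _ < ν W := ENNReal.half_lt_self hW2.ne' hνW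
  obtain ⟨x, -, hx1, hx2⟩ := hX A hA hpos ε' hε0 hεt 0
  have mA' := X.meas_smul x hA
  have mA'' := X.meas_smul g⁻¹ mA'
  set E := W ∩ (B.smul x ⁻¹' A ∩ B.smul g⁻¹ ⁻¹' (B.smul x ⁻¹' A)) with hE
  have mE : MeasurableSet E := hW1.inter (mA'.inter mA'')
  have hEpos : 0 < ν E := by
    rw [pos_iff_ne_zero]
    intro h0
    have hsub : W ⊆ E ∪ (B.smul x ⁻¹' Aᶜ ∪ B.smul g⁻¹ ⁻¹' (B.smul x ⁻¹' Aᶜ)) := by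
      intro ω hω
      by_cases h1 : B.smul x ω ∈ A
      · by_cases h2 : B.smul x (B.smul g⁻¹ ω) ∈ A
        · left; exact ⟨hω, h1, h2⟩
        · right; right; exact h2
      · right; left; exact h1
    have := calc ν W ≤ ν E + (ν (B.smul x ⁻¹' Aᶜ) + ν (B.smul g⁻¹ ⁻¹' (B.smul x ⁻¹' Aᶜ))) :=
          (measure_mono hsub).trans ((measure_union_le _ _).trans (by gcongr; exact measure_union_le _ _))
      _ ≤ 0 + (ε' + L * ε') := by
          rw [h0]; gcongr
          refine (hLg _ (X.meas_smul x hA.compl)).trans ?_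
          gcongr
      _ = ε' + L * ε' := zero_add _
    exact absurd this (not_le.2 hsum)
  refine ⟨x * g * x⁻¹, lt_of_lt_of_le (X.pos_smul x⁻¹ mE hEpos) (measure_mono ?_)⟩
  intro ω hω
  set ω' := B.smul x⁻¹ ω with hω'
  have hωx : B.smul x ω' = ω := smul_inv_smul X.hS B x ω
  obtain ⟨h1, h2, h3⟩ := (hω : ω' ∈ E)
  rw [Set.mem_preimage, hωx] at h2
  rw [Set.mem_preimage, Set.mem_preimage] at h3
  refine ⟨h2, ?_, ?_⟩
  · rw [mul_inv_rev, mul_inv_rev, inv_inv, smul_mul X.hS, smul_mul X.hS]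
    exact h3
  · have hn := hW3 ω' h1
    have hw := Nat.cast_nonneg (α := ℝ) (wl S g)
    have hn1 : near B ω' (plusPt B g) r0 := hn.mono (by linarith)
    have hn2 : near B (B.smul g⁻¹ ω') (plusPt B g) r0 := by
      have := hn.smul X.hS X.hδ g⁻¹
      rw [hfix', wl_inv X.hS] at this
      exact this.mono (by linarith)
    have hK : Kb (x * g * x⁻¹) ω = (Kb x⁻¹ ω')⁻¹ * (Kb g ω' * Kb x⁻¹ (B.smul g⁻¹ ω')) := by
      rw [mul_assoc, X.cocycle, ← hω', X.cocycle, X.K_inv x ω', hωx, inv_inv]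
    have a1 : ap (1 + e) (Kb x⁻¹ (plusPt B g)) (Kb x⁻¹ ω') :=
      hM _ _ _ hx1 ((hn1.symm' X.hS).mono (le_max_left _ _))
    have a2 : ap (1 + e) (Kb x⁻¹ (plusPt B g)) (Kb x⁻¹ (B.smul g⁻¹ ω')) :=
      hM _ _ _ hx1 ((hn2.symm' X.hS).mono (le_max_left _ _))
    have a3 : ap (1 + e) lam (Kb g ω') :=
      ⟨hM' _ _ ((hn1.symm' X.hS).mono (le_max_right _ _)), hM' _ _ (hn1.mono (le_max_right _ _))⟩
    have p1 := X.pos x⁻¹ (plusPt B g)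
    have p2 := X.pos x⁻¹ ω'
    have p3 := X.pos x⁻¹ (B.smul g⁻¹ ω')
    have p4 := X.pos g ω'
    have a4 := (a1.inv' p1 p2).mul' (a3.mul' a2 hl0 p4 p1 p3) (by positivity) (by positivity)
      (by positivity) (by positivity)
    rw [← hK] at a4
    refine hap _ _ 3 hl0 (X.pos _ _) le_rfl (by norm_num) ?_
    convert a4 using 1
    · ring
    · field_simp

lemma rfun_mem (X : MCtx δ μ B Kb ν) (g : Γ) : rfun B Kb g ∈ ratioSet B ν Kb := by
  by_cases h : IsOfFinOrder g
  · rw [rfun, if_pos h]; exact X.rs_one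
  · rw [rfun, if_neg h]
    have hg := lox_of_inf X.hS X.hδ h
    rw [X.K_inv, smul_plus X.hS X.hδ B hg]
    exact X.rs_inv (X.K_plus_mem hg) (X.pos _ _)

end MCtx

end Part16



namespace MCtx

variable {S : Set Γ} {δ : ℝ} {μ : Γ → ℝ} {B : Boundary Γ S} {Kb : Γ → B.pt → ℝ}
  [mB : MeasurableSpace B.pt] {ν : Measure B.pt}

lemma lemC (X : MCtx δ μ B Kb ν) (P : B.pt) {e R : ℝ} (he : 0 < e) (hR : 0 ≤ R) :
    ∃ (r0 : ℝ) (N : ℕ), ∀ (b : Γ) (η : B.pt), N ≤ wl S b → ¬ Lb B b⁻¹ P R → near B η P r0 →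
      near B (B.smul b η) P r0 → ap ((1 + e) ^ 2) (Kb b⁻¹ η) (rfun B Kb b) := by
  have hδ0 := X.hδ.1
  obtain ⟨M, hM⟩ := X.lemH he hR
  have hMa := le_abs_self M
  have hMb := abs_nonneg M
  set r0 := |M| + R + 4 * δ with hr0
  obtain ⟨N, hN⟩ := exists_nat_ge (2 * r0 + 2 * R + 6 * δ + 1)
  refine ⟨r0, N, fun b η hb hbP h1 h2 => ?_⟩
  have hn : (N : ℝ) ≤ wl S b := by exact_mod_cast hb
  have h3 : ¬ Lb B b⁻¹ η (R + δ) := fun h =>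
    hbP ((h.near_trans X.hS X.hδ (h1.mono (by linarith))).mono (by linarith))
  have h4 : Lb B b (B.smul b η) r0 := (Lb_smul_of_far X.hS X.hδ h3).mono (by linarith)
  have h5 : Lb B b P (r0 - δ) := h4.near_trans X.hS X.hδ h2
  have h6 : gp S 1 b⁻¹ b < R + δ := by
    by_contra hc
    rw [not_lt] at hc
    exact hbP (((h5.mono (r' := R + δ) (by linarith)).left_trans X.hS X.hδ hc).mono (by linarith))
  have e1 : dd S b⁻¹ b = dd S 1 (b ^ 2) := by
    rw [← dd_left S b, mul_inv_cancel, pow_two]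
  rw [gp_eq, dd_one_right X.hS, dd_one_right X.hS, wl_inv X.hS, e1] at h6
  have hgr : dd S 1 b + 4 * δ + 1 ≤ dd S 1 (b ^ 2) := by
    rw [dd_one_left]; linarith
  have hl := lox_of_growth X.hS X.hδ hgr
  have h7 : Lb B b (plusPt B b) (wl S b / 2 - δ) := by
    refine Lb_of_seq X.hS X.hδ hl.convInf rfl (Filter.Eventually.frequently ?_)
    filter_upwards [eventually_ge_atTop 2] with k hk
    obtain ⟨j, rfl⟩ : ∃ j, k = j + 1 := ⟨k - 1, by omega⟩
    have := lox_growth X.hS X.hδ hgr j (by omega)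
    rw [gp_eq, dd_one_right X.hS, dd_comm X.hS _ 1]
    have e2 : dd S b (b ^ (j + 1)) = dd S 1 (b ^ j) := by
      rw [← dd_left S b 1 (b ^ j), mul_one, pow_succ']
    rw [e2]
    linarith
  have h8 : near B P (plusPt B b) (r0 - δ - δ) :=
    h5.near_of X.hS X.hδ (h7.mono (by linarith))
  have a1 : ap (1 + e) (Kb b⁻¹ P) (Kb b⁻¹ η) := hM _ _ _ hbP ((h1.symm' X.hS).mono (by linarith))
  have a2 : ap (1 + e) (Kb b⁻¹ P) (Kb b⁻¹ (plusPt B b)) := hM _ _ _ hbP (h8.mono (by linarith))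
  rw [rfun, if_neg (hl.not_fin X.hS), pow_two]
  exact a1.symm'.trans' a2 (by linarith) (by linarith)

lemma goal1 (X : MCtx δ μ B Kb ν) {l : ℝ} (hl : l ∈ ratioSet B ν Kb) {ε : ℝ} (hε : 0 < ε) :
    ∃ a b : Γ, |rfun B Kb b * (rfun B Kb a)⁻¹ - l| < ε := by
  have hδ0 := X.hδ.1
  have := X.hν
  have hcount := Γ_countable X.hS
  obtain ⟨p, hp⟩ := exists_inf X.hS X.hδ X.hne
  set P := plusPt B p
  have hl0 := hl.1
  obtain ⟨R, hR, hX⟩ := X.lemX P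
  obtain ⟨e, he, hap⟩ := ap_close (Λ := l + 1) (by linarith) (half_pos hε)
  obtain ⟨r0, N, hC⟩ := X.lemC P he (R := R + δ) (by linarith)
  obtain ⟨W, hW1, hW2, hW3⟩ := X.exists_W P r0
  set D : ℕ → Set B.pt := fun n => ⋃ (b : Γ) (_ : n ≤ wl S b ∧ ¬ Lb B b⁻¹ P R), B.smul b⁻¹ ⁻¹' W with hD
  have mD : ∀ n, MeasurableSet (D n) := fun n =>
    MeasurableSet.iUnion fun b => MeasurableSet.iUnion fun _ => X.meas_smul b⁻¹ hW1
  have hDn : ∀ n, ν (D n)ᶜ = 0 := by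
    intro n
    by_contra h0
    obtain ⟨x, hx1, hx2, hx3⟩ := hX (D n)ᶜ (mD n).compl (pos_iff_ne_zero.2 h0) (ν W / 2)
      (ENNReal.div_pos hW2.ne' (by norm_num)) (ENNReal.div_ne_top (measure_ne_top ν W) (by norm_num)) n
    have hsub : W ⊆ B.smul x ⁻¹' (D n)ᶜᶜ := by
      intro ω hω
      rw [compl_compl]
      refine Set.mem_iUnion₂.2 ⟨x, ⟨hx1, hx2⟩, ?_⟩
      rw [Set.mem_preimage, inv_smul_smul X.hS]; exact hω
    exact absurd ((measure_mono hsub).trans hx3) (not_le.2 (ENNReal.half_lt_self hW2.ne' (measure_ne_top ν W)))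
  set A := W ∩ ⋂ n, D n with hA
  have mA : MeasurableSet A := hW1.inter (MeasurableSet.iInter mD)
  have hApos : 0 < ν A := by
    have h0 : ν (⋂ n, D n)ᶜ = 0 := by
      rw [Set.compl_iInter]; exact measure_iUnion_null hDn
    rw [hA, measure_inter_conull h0]; exact hW2
  obtain ⟨g, hg⟩ := hl.2 (min 1 (ε / 2)) (by positivity) A mA hApos
  obtain ⟨ω, h1, h2, h3⟩ := nonempty_of_measure_ne_zero hg.ne'
  obtain ⟨N', hN'⟩ := exists_nat_ge (N + wl S g + R + δ)
  obtain ⟨b, ⟨hb1, hb2⟩, hb3⟩ := Set.mem_iUnion₂.1 (Set.mem_iInter.1 h2.2 N')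
  set η := B.smul b⁻¹ (B.smul g⁻¹ ω) with hη
  have hb1' : (N' : ℝ) ≤ wl S b := by exact_mod_cast hb1
  have hwg := Nat.cast_nonneg (α := ℝ) (wl S g)
  have hNn := Nat.cast_nonneg (α := ℝ) N
  have hbη : B.smul b η = B.smul g⁻¹ ω := smul_inv_smul X.hS B b _
  have haη : B.smul (g * b) η = ω := by rw [smul_mul X.hS, hbη, smul_inv_smul X.hS]
  have hηW : near B η P r0 := hW3 _ hb3
  have hbN : N ≤ wl S b := by
    have : (N : ℝ) ≤ wl S b := by linarith
    exact_mod_cast this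
  have haN : N ≤ wl S (g * b) := by
    have h4 : wl S b ≤ wl S g + wl S (g * b) := by
      have := wl_mul X.hS g⁻¹ (g * b)
      rwa [inv_mul_cancel_left, wl_inv X.hS] at this
    have h5 : (wl S b : ℝ) ≤ wl S g + wl S (g * b) := by exact_mod_cast h4
    have : (N : ℝ) ≤ wl S (g * b) := by linarith
    exact_mod_cast this
  have hb2' : ¬ Lb B b⁻¹ P (R + δ) := fun h => hb2 (h.mono (by linarith))
  have ha2 : ¬ Lb B (g * b)⁻¹ P (R + δ) := by
    intro h
    have h4 := gp_lip X.hS 1 b⁻¹ (g * b)⁻¹ b⁻¹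
    have h5 : dd S b⁻¹ (g * b)⁻¹ = wl S g := by
      rw [mul_inv_rev, show b⁻¹ = b⁻¹ * 1 by rw [mul_one], mul_assoc, dd_left, one_mul, dd_one_left, wl_inv X.hS]
    rw [h5, gp_eq, dd_self, dd_one_right X.hS, wl_inv X.hS, gp_comm X.hS] at h4
    exact hb2 ((h.left_trans X.hS X.hδ (y := b⁻¹) (by linarith)).mono (by linarith))
  have c1 := hC b η hbN hb2' hηW (by rw [hbη]; exact hW3 _ h2.1)
  have c2 := hC (g * b) η haN ha2 hηW (by rw [haη]; exact hW3 _ h1.1)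
  have p1 := X.pos b⁻¹ η
  have p2 := X.pos (g * b)⁻¹ η
  have p3 := X.rfun_pos b
  have p4 := X.rfun_pos (g * b)
  have c3 := c1.mul' (c2.inv' p2 p4) p1 p3 (by positivity) (by positivity)
  have hK : Kb g ω = Kb b⁻¹ η * (Kb (g * b)⁻¹ η)⁻¹ := by
    rw [X.K_inv (g * b) η, haη, inv_inv]
    have := X.cocycle (g * b) b⁻¹ ω
    rw [mul_inv_cancel_right] at this
    rw [this, mul_comm, mul_inv_rev, smul_mul X.hS]
  rw [← hK, ← pow_add] at c3
  have h31 := lt_of_lt_of_le h3 (min_le_left _ _)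
  have h32 := lt_of_lt_of_le h3 (min_le_right _ _)
  have h4 := hap _ _ (2 + 2) (X.pos g ω) (by positivity) (by have := (abs_lt.1 h31).2; linarith) (by norm_num) c3
  refine ⟨g * b, b, ?_⟩
  have := abs_add_le (rfun B Kb b * (rfun B Kb (g * b))⁻¹ - Kb g ω) (Kb g ω - l)
  rw [sub_add_sub_cancel] at this
  linarith

lemma goal3 (X : MCtx δ μ B Kb ν) {p : Γ} (hp : ¬ IsOfFinOrder p) : rfun B Kb p ≠ 1 := by
  intro h1
  have hl := lox_of_inf X.hS X.hδ hp
  rw [rfun, if_neg hp] at h1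
  obtain ⟨C, ρ, hC, h0, hρ1, hdec⟩ := X.GE_decay
  obtain ⟨c, C0, hc, hcC⟩ := hl
  set a : ℕ → ℝ := fun n => (GE μ 1 (p ^ n)).toReal with ha
  have hapos : ∀ n, 0 < a n := fun n => GEr_pos X.hμ X.hG _ _
  have hlim : Tendsto (fun n => a (n + 1) / a n) atTop (𝓝 1) := by
    have := X.hKb p⁻¹ (plusPt B p) (fun n => p ^ n) (Lox.convInf ⟨c, C0, hc, hcC⟩) rfl
    rw [h1] at this
    refine this.congr fun n => ?_
    rw [martinK_eq X.hμ X.hG, ← GE_inv μ p p⁻¹ (p ^ n), mul_inv_cancel, ← pow_succ']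
  set θ := ρ ^ c with hθ
  have hθ0 : 0 < θ := Real.rpow_pos_of_pos h0 c
  have hθ1 : θ < 1 := Real.rpow_lt_one h0.le hρ1 hc
  have hbd : ∀ n, a n ≤ C * ρ ^ (-C0) * θ ^ n := by
    intro n
    have h2 : a n ≤ C * ρ ^ (wl S (p ^ n)) :=
      ENNReal.toReal_le_of_le_ofReal (by positivity) (hdec _)
    have h3 := (hcC n n).1
    rw [gp_eq, dd_self, dd_one_right X.hS, min_self] at h3
    have h4 : (ρ ^ (wl S (p ^ n)) : ℝ) ≤ ρ ^ (c * n - C0) := by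
      rw [← Real.rpow_natCast]
      exact Real.rpow_le_rpow_of_exponent_ge h0 hρ1.le (by linarith)
    have h5 : ρ ^ (c * n - C0) = ρ ^ (-C0) * θ ^ n := by
      rw [hθ, ← Real.rpow_natCast, ← Real.rpow_mul h0.le, ← Real.rpow_add h0]; congr 1; ring
    rw [h5] at h4
    calc a n ≤ _ := h2
      _ ≤ C * (ρ ^ (-C0) * θ ^ n) := by gcongr
      _ = _ := by ring
  set t := (1 + θ) / 2 with ht
  have ht0 : 0 < t := by positivity
  have ht1 : t < 1 := by linarith
  have hθt : θ < t := by linarith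
  have hsum : Summable fun n => a n / t ^ n := by
    refine Summable.of_nonneg_of_le (fun n => by have := hapos n; positivity) (fun n => ?_)
      ((summable_geometric_of_lt_one (r := θ / t) (by positivity) ((div_lt_one ht0).2 hθt)).mul_left (C * ρ ^ (-C0)))
    rw [div_pow θ t, ← mul_div_assoc]
    gcongr
    exact hbd n
  refine not_summable_of_ratio_test_tendsto_gt_one (l := 1 / t) ((one_lt_div ht0).2 ht1) ?_ hsum
  have h6 := hlim.div_const t
  refine h6.congr fun n => ?_
  have := hapos n
  have := hapos (n + 1)
  rw [Real.norm_of_nonneg (by positivity), Real.norm_of_nonneg (by positivity), pow_succ]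
  field_simp

lemma list_mem (X : MCtx δ μ B Kb ν) (l : List ℝ)
    (hl : ∀ z ∈ l, (∃ g : Γ, z = rfun B Kb g) ∨ (∃ g : Γ, z⁻¹ = rfun B Kb g)) :
    l.prod ∈ ratioSet B ν Kb := by
  induction l with
  | nil => simpa using X.rs_one
  | cons z l ih =>
    rw [List.prod_cons]
    refine X.rs_mul ?_ (ih fun w hw => hl w (List.mem_cons_of_mem _ hw))
    rcases hl z List.mem_cons_self with ⟨g, hg⟩ | ⟨g, hg⟩
    · rw [hg]; exact X.rfun_mem g
    · rw [← inv_inv z, hg]; exact X.rs_inv (X.rfun_mem g) (X.rfun_pos g)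

end MCtx

theorem ratio_set_of_harmonic_measure
    (Γ : Type) [Group Γ] (S : Set Γ) (δ : ℝ)
    (hS : IsGenSet S) (hδ : IsHyperbolic S δ) (hne : Nonelementary Γ)
    (μ : Γ → ℝ) (hμ : IsRWMeasure S μ)
    (B : Boundary Γ S)
    (Kb : Γ → B.pt → ℝ)
    (hKb : ∀ (x : Γ) (ξ : B.pt) (u : ℕ → Γ), ConvInf S u → B.cls u = ξ →
      Tendsto (fun n => martinK μ x (u n)) atTop (𝓝 (Kb x ξ)))
    [mB : MeasurableSpace B.pt] (hmB : mB = @borel B.pt (btop B))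
    (ν : Measure B.pt) (hν : IsProbabilityMeasure ν)
    (hstat : ∀ A : Set B.pt, MeasurableSet A →
      ν A = ∑' g : Γ, ENNReal.ofReal (μ g) * ν (B.smul g ⁻¹' A))
    (hRN : ∀ (g : Γ) (A : Set B.pt), MeasurableSet A →
      ν (B.smul g ⁻¹' A) = ∫⁻ ω in A, ENNReal.ofReal (Kb g ω) ∂ν) :
    ratioSet B ν Kb \ {0} =
      {x : ℝ | 0 < x ∧ x ∈ closure {y : ℝ | ∃ l : List ℝ,
        (∀ z ∈ l, (∃ g : Γ, z = rfun B Kb g) ∨ (∃ g : Γ, z⁻¹ = rfun B Kb g)) ∧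
        y = l.prod}} ∧
    ratioSet B ν Kb \ {0} ≠ {1} := by
  have hG : ∀ x y, GE μ x y ≠ ⊤ := by
    by_contra hcon
    push Not at hcon
    obtain ⟨a, b, hab⟩ := hcon
    have hm : ∀ x y, martinK μ x y = 0 := by
      intro x y
      by_contra h
      exact GE_finite hμ h a b hab
    have hK0 : ∀ x ξ, Kb x ξ = 0 := by
      intro x ξ
      obtain ⟨u, hu, hc⟩ := B.cls_surj ξ
      have := hKb x ξ u hu hc
      simp only [hm] at this
      exact (tendsto_nhds_unique this tendsto_const_nhds)
    have h := hRN 1 Set.univ MeasurableSet.univ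
    simp [hK0] at h
  have X : MCtx δ μ B Kb ν :=
    { hS := hS, hδ := hδ, hne := hne, hμ := hμ, hG := hG, hKb := hKb, hmB := hmB, hν := hν, hRN := hRN }
  refine ⟨?_, ?_⟩
  · ext x
    constructor
    · rintro ⟨hx, hx0⟩
      refine ⟨lt_of_le_of_ne hx.1 (fun h => hx0 h.symm), ?_⟩
      rw [Metric.mem_closure_iff]
      intro ε hε
      obtain ⟨a, b, hab⟩ := X.goal1 hx hε
      refine ⟨_, ⟨[rfun B Kb b, (rfun B Kb a)⁻¹], ?_, rfl⟩, ?_⟩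
      · intro z hz
        simp only [List.mem_cons, List.not_mem_nil, or_false] at hz
        rcases hz with rfl | rfl
        · exact Or.inl ⟨b, rfl⟩
        · exact Or.inr ⟨a, inv_inv _⟩
      · rw [dist_comm, Real.dist_eq, List.prod_cons, List.prod_singleton]
        exact hab
    · rintro ⟨hx, hcl⟩
      refine ⟨X.rs_closed hx.le fun ε hε => ?_, fun h => hx.ne' h⟩
      obtain ⟨y, ⟨l, hl, rfl⟩, hd⟩ := Metric.mem_closure_iff.1 hcl ε hε
      refine ⟨_, X.list_mem l hl, ?_⟩
      rw [dist_comm, Real.dist_eq] at hd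
      exact hd
  · intro h
    obtain ⟨p, hp⟩ := exists_inf hS hδ hne
    have h1 : rfun B Kb p ∈ ratioSet B ν Kb \ {0} := ⟨X.rfun_mem p, (X.rfun_pos p).ne'⟩
    rw [h] at h1
    exact X.goal3 hp h1

end HarmonicBoundary
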